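/- There exists an absolute constant c > 0 such that: for each n, if the martingale differences (X_i)_{1≤i≤n} satisfy conditions (A1), (A2) with exponent ρ = 1, and (A4) with ρ = 1, and (x_n) is a sequence with x_n ≥ 0 and x_n γ_n → 0 (i.e. x_n = o(γ_n^{-1})), then for all sufficiently large n, P(W_n ≥ x_n)/(1 − Φ(x_n)) ≤ exp{ c ( x_n³ ε_n + x_n² δ_n² + (1 + x_n)( x_n γ_n + γ_n |ln γ_n| + δ_n + ε̂_n(x_n, 1) ) ) }, where ε̂_n(x, 1) = ε_n^{1/4} / (1 + x^{3/4}). The same upper bound holds with P(W_n ≥ x_n)/(1 − Φ(x_n)) replaced by P(W_n ≤ −x_n)/Φ(−x_n). -/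

import Mathlib

open MeasureTheory Filter
open scoped Topology ENNReal

noncomputable def stdNormalCDF (x : ℝ) : ℝ :=
  (Real.sqrt (2 * Real.pi))⁻¹ * ∫ t in Set.Iic x, Real.exp (-(t ^ 2) / 2)

/-- A finite sequence of square-integrable martingale differences
`X 1, ..., X n` adapted to a filtration `F 0 ⊆ F 1 ⊆ ... ⊆ F n`, with
`F 0` trivial, `E[X i | F (i-1)] = 0` and `0 < E[(X i)^2] < ∞`. -/
structure MDS (Ω : Type) [mΩ : MeasurableSpace Ω] (P : Measure Ω) where
  n : ℕ
  npos : 0 < n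
  F : ℕ → MeasurableSpace Ω
  F_mono : Monotone F
  F_le : ∀ i, F i ≤ mΩ
  F_zero : F 0 = ⊥
  X : ℕ → Ω → ℝ
  meas : ∀ i, 1 ≤ i → i ≤ n → StronglyMeasurable[F i] (X i)
  sq_int : ∀ i, 1 ≤ i → i ≤ n → Integrable (fun ω => (X i ω) ^ 2) P
  mean_zero : ∀ i, 1 ≤ i → i ≤ n → P[X i|F (i - 1)] =ᵐ[P] 0
  var_pos : ∀ i, 1 ≤ i → i ≤ n → 0 < ∫ ω, (X i ω) ^ 2 ∂P

namespace MDS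

variable {Ω : Type} [mΩ : MeasurableSpace Ω] {P : Measure Ω}

/-- `S_n = ∑_{i=1}^n X_i`. -/
noncomputable def S (A : MDS Ω P) : Ω → ℝ := fun ω => ∑ i ∈ Finset.Icc 1 A.n, A.X i ω

/-- `B_n² = ∑_{i=1}^n E[X_i²]`. -/
noncomputable def Bsq (A : MDS Ω P) : ℝ := ∑ i ∈ Finset.Icc 1 A.n, ∫ ω, (A.X i ω) ^ 2 ∂P

/-- `[S]_n = ∑_{i=1}^n X_i²`. -/
noncomputable def QV (A : MDS Ω P) : Ω → ℝ := fun ω => ∑ i ∈ Finset.Icc 1 A.n, (A.X i ω) ^ 2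

/-- `⟨S⟩_n = ∑_{i=1}^n E[X_i² | F_{i-1}]`. -/
noncomputable def CV (A : MDS Ω P) : Ω → ℝ :=
  fun ω => ∑ i ∈ Finset.Icc 1 A.n, (P[fun ω' => (A.X i ω') ^ 2|A.F (i - 1)]) ω

/-- `W_n = S_n / √[S]_n`. -/
noncomputable def W (A : MDS Ω P) : Ω → ℝ := fun ω => A.S ω / Real.sqrt (A.QV ω)

/-- Condition (A1): `|⟨S⟩_n − B_n²| ≤ δ² B_n²` a.s., with `δ ∈ [0, 1/4]`. -/
def CondA1 (A : MDS Ω P) (δ : ℝ) : Prop :=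
  0 ≤ δ ∧ δ ≤ 1 / 4 ∧ ∀ᵐ ω ∂P, |A.CV ω - A.Bsq| ≤ δ ^ 2 * A.Bsq

/-- Condition (A2): `∑_{i=1}^n E[|X_i|^{2+ρ} | F_{i-1}] ≤ ε^ρ B_n^{2+ρ}` a.s.,
with `ε ∈ (0, 1/4]`. -/
def CondA2 (A : MDS Ω P) (ρ ε : ℝ) : Prop :=
  0 < ε ∧ ε ≤ 1 / 4 ∧
    (∀ i, 1 ≤ i → i ≤ A.n → Integrable (fun ω => |A.X i ω| ^ (2 + ρ)) P) ∧
    ∀ᵐ ω ∂P,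
      ∑ i ∈ Finset.Icc 1 A.n, (P[fun ω' => |A.X i ω'| ^ (2 + ρ)|A.F (i - 1)]) ω ≤
        ε ^ ρ * A.Bsq ^ ((2 + ρ) / 2)

/-- Condition (A3): `E[X_i² | F_{i-1}] ≤ κ² B_n²` a.s. for each `i`, with `κ ∈ (0, 1/4]`. -/
def CondA3 (A : MDS Ω P) (κ : ℝ) : Prop :=
  0 < κ ∧ κ ≤ 1 / 4 ∧
    ∀ i, 1 ≤ i → i ≤ A.n →
      ∀ᵐ ω ∂P, (P[fun ω' => (A.X i ω') ^ 2|A.F (i - 1)]) ω ≤ κ ^ 2 * A.Bsq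

/-- Condition (A4): `E[|X_i|^{2+ρ} | F_{i-1}] ≤ (γ B_n)^ρ E[X_i² | F_{i-1}]` a.s.
for each `i`, with `γ ∈ (0, 1/4]`. -/
def CondA4 (A : MDS Ω P) (ρ γ : ℝ) : Prop :=
  0 < γ ∧ γ ≤ 1 / 4 ∧
    (∀ i, 1 ≤ i → i ≤ A.n → Integrable (fun ω => |A.X i ω| ^ (2 + ρ)) P) ∧
    ∀ i, 1 ≤ i → i ≤ A.n →
      ∀ᵐ ω ∂P,
        (P[fun ω' => |A.X i ω'| ^ (2 + ρ)|A.F (i - 1)]) ω ≤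
          (γ * Real.sqrt A.Bsq) ^ ρ * (P[fun ω' => (A.X i ω') ^ 2|A.F (i - 1)]) ω

end MDS


set_option linter.unusedVariables false
set_option linter.unusedSectionVars false

namespace SN

noncomputable def G (u : ℝ) : ℝ := Real.exp (-(u ^ 2) / 2)
noncomputable def cpi : ℝ := (Real.sqrt (2 * Real.pi))⁻¹
noncomputable def Nt (u : ℝ) : ℝ := 1 - stdNormalCDF u
noncomputable def psi (u : ℝ) : ℝ := 1 / (1 + u ^ 2)

lemma cpi_pos : 0 < cpi := by unfold cpi; positivity
lemma cpi_le_one : cpi ≤ 1 := by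
  unfold cpi
  apply inv_le_one_of_one_le₀
  rw [Real.one_le_sqrt]
  nlinarith [Real.pi_gt_three]

lemma cpi_ge : 1 / 3 ≤ cpi := by
  unfold cpi
  rw [one_div]
  apply inv_anti₀ (by positivity)
  rw [Real.sqrt_le_left (by norm_num)]
  nlinarith [Real.pi_lt_d2]

lemma G_pos (u : ℝ) : 0 < G u := Real.exp_pos _
lemma G_le_one (u : ℝ) : G u ≤ 1 := by
  unfold G; rw [Real.exp_le_one_iff]; nlinarith [sq_nonneg u]
lemma G_neg (u : ℝ) : G (-u) = G u := by unfold G; simp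
lemma psi_pos (u : ℝ) : 0 < psi u := by unfold psi; positivity
lemma psi_le_one (u : ℝ) : psi u ≤ 1 := by
  unfold psi; rw [div_le_one (by positivity)]; nlinarith [sq_nonneg u]

lemma G_cont : Continuous G := by unfold G; fun_prop

lemma G_integrable : Integrable G := by
  have := integrable_exp_neg_mul_sq (b := 1/2) (by norm_num)
  refine this.congr (ae_of_all _ fun x => ?_)
  simp only [G]; congr 1; ring

lemma G_integral : cpi * ∫ u, G u = 1 := by
  have h := integral_gaussian (1/2)
  have e : (fun x : ℝ => Real.exp (-(1/2) * x ^ 2)) = G := by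
    funext x; simp only [G]; congr 1; ring
  rw [e] at h
  rw [h]; unfold cpi
  rw [show Real.pi / (1/2) = 2 * Real.pi by ring]
  apply inv_mul_cancel₀
  positivity

lemma cdf_eq (x : ℝ) : stdNormalCDF x = cpi * ∫ t in Set.Iic x, G t := rfl

lemma Nt_eq (x : ℝ) : Nt x = cpi * ∫ t in Set.Ioi x, G t := by
  have h := integral_add_compl (s := Set.Iic x) (f := G) (μ := volume) measurableSet_Iic G_integrable
  rw [Set.compl_Iic] at h
  have := G_integral
  rw [← h] at this
  unfold Nt; rw [cdf_eq]; linarith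

lemma Nt_hasDerivAt (x : ℝ) : HasDerivAt Nt (-(cpi * G x)) x := by
  have h1 : ∀ y, Nt y = Nt 0 - cpi * ∫ t in (0:ℝ)..y, G t := by
    intro y
    have := intervalIntegral.integral_Iic_sub_Iic (μ := volume) (f := G) (a := 0) (b := y)
      G_integrable.integrableOn G_integrable.integrableOn
    unfold Nt; rw [cdf_eq, cdf_eq, ← this]; ring
  have h2 : HasDerivAt (fun y => ∫ t in (0:ℝ)..y, G t) (G x) x :=
    intervalIntegral.integral_hasDerivAt_right (G_cont.intervalIntegrable _ _)
      G_cont.aestronglyMeasurable.stronglyMeasurableAtFilter G_cont.continuousAt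
  have h3 := (h2.const_mul cpi).const_sub (Nt 0)
  refine h3.congr_of_eventuallyEq (Eventually.of_forall h1)

lemma Nt_nonneg (x : ℝ) : 0 ≤ Nt x := by
  rw [Nt_eq]
  exact mul_nonneg cpi_pos.le (setIntegral_nonneg measurableSet_Ioi fun t _ => (G_pos t).le)

lemma cdf_nonneg (x : ℝ) : 0 ≤ stdNormalCDF x := by
  rw [cdf_eq]
  exact mul_nonneg cpi_pos.le (setIntegral_nonneg measurableSet_Iic fun t _ => (G_pos t).le)

lemma Nt_le_one (x : ℝ) : Nt x ≤ 1 := by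
  have := cdf_nonneg x; unfold Nt; linarith

lemma cdf_neg (x : ℝ) : stdNormalCDF (-x) = Nt x := by
  rw [Nt_eq, cdf_eq]
  congr 1
  have := integral_comp_neg_Iic (-x) G
  simp only [G_neg, neg_neg] at this
  exact this

lemma Nt_neg (x : ℝ) : Nt (-x) = 1 - Nt x := by
  rw [← cdf_neg x]; rfl

/-- mean value form -/
lemma Nt_mvt {a b : ℝ} (h : a < b) : ∃ c ∈ Set.Ioo a b, Nt a - Nt b = cpi * G c * (b - a) := by
  obtain ⟨c, hc, h1⟩ := exists_hasDerivAt_eq_slope Nt (fun x => -(cpi * G x)) h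
    (fun x _ => (Nt_hasDerivAt x).continuousAt.continuousWithinAt) (fun x _ => Nt_hasDerivAt x)
  refine ⟨c, hc, ?_⟩
  have : b - a ≠ 0 := by linarith
  field_simp at h1
  linarith

lemma Nt_anti {a b : ℝ} (h : a ≤ b) : Nt b ≤ Nt a := by
  rcases h.eq_or_lt with rfl | h
  · exact le_rfl
  · obtain ⟨c, _, hc⟩ := Nt_mvt h
    have : 0 ≤ cpi * G c * (b - a) :=
      mul_nonneg (mul_nonneg cpi_pos.le (G_pos c).le) (by linarith)
    linarith

lemma G_anti {a b : ℝ} (h : a ^ 2 ≤ b ^ 2) : G b ≤ G a := by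
  unfold G; apply Real.exp_le_exp.2; linarith

/-- Mills ratio lower bound. -/
lemma mills {x : ℝ} (hx : 0 ≤ x) : G x ≤ 15 * (1 + x) * Nt x := by
  have hp : (0:ℝ) < 1 / (1 + x) := by positivity
  obtain ⟨c, hc, h⟩ := Nt_mvt (a := x) (b := x + 1 / (1 + x)) (by linarith)
  have h0 := Nt_nonneg (x + 1 / (1 + x))
  have hb : (x + 1 / (1 + x)) ^ 2 ≤ x ^ 2 + 3 := by
    have h1 : x * (1 / (1 + x)) ≤ 1 := by
      rw [mul_one_div, div_le_one (by positivity)]; linarith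
    have h2 : (1 / (1 + x)) ≤ 1 := by
      rw [div_le_one (by positivity)]; linarith
    nlinarith
  have hG : G x * Real.exp (-(3/2)) ≤ G c := by
    have : G (x + 1 / (1 + x)) ≤ G c := by
      apply G_anti
      have := hc.1; have := hc.2
      nlinarith
    refine le_trans ?_ this
    unfold G; rw [← Real.exp_add]; apply Real.exp_le_exp.2
    linarith
  have he : (1:ℝ)/5 ≤ Real.exp (-(3/2)) := by
    rw [Real.exp_neg, one_div]
    apply inv_anti₀ (Real.exp_pos _)
    have h1 : Real.exp (3/2) ^ 2 = Real.exp 1 ^ 3 := by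
      rw [← Real.exp_nat_mul, ← Real.exp_nat_mul]; congr 1; norm_num
    have h2 := Real.exp_one_lt_d9
    have h3 : Real.exp 1 ^ 3 ≤ 2.7182818286 ^ 3 := by
      gcongr
    nlinarith [Real.exp_pos (3/2)]
  have e : x + 1 / (1 + x) - x = 1 / (1 + x) := by ring
  rw [e] at h
  have h5 : Nt x ≥ cpi * G c * (1 / (1 + x)) := by linarith
  have h6 : 15 * (1 + x) * Nt x ≥ 15 * (1 + x) * (cpi * G c * (1 / (1 + x))) := by gcongr
  have h7 : 15 * (1 + x) * (cpi * G c * (1 / (1 + x))) = 15 * cpi * G c := by field_simp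
  have := cpi_ge
  have := G_pos x
  have := G_pos c
  nlinarith [mul_le_mul_of_nonneg_left he (G_pos x).le]

lemma Nt_pos (x : ℝ) : 0 < Nt x := by
  rcases le_or_gt 0 x with h | h
  · have := mills h; have := G_pos x
    by_contra hn
    have : Nt x ≤ 0 := not_lt.1 hn
    nlinarith
  · have := mills (le_refl (0:ℝ)); have := G_pos 0
    have := Nt_anti h.le
    nlinarith

/-- polynomial domination of Gaussian -/
lemma exp_quarter_le {a : ℝ} (ha : 0 ≤ a) : Real.exp (-a / 4) ≤ 65536 / (1 + a) ^ 4 := by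
  have h1 : 1 + a / 16 ≤ Real.exp (a / 16) := by linarith [Real.add_one_le_exp (a / 16)]
  have h2 : (1 + a) / 16 ≤ Real.exp (a / 16) := by linarith
  have h3 : ((1 + a) / 16) ^ 4 ≤ Real.exp (a / 16) ^ 4 := by gcongr
  rw [← Real.exp_nat_mul] at h3
  have e : ((4:ℕ):ℝ) * (a / 16) = a / 4 := by push_cast; ring
  rw [e] at h3
  rw [show -a/4 = -(a/4) by ring, Real.exp_neg, ← one_div, div_le_div_iff₀ (Real.exp_pos _) (by positivity)]
  have : ((1 + a) / 16) ^ 4 = (1 + a) ^ 4 / 65536 := by ring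
  linarith

lemma G_le_poly (u : ℝ) : G u ≤ 65536 / (1 + u ^ 2) ^ 4 := by
  refine le_trans ?_ (exp_quarter_le (sq_nonneg u))
  unfold G; apply Real.exp_le_exp.2; nlinarith [sq_nonneg u]

end SN

namespace SN

lemma taylor_dec {f f1 f2 f3 : ℝ → ℝ} {C : ℝ} (h0 : ∀ u, HasDerivAt f (f1 u) u)
    (h1 : ∀ u, HasDerivAt f1 (f2 u) u) (h2 : ∀ u, HasDerivAt f2 (f3 u) u)
    (b0 : ∀ u, |f u| ≤ C) (b1 : ∀ u, |f1 u| ≤ C / (1 + u ^ 2))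
    (b2 : ∀ u, |f2 u| ≤ C / (1 + u ^ 2)) (b3 : ∀ u, |f3 u| ≤ C / (1 + u ^ 2)) (u h : ℝ) :
    |f (u + h) - f u - f1 u * h - f2 u * h ^ 2 / 2| ≤ 32 * C * |h| ^ 3 / (1 + u ^ 2) := by
  have hC : 0 ≤ C := (abs_nonneg _).trans (b0 0)
  have hpos : 0 < 1 + u ^ 2 := by positivity
  by_cases hh : |h| ≤ (1 + |u|) / 2
  · set s := Set.uIcc u (u + h)
    have hs : Convex ℝ s := convex_uIcc _ _
    have hus : u ∈ s := Set.left_mem_uIcc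
    have hvs : ∀ v ∈ s, |v - u| ≤ |h| := by
      intro v hv
      have := Set.abs_sub_left_of_mem_uIcc hv
      simpa [abs_sub_comm] using this
    set M := 16 * C / (1 + u ^ 2) with hM
    have hM0 : 0 ≤ M := by positivity
    have hb3 : ∀ v ∈ s, ‖f3 v‖ ≤ M := by
      intro v hv
      refine (b3 v).trans ?_
      rw [hM, div_le_div_iff₀ (by positivity) (by positivity)]
      have h1 : (|u| - 1) / 2 ≤ |v| := by
        have := hvs v hv
        have h3 : |u| - |v| ≤ |v - u| := by
          have := abs_sub_abs_le_abs_sub u v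
          rwa [abs_sub_comm] at this
        linarith
      have h2 : 1 + u ^ 2 ≤ 16 * (1 + v ^ 2) := by
        rw [← sq_abs u, ← sq_abs v]
        have := abs_nonneg u
        have := abs_nonneg v
        by_cases hu1 : |u| ≤ 1
        · nlinarith
        · nlinarith [sq_nonneg (|u| - 4 / 3)]
      nlinarith
    have e2 : ∀ v ∈ s, ‖f2 v - f2 u‖ ≤ M * |h| := by
      intro v hv
      have := Convex.norm_image_sub_le_of_norm_hasDerivWithin_le
        (fun x _ => (h2 x).hasDerivWithinAt) hb3 hs hus hv
      refine this.trans ?_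
      exact mul_le_mul_of_nonneg_left (hvs v hv) hM0
    have e1 : ∀ v ∈ s, ‖f1 v - f1 u - f2 u * (v - u)‖ ≤ M * |h| ^ 2 := by
      intro v hv
      have hd : ∀ x ∈ s, HasDerivWithinAt (fun v => f1 v - f1 u - f2 u * (v - u)) (f2 x - f2 u) s x := by
        intro x _
        have : HasDerivAt (fun v => f1 v - f1 u - f2 u * (v - u)) (f2 x - f2 u * 1) x :=
          ((h1 x).sub_const _).sub (((hasDerivAt_id x).sub_const u).const_mul _)
        simpa using this.hasDerivWithinAt
      have := Convex.norm_image_sub_le_of_norm_hasDerivWithin_le hd e2 hs hus hv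
      simp only [sub_self, mul_zero, sub_zero] at this
      refine this.trans ?_
      have h4 := hvs v hv
      rw [Real.norm_eq_abs, pow_two, ← mul_assoc]
      exact mul_le_mul_of_nonneg_left h4 (by positivity)
    have hd : ∀ x ∈ s, HasDerivWithinAt (fun v => f v - f u - f1 u * (v - u) - f2 u * (v - u) ^ 2 / 2)
        (f1 x - f1 u - f2 u * (x - u)) s x := by
      intro x _
      have : HasDerivAt (fun v => f v - f u - f1 u * (v - u) - f2 u * (v - u) ^ 2 / 2)
          (f1 x - f1 u * 1 - (f2 u * (2 * (x - u) ^ (2 - 1) * 1)) / 2) x :=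
        (((h0 x).sub_const _).sub (((hasDerivAt_id x).sub_const u).const_mul _)).sub
          (((((hasDerivAt_id x).sub_const u).pow 2).const_mul _).div_const 2)
      exact (this.congr_deriv (by simp; ring)).hasDerivWithinAt
    have := Convex.norm_image_sub_le_of_norm_hasDerivWithin_le hd e1 hs hus (Set.right_mem_uIcc)
    simp only [sub_self, mul_zero, add_sub_cancel_left, Real.norm_eq_abs] at this
    norm_num at this
    refine this.trans ?_
    rw [hM]
    have h3 : 0 ≤ C * |h| ^ 3 / (1 + u ^ 2) := by positivity
    calc 16 * C / (1 + u ^ 2) * h ^ 2 * |h| = 16 * (C * |h| ^ 3 / (1 + u ^ 2)) := by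
          rw [← sq_abs h]; ring
      _ ≤ 32 * (C * |h| ^ 3 / (1 + u ^ 2)) := by linarith
      _ = _ := by ring
  · push Not at hh
    have hu := abs_nonneg u
    have hh1 : 1 / 2 ≤ |h| := by linarith
    have h4 : 1 + u ^ 2 ≤ 4 * |h| ^ 2 := by rw [← sq_abs u]; nlinarith
    set q := |h| ^ 3 / (1 + u ^ 2) with hq
    have q1 : |h| / (1 + u ^ 2) ≤ 4 * q := by
      rw [hq, ← mul_div_assoc]
      apply div_le_div_of_nonneg_right _ hpos.le
      nlinarith [sq_nonneg (|h| - 1/2), mul_nonneg (abs_nonneg h) (abs_nonneg h)]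
    have q2 : |h| ^ 2 / (1 + u ^ 2) ≤ 2 * q := by
      rw [hq, ← mul_div_assoc]
      apply div_le_div_of_nonneg_right _ hpos.le
      nlinarith [sq_nonneg (|h|)]
    have q0 : 1 ≤ 8 * q := by
      rw [hq, ← mul_div_assoc, le_div_iff₀ hpos]
      nlinarith [sq_nonneg (|h|)]
    have a0 : |f (u + h) - f u| ≤ 2 * C := by
      have := abs_sub (f (u+h)) (f u); have := b0 u; have := b0 (u+h); linarith
    have a1 : |f1 u * h| ≤ C * (4 * q) := by
      rw [abs_mul]
      calc |f1 u| * |h| ≤ C / (1 + u ^ 2) * |h| := by gcongr; exact b1 u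
        _ = C * (|h| / (1 + u ^ 2)) := by ring
        _ ≤ _ := by gcongr
    have a2 : |f2 u * h ^ 2 / 2| ≤ C * q := by
      rw [abs_div, abs_mul, abs_pow]
      calc |f2 u| * |h| ^ 2 / |2| ≤ C / (1 + u ^ 2) * |h| ^ 2 / |2| := by gcongr; exact b2 u
        _ = C * (|h| ^ 2 / (1 + u ^ 2)) / 2 := by norm_num; ring
        _ ≤ C * (2 * q) / 2 := by gcongr
        _ = _ := by ring
    have t1 := abs_sub (f (u + h) - f u - f1 u * h) (f2 u * h ^ 2 / 2)
    have t2 := abs_sub (f (u + h) - f u) (f1 u * h)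
    have : 32 * C * |h| ^ 3 / (1 + u ^ 2) = 32 * (C * q) := by rw [hq]; ring
    rw [this]
    nlinarith

noncomputable def CT : ℝ := 10 ^ 9

noncomputable def VV (A B u : ℝ) : ℝ := Nt u + A * G u + B * psi u
noncomputable def V1 (A B u : ℝ) : ℝ :=
  -(cpi * G u) + A * (-(u * G u)) + B * (-(2 * u) / (1 + u ^ 2) ^ 2)
noncomputable def V2 (A B u : ℝ) : ℝ :=
  cpi * u * G u + A * ((u ^ 2 - 1) * G u) + B * ((6 * u ^ 2 - 2) / (1 + u ^ 2) ^ 3)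

lemma G_hasDerivAt (u : ℝ) : HasDerivAt G (-(u * G u)) u := by
  have : HasDerivAt G (Real.exp (-(u ^ 2) / 2) * (-(2 * u ^ (2-1) * 1) / 2)) u :=
    ((((hasDerivAt_id u).pow 2).neg.div_const 2)).exp
  convert this using 1
  simp [G]; ring

lemma G_bd {p : ℝ} {u : ℝ} (hp : |p| ≤ 15000 * (1 + u ^ 2) ^ 3) :
    |p * G u| ≤ 10 ^ 9 / (1 + u ^ 2) := by
  rw [abs_mul, abs_of_pos (G_pos u)]
  have := G_le_poly u
  have h1 : (0:ℝ) < 1 + u ^ 2 := by positivity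
  calc |p| * G u ≤ (15000 * (1 + u ^ 2) ^ 3) * (65536 / (1 + u ^ 2) ^ 4) := by
        apply mul_le_mul hp this (G_pos u).le (by positivity)
    _ = 15000 * 65536 / (1 + u ^ 2) := by field_simp
    _ ≤ _ := by gcongr; norm_num

lemma abs_le_half (u : ℝ) : |u| ≤ (1 + u ^ 2) / 2 := by
  rw [← sq_abs u]; nlinarith [sq_nonneg (|u| - 1)]

lemma taylor_G (u h : ℝ) :
    |G (u + h) - G u - (-(u * G u)) * h - ((u ^ 2 - 1) * G u) * h ^ 2 / 2|
      ≤ 32 * 10 ^ 9 * |h| ^ 3 / (1 + u ^ 2) := by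
  refine taylor_dec (f := G) (f1 := fun u => -(u * G u)) (f2 := fun u => (u ^ 2 - 1) * G u)
    (f3 := fun u => (3 * u - u ^ 3) * G u) G_hasDerivAt ?_ ?_ ?_ ?_ ?_ ?_ u h
  · intro u
    have := ((hasDerivAt_id u).mul (G_hasDerivAt u)).neg
    exact this.congr_deriv (by simp; ring)
  · intro u
    have : HasDerivAt (fun u => (u ^ 2 - 1) * G u) ((2 * u ^ (2-1) * 1) * G u + (u ^ 2 - 1) * (-(u * G u))) u :=
      (((hasDerivAt_id u).pow 2).sub_const 1).mul (G_hasDerivAt u)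
    exact this.congr_deriv (by simp; ring)
  · intro u; rw [abs_of_pos (G_pos u)]; have := G_le_one u; linarith
  · intro u; rw [abs_neg]; apply G_bd
    have := abs_le_half u
    have h1 : (1:ℝ) ≤ 1 + u ^ 2 := by nlinarith [sq_nonneg u]
    have := pow_le_pow_right₀ h1 (show 1 ≤ 3 by norm_num)
    nlinarith
  · intro u; apply G_bd
    have h1 : (1:ℝ) ≤ 1 + u ^ 2 := by nlinarith [sq_nonneg u]
    have := pow_le_pow_right₀ h1 (show 1 ≤ 3 by norm_num)
    rw [abs_le]; constructor <;> nlinarith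
  · intro u; apply G_bd
    have h1 : (1:ℝ) ≤ 1 + u ^ 2 := by nlinarith [sq_nonneg u]
    have := pow_le_pow_right₀ h1 (show 2 ≤ 3 by norm_num)
    have e : |3 * u - u ^ 3| = |u| * |3 - u ^ 2| := by rw [← abs_mul]; ring_nf
    have e2 : |3 - u ^ 2| ≤ 3 * (1 + u ^ 2) := by rw [abs_le]; constructor <;> nlinarith
    rw [e]
    have := mul_le_mul (abs_le_half u) e2 (abs_nonneg _) (by positivity)
    nlinarith

lemma taylor_Nt (u h : ℝ) :
    |Nt (u + h) - Nt u - (-(cpi * G u)) * h - (cpi * u * G u) * h ^ 2 / 2|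
      ≤ 32 * 10 ^ 9 * |h| ^ 3 / (1 + u ^ 2) := by
  have hc := cpi_le_one
  have hc0 := cpi_pos
  refine taylor_dec (f := Nt) (f1 := fun u => -(cpi * G u)) (f2 := fun u => cpi * u * G u)
    (f3 := fun u => cpi * (1 - u ^ 2) * G u) Nt_hasDerivAt ?_ ?_ ?_ ?_ ?_ ?_ u h
  · intro u
    have := ((G_hasDerivAt u).const_mul cpi).neg
    exact this.congr_deriv (by ring)
  · intro u
    have := ((hasDerivAt_id u).const_mul cpi).mul (G_hasDerivAt u)
    exact this.congr_deriv (by simp; ring)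
  · intro u; rw [abs_of_nonneg (Nt_nonneg u)]; have := Nt_le_one u; linarith
  · intro u; rw [abs_neg]; apply G_bd
    have h1 : (1:ℝ) ≤ 1 + u ^ 2 := by nlinarith [sq_nonneg u]
    have := pow_le_pow_right₀ h1 (show 1 ≤ 3 by norm_num)
    rw [abs_of_pos hc0]; nlinarith
  · intro u; apply G_bd
    have h1 : (1:ℝ) ≤ 1 + u ^ 2 := by nlinarith [sq_nonneg u]
    have := pow_le_pow_right₀ h1 (show 1 ≤ 3 by norm_num)
    rw [abs_mul, abs_of_pos hc0]
    have := abs_le_half u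
    have : cpi * |u| ≤ 1 * |u| := by gcongr
    nlinarith
  · intro u; apply G_bd
    have h1 : (1:ℝ) ≤ 1 + u ^ 2 := by nlinarith [sq_nonneg u]
    have := pow_le_pow_right₀ h1 (show 1 ≤ 3 by norm_num)
    rw [abs_mul, abs_of_pos hc0]
    have e2 : |1 - u ^ 2| ≤ (1 + u ^ 2) := by rw [abs_le]; constructor <;> nlinarith
    have : cpi * |1 - u ^ 2| ≤ 1 * |1 - u ^ 2| := by gcongr
    nlinarith

lemma psi_bd {p : ℝ} {u : ℝ} {k : ℕ} (hp : |p| ≤ 15000 * (1 + u ^ 2) ^ k) :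
    |p / (1 + u ^ 2) ^ (k + 1)| ≤ 10 ^ 9 / (1 + u ^ 2) := by
  have h1 : (0:ℝ) < 1 + u ^ 2 := by positivity
  rw [abs_div, abs_of_pos (pow_pos h1 _)]
  calc |p| / (1 + u ^ 2) ^ (k+1) ≤ (15000 * (1 + u ^ 2) ^ k) / (1 + u ^ 2) ^ (k+1) := by gcongr
    _ = 15000 / (1 + u ^ 2) := by rw [pow_succ (1 + u ^ 2) k, mul_comm 15000, mul_div_mul_left _ _ (pow_pos h1 k).ne']
    _ ≤ _ := by gcongr; norm_num

lemma taylor_psi (u h : ℝ) :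
    |psi (u + h) - psi u - (-(2 * u) / (1 + u ^ 2) ^ 2) * h - ((6 * u ^ 2 - 2) / (1 + u ^ 2) ^ 3) * h ^ 2 / 2|
      ≤ 32 * 10 ^ 9 * |h| ^ 3 / (1 + u ^ 2) := by
  have hden : ∀ (k : ℕ) (u : ℝ), HasDerivAt (fun u : ℝ => (1 + u ^ 2) ^ k) (k * (1 + u ^ 2) ^ (k - 1) * (2 * u)) u := by
    intro k u
    have : HasDerivAt (fun u : ℝ => (1 + u ^ 2)) (2 * u) u := by
      simpa using ((hasDerivAt_id u).pow 2).const_add 1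
    exact (this.pow k)
  refine taylor_dec (f := psi) (f1 := fun u => -(2 * u) / (1 + u ^ 2) ^ 2)
    (f2 := fun u => (6 * u ^ 2 - 2) / (1 + u ^ 2) ^ 3)
    (f3 := fun u => (24 * u - 24 * u ^ 3) / (1 + u ^ 2) ^ 4) ?_ ?_ ?_ ?_ ?_ ?_ ?_ u h
  · intro u
    have h1 : (0:ℝ) < 1 + u ^ 2 := by positivity
    have := (hasDerivAt_const u (1:ℝ)).div (hden 1 u) (by positivity)
    have e : psi = (fun _ => (1:ℝ)) / fun u => (1 + u ^ 2) ^ 1 := by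
      funext v; simp [psi]
    rw [e]
    exact this.congr_deriv (by simp)
  · intro u
    have h1 : (0:ℝ) < 1 + u ^ 2 := by positivity
    have := (((hasDerivAt_id u).const_mul 2).neg).div (hden 2 u) (by positivity)
    exact this.congr_deriv (by simp; field_simp; ring)
  · intro u
    have h1 : (0:ℝ) < 1 + u ^ 2 := by positivity
    have h6 : HasDerivAt (fun u : ℝ => 6 * u ^ 2 - 2) (12 * u) u := by
      have := (((hasDerivAt_id u).pow 2).const_mul 6).sub_const 2
      exact this.congr_deriv (by simp; ring)
    have := h6.div (hden 3 u) (by positivity)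
    exact this.congr_deriv (by simp; field_simp; ring)
  · intro u; rw [abs_of_pos (psi_pos u)]; have := psi_le_one u; linarith
  · intro u; apply psi_bd
    rw [abs_neg, abs_mul]
    have := abs_le_half u
    norm_num; nlinarith
  · intro u; apply psi_bd
    have h1 : (1:ℝ) ≤ 1 + u ^ 2 := by nlinarith [sq_nonneg u]
    have := pow_le_pow_right₀ h1 (show 1 ≤ 2 by norm_num)
    rw [abs_le]; constructor <;> nlinarith
  · intro u; apply psi_bd
    have h1 : (1:ℝ) ≤ 1 + u ^ 2 := by nlinarith [sq_nonneg u]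
    have := pow_le_pow_right₀ h1 (show 2 ≤ 3 by norm_num)
    have e : |24 * u - 24 * u ^ 3| = 24 * (|u| * |1 - u ^ 2|) := by
      rw [show 24 * u - 24 * u ^ 3 = 24 * (u * (1 - u ^ 2)) by ring, abs_mul, abs_mul u]; norm_num
    have e2 : |1 - u ^ 2| ≤ (1 + u ^ 2) := by rw [abs_le]; constructor <;> nlinarith
    rw [e]
    have := mul_le_mul (abs_le_half u) e2 (abs_nonneg _) (by positivity)
    nlinarith

lemma taylor_VV {A B : ℝ} (hA : 0 ≤ A) (hB : 0 ≤ B) (u h : ℝ) :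
    VV A B (u + h) ≤ VV A B u + V1 A B u * h + V2 A B u * h ^ 2 / 2
      + CT * 32 * (1 + A + B) * psi u * |h| ^ 3 := by
  have t1 := (abs_le.1 (taylor_Nt u h)).2
  have t2 := mul_le_mul_of_nonneg_left (abs_le.1 (taylor_G u h)).2 hA
  have t3 := mul_le_mul_of_nonneg_left (abs_le.1 (taylor_psi u h)).2 hB
  have e : CT * 32 * (1 + A + B) * psi u * |h| ^ 3 =
    (1 + A + B) * (32 * 10 ^ 9 * |h| ^ 3 / (1 + u ^ 2)) := by unfold CT psi; ring
  rw [e]; unfold VV V1 V2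
  generalize 32 * 10 ^ 9 * |h| ^ 3 / (1 + u ^ 2) = q at *
  generalize (6 * u ^ 2 - 2) / (1 + u ^ 2) ^ 3 = q1 at *
  generalize -(2 * u) / (1 + u ^ 2) ^ 2 = q2 at *
  linarith

lemma V2_bd {A B : ℝ} (hA : 0 ≤ A) (hB : 0 ≤ B) (u : ℝ) :
    |V2 A B u| ≤ CT * (1 + A + B) * psi u := by
  have hc := cpi_le_one
  have hc0 := cpi_pos
  have h1 : (1:ℝ) ≤ 1 + u ^ 2 := by nlinarith [sq_nonneg u]
  have h13 := pow_le_pow_right₀ h1 (show 1 ≤ 3 by norm_num)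
  have b1 : |cpi * u * G u| ≤ 10 ^ 9 / (1 + u ^ 2) := by
    apply G_bd
    rw [abs_mul, abs_of_pos hc0]
    have := abs_le_half u
    have : cpi * |u| ≤ 1 * |u| := by gcongr
    nlinarith
  have b2 : |(u ^ 2 - 1) * G u| ≤ 10 ^ 9 / (1 + u ^ 2) := by
    apply G_bd
    rw [abs_le]; constructor <;> nlinarith
  have b3 : |(6 * u ^ 2 - 2) / (1 + u ^ 2) ^ 3| ≤ 10 ^ 9 / (1 + u ^ 2) := by
    apply psi_bd
    have := pow_le_pow_right₀ h1 (show 1 ≤ 2 by norm_num)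
    rw [abs_le]; constructor <;> nlinarith
  unfold V2
  have t1 := abs_add_le (cpi * u * G u + A * ((u ^ 2 - 1) * G u)) (B * ((6 * u ^ 2 - 2) / (1 + u ^ 2) ^ 3))
  have t2 := abs_add_le (cpi * u * G u) (A * ((u ^ 2 - 1) * G u))
  rw [abs_mul A, abs_of_nonneg hA] at t2
  rw [abs_mul B, abs_of_nonneg hB] at t1
  have e : CT * (1 + A + B) * psi u = (1 + A + B) * (10 ^ 9 / (1 + u ^ 2)) := by unfold CT psi; ring
  rw [e]
  have := mul_le_mul_of_nonneg_left b2 hA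
  have := mul_le_mul_of_nonneg_left b3 hB
  linarith
end SN

namespace SN

lemma r_lo {κ r : ℝ} (h0 : 0 ≤ κ) (h1 : κ ≤ 1 / 2) (hr : 0 < r) (hr2 : r ^ 2 * (1 + κ) = 1) :
    1 - κ / 2 ≤ r := by
  by_contra h
  push Not at h
  have h2 : r ^ 2 < (1 - κ / 2) ^ 2 := by nlinarith
  have h3 : (1 - κ / 2) ^ 2 * (1 + κ) ≤ 1 := by nlinarith [sq_nonneg κ]
  nlinarith

lemma r_hi {κ r : ℝ} (h0 : 0 ≤ κ) (h1 : κ ≤ 1 / 2) (hr : 0 < r) (hr2 : r ^ 2 * (1 + κ) = 1) :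
    r ≤ 1 - κ / 2 + κ ^ 2 / 2 := by
  by_contra h
  push Not at h
  have h2 : (1 - κ / 2 + κ ^ 2 / 2) ^ 2 < r ^ 2 := by
    apply pow_lt_pow_left₀ h (by nlinarith) (by norm_num)
  have h3 : 1 ≤ (1 - κ / 2 + κ ^ 2 / 2) ^ 2 * (1 + κ) := by
    have : (1 - κ / 2 + κ ^ 2 / 2) ^ 2 * (1 + κ) = 1 + κ ^ 2 * (1/4 + 3/4 * κ - κ^2/4 + κ ^ 3/4) := by ring
    rw [this]
    have : 0 ≤ 1/4 + 3/4 * κ - κ^2/4 + κ ^ 3/4 := by nlinarith [pow_nonneg h0 3]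
    nlinarith [mul_nonneg (sq_nonneg κ) this]
  nlinarith

lemma r_le_one {κ r : ℝ} (h0 : 0 ≤ κ) (hr : 0 < r) (hr2 : r ^ 2 * (1 + κ) = 1) : r ≤ 1 := by
  nlinarith

lemma G_step_lo {κ r u : ℝ} (h0 : 0 ≤ κ) (hr2 : r ^ 2 * (1 + κ) = 1) :
    G u * (1 + u ^ 2 * κ / 2 - u ^ 2 * κ ^ 2 / 2) ≤ G (u * r) := by
  have hk : 0 < 1 + κ := by linarith
  have hr' : r ^ 2 = 1 / (1 + κ) := by field_simp; exact hr2
  have e : G (u * r) = G u * Real.exp (u ^ 2 * κ / (2 * (1 + κ))) := by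
    unfold G; rw [← Real.exp_add]; congr 1; rw [mul_pow, hr']; field_simp; ring
  rw [e]
  apply mul_le_mul_of_nonneg_left _ (G_pos u).le
  have h1 := Real.add_one_le_exp (u ^ 2 * κ / (2 * (1 + κ)))
  have h2 : u ^ 2 * κ / 2 - u ^ 2 * κ ^ 2 / 2 ≤ u ^ 2 * κ / (2 * (1 + κ)) := by
    rw [le_div_iff₀ (by positivity)]
    have : 0 ≤ u ^ 2 * κ ^ 3 := by positivity
    nlinarith
  linarith

lemma G_step_hi {κ r u : ℝ} (h0 : 0 ≤ κ) (h1 : κ ≤ 1 / 2) (hr2 : r ^ 2 * (1 + κ) = 1) :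
    G (u * r) ≤ G u + u ^ 2 * κ / 2 * Real.exp (-(u ^ 2) / 4) := by
  have hk : 0 < 1 + κ := by linarith
  have hr' : r ^ 2 = 1 / (1 + κ) := by field_simp; exact hr2
  set t := u ^ 2 * κ / (2 * (1 + κ)) with ht
  have ht0 : 0 ≤ t := by positivity
  have e : G u = G (u * r) * Real.exp (-t) := by
    unfold G; rw [← Real.exp_add]; congr 1; rw [mul_pow, hr', ht]; field_simp; ring
  have h2 := Real.add_one_le_exp (-t)
  have h3 : G (u * r) ≤ Real.exp (-(u ^ 2) / 4) := by
    unfold G; apply Real.exp_le_exp.2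
    have : 1 / 2 ≤ r ^ 2 := by rw [hr', div_le_div_iff₀ (by norm_num) hk]; linarith
    nlinarith [mul_le_mul_of_nonneg_left this (sq_nonneg u)]
  have h4 : t ≤ u ^ 2 * κ / 2 := by
    rw [ht]; apply div_le_div_of_nonneg_left (by positivity) (by norm_num) (by linarith)
  have h5 := mul_le_mul_of_nonneg_left h2 (G_pos (u * r)).le
  have h6 := mul_le_mul h4 h3 (G_pos _).le (by positivity)
  nlinarith

lemma Nt_step {κ r u : ℝ} (h0 : 0 ≤ κ) (h1 : κ ≤ 1 / 2) (hr : 0 < r) (hr2 : r ^ 2 * (1 + κ) = 1) :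
    Nt u + κ / 2 * (cpi * u * G u) - 65536 * κ ^ 2 * psi u ≤ Nt (u * r) := by
  have hc := cpi_le_one
  have hc0 := cpi_pos
  have hp := psi_pos u
  have hlo := r_lo h0 h1 hr hr2
  have hhi := r_hi h0 h1 hr hr2
  have hr1 := r_le_one h0 hr hr2
  have ha : (1:ℝ) ≤ 1 + u ^ 2 := by nlinarith [sq_nonneg u]
  have hG := G_pos u
  have huG : |u| * G u ≤ 65536 * psi u := by
    have h3 := G_le_poly u
    have h4 : |u| ≤ (1 + u ^ 2) ^ 3 := by
      have := abs_le_half u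
      have := pow_le_pow_right₀ ha (show 1 ≤ 3 by norm_num)
      nlinarith
    calc |u| * G u ≤ (1 + u ^ 2) ^ 3 * (65536 / (1 + u ^ 2) ^ 4) :=
          mul_le_mul h4 h3 hG.le (by positivity)
      _ = 65536 * psi u := by unfold psi; field_simp
  rcases lt_trichotomy u 0 with hu | hu | hu
  · rcases eq_or_lt_of_le hr1 with h | h
    · rw [h, mul_one]
      have : κ / 2 * (cpi * u * G u) ≤ 0 := by
        have : 0 ≤ cpi * G u * κ := by positivity
        nlinarith
      have : 0 ≤ 65536 * κ ^ 2 * psi u := by positivity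
      linarith
    · have hlt : u < u * r := by nlinarith
      obtain ⟨c, ⟨hc1, hc2⟩, hc3⟩ := Nt_mvt hlt
      have hGc : G c ≤ G (u * r) := G_anti (by nlinarith [mul_neg_of_neg_of_pos hu hr])
      have hGr := G_step_hi (u := u) h0 h1 hr2
      have hex := exp_quarter_le (sq_nonneg u)
      have hd : u * r - u ≤ -u * (κ / 2) := by nlinarith
      have hq : (-u) * (u ^ 2) * Real.exp (-(u ^ 2) / 4) ≤ 65536 * psi u := by
        have h4 : (-u) * u ^ 2 ≤ (1 + u ^ 2) ^ 3 := by
          have h5 := abs_le_half u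
          have h6 := neg_le_abs u
          have : (-u) * u ^ 2 ≤ (1 + u ^ 2) * (1 + u ^ 2) :=
            mul_le_mul (by linarith) (by linarith) (sq_nonneg _) (by linarith)
          have := pow_le_pow_right₀ ha (show 2 ≤ 3 by norm_num)
          nlinarith
        calc (-u) * (u ^ 2) * Real.exp (-(u ^ 2) / 4) ≤ (1 + u ^ 2) ^ 3 * (65536 / (1 + u ^ 2) ^ 4) :=
              mul_le_mul h4 hex (Real.exp_pos _).le (by positivity)
          _ = 65536 * psi u := by unfold psi; field_simp
      have h7 : cpi * G c * (u * r - u) ≤ cpi * (G u + u ^ 2 * κ / 2 * Real.exp (-(u ^ 2) / 4)) * (-u * (κ / 2)) := by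
        apply mul_le_mul _ hd (by linarith) (by positivity)
        apply mul_le_mul_of_nonneg_left (hGc.trans hGr) hc0.le
      have h8 : cpi * (κ ^ 2 / 4) * ((-u) * (u ^ 2) * Real.exp (-(u ^ 2) / 4)) ≤ 1 * κ ^ 2 * (65536 * psi u) := by
        apply mul_le_mul _ hq _ (by positivity)
        · nlinarith [sq_nonneg κ]
        · have : 0 < -u := by linarith
          positivity
      nlinarith
  · subst hu; simp; positivity
  · rcases eq_or_lt_of_le hr1 with h | h
    · rw [h] at hr2
      have : κ = 0 := by linarith
      simp [this, h]
    · have hlt : u * r < u := by nlinarith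
      obtain ⟨c, ⟨hc1, hc2⟩, hc3⟩ := Nt_mvt hlt
      have hGc : G u ≤ G c := G_anti (by nlinarith [mul_pos hu hr])
      have hd : u * (κ / 2 - κ ^ 2 / 2) ≤ u - u * r := by nlinarith
      have h7 : cpi * G u * (u - u * r) ≤ cpi * G c * (u - u * r) := by
        apply mul_le_mul_of_nonneg_right _ (by linarith)
        apply mul_le_mul_of_nonneg_left hGc hc0.le
      have h8 := mul_le_mul_of_nonneg_left hd (show 0 ≤ cpi * G u by positivity)
      rw [abs_of_pos hu] at huG
      have h9 : cpi * (κ ^ 2 / 2) * (u * G u) ≤ 1 * κ ^ 2 * (65536 * psi u) := by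
        apply mul_le_mul _ huG (by positivity) (by positivity)
        nlinarith [sq_nonneg κ]
      nlinarith

lemma psi_step {κ r u : ℝ} (h0 : 0 ≤ κ) (hr2 : r ^ 2 * (1 + κ) = 1) :
    psi u + κ * u ^ 2 * psi u ^ 2 - κ ^ 2 * psi u ≤ psi (u * r) := by
  have hk : 0 < 1 + κ := by linarith
  have hr' : r ^ 2 = 1 / (1 + κ) := by field_simp; exact hr2
  unfold psi
  rw [mul_pow, hr']
  have ha := sq_nonneg u
  generalize u ^ 2 = a at *
  have h1 : 0 < 1 + a := by linarith
  have e : 1 / (1 + a * (1 / (1 + κ))) = 1 / (1 + a) + κ * a / ((1 + a) * (1 + a + κ)) := by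
    field_simp; ring
  rw [e]
  have h2 : κ * a * (1 / (1 + a)) ^ 2 - κ * a / ((1 + a) * (1 + a + κ)) = κ ^ 2 * (a / (1 + a)) / ((1 + a) * (1 + a + κ)) := by
    field_simp; ring
  have h3 : κ ^ 2 * (a / (1 + a)) / ((1 + a) * (1 + a + κ)) ≤ κ ^ 2 * (1 / (1 + a)) := by
    have : a / (1 + a) ≤ 1 := by rw [div_le_one h1]; linarith
    calc κ ^ 2 * (a / (1 + a)) / ((1 + a) * (1 + a + κ)) ≤ κ ^ 2 * 1 / ((1 + a) * 1) := by
          gcongr; linarith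
      _ = _ := by ring
  linarith

noncomputable def E7 : ℝ := 12 * Real.exp 7
noncomputable def C3 : ℝ := 40 * CT
noncomputable def K2 : ℝ := 32 * C3
noncomputable def K3 : ℝ := 128 * C3
noncomputable def K1 : ℝ := 4 * K2 * E7

lemma gain1 (u : ℝ) : psi u / 4 - E7 * G u ≤ u ^ 2 * psi u ^ 2 - psi u / 2 - (3 * u ^ 2 - 1) / (1 + u ^ 2) ^ 3 := by
  unfold psi G E7
  have ha := sq_nonneg u
  generalize u ^ 2 = a at *
  have h1 : 0 < 1 + a := by linarith
  have e : a * (1 / (1 + a)) ^ 2 - 1 / (1 + a) / 2 - (3 * a - 1) / (1 + a) ^ 3 - 1 / (1 + a) / 4 = (a ^ 2 - 14 * a + 1) / (4 * (1 + a) ^ 3) := by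
    field_simp; ring
  have h2 : -(12 * Real.exp 7 * Real.exp (-a / 2)) ≤ (a ^ 2 - 14 * a + 1) / (4 * (1 + a) ^ 3) := by
    by_cases h14 : 14 ≤ a
    · have : 0 ≤ (a ^ 2 - 14 * a + 1) / (4 * (1 + a) ^ 3) := by
        apply div_nonneg _ (by positivity); nlinarith
      have : 0 ≤ 12 * Real.exp 7 * Real.exp (-a / 2) := by positivity
      linarith
    · push Not at h14
      have : 1 ≤ Real.exp 7 * Real.exp (-a / 2) := by
        rw [← Real.exp_add]; apply Real.one_le_exp; linarith
      have : -12 ≤ (a ^ 2 - 14 * a + 1) / (4 * (1 + a) ^ 3) := by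
        rw [le_div_iff₀ (by positivity)]
        have : 1 ≤ (1 + a) ^ 3 := one_le_pow₀ (by linarith)
        nlinarith [sq_nonneg (a - 7)]
      linarith
  linarith

lemma gain2 (u : ℝ) : psi u / 16 ≤ G u / 2 + u ^ 2 * psi u ^ 2 - (3 * u ^ 2 - 1) / (1 + u ^ 2) ^ 3 := by
  unfold psi G
  have ha := sq_nonneg u
  generalize u ^ 2 = a at *
  have h1 : 0 < 1 + a := by linarith
  have e : a * (1 / (1 + a)) ^ 2 - (3 * a - 1) / (1 + a) ^ 3 = (a - 1) ^ 2 / (1 + a) ^ 3 := by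
    field_simp; ring
  have hG := Real.exp_pos (-a / 2)
  have h3 : 0 ≤ (a - 1) ^ 2 / (1 + a) ^ 3 := by positivity
  by_cases h2 : (1 + a) ^ 2 ≤ 16 * (a - 1) ^ 2
  · have : 1 / (1 + a) / 16 ≤ (a - 1) ^ 2 / (1 + a) ^ 3 := by
      rw [div_div, div_le_div_iff₀ (by positivity) (by positivity)]
      nlinarith
    linarith
  · push Not at h2
    have : 1 / 8 ≤ Real.exp (-a / 2) := by
      have := Real.add_one_le_exp (-a / 2)
      have : a ≤ 5 / 3 := by nlinarith
      linarith
    have : 1 / (1 + a) ≤ 1 := by rw [div_le_one h1]; linarith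
    linarith

set_option maxHeartbeats 2000000 in
lemma one_step {Λ θ χ κ r u : ℝ} (hΛ : 0 ≤ Λ) (hθ : 0 ≤ θ) (hχ : 0 ≤ χ) (h0 : 0 ≤ κ) (hκθ : κ ≤ θ)
    (h1 : κ ≤ 1 / 2) (hr : 0 < r) (hr2 : r ^ 2 * (1 + κ) = 1)
    (hM : 1 + (Λ + K3 * χ) + (K2 * θ + K3 * χ) ≤ 8) :
    VV (Λ + K3 * χ) (K2 * θ + K3 * χ) u + V2 (Λ + K3 * χ) (K2 * θ + K3 * χ) u * κ / 2
      + |V2 (Λ + K3 * χ) (K2 * θ + K3 * χ) u| * χ * κ / 2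
      + CT * 32 * (1 + (Λ + K3 * χ) + (K2 * θ + K3 * χ)) * psi u * θ * κ
    ≤ VV ((Λ + K1 * θ * Real.log (1 + κ)) * r + K3 * χ) (K2 * θ * r + K3 * χ) (u * r) := by
  have hCT : CT = 10 ^ 9 := rfl
  have hK3 : 0 ≤ K3 := by unfold K3 C3 CT; norm_num
  have hK2 : 0 ≤ K2 := by unfold K2 C3 CT; norm_num
  have hE7 : 0 < E7 := by unfold E7; positivity
  have hK1 : 0 ≤ K1 := by unfold K1; positivity
  set H := K3 * χ with hH
  have hH0 : 0 ≤ H := by positivity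
  have hp := psi_pos u
  have hG := G_pos u
  have hGr := G_pos (u * r)
  have hlo := r_lo h0 h1 hr hr2
  have hr1 := r_le_one h0 hr hr2
  have hln : κ / 2 ≤ Real.log (1 + κ) := by
    have := Real.one_sub_inv_le_log_of_pos (show 0 < 1 + κ by linarith)
    have h3 : (1 + κ)⁻¹ ≤ 1 - κ / 2 := by
      rw [inv_le_iff_one_le_mul₀ (by linarith)]; nlinarith
    linarith
  have sN := Nt_step (u := u) h0 h1 hr hr2
  have sG := G_step_lo (u := u) h0 hr2
  have sP := psi_step (u := u) h0 hr2
  have sG0 : G u ≤ G (u * r) := G_anti (by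
    rw [mul_pow]; have : r ^ 2 ≤ 1 := by nlinarith
    nlinarith [sq_nonneg u])
  have haG : u ^ 2 * G u ≤ 65536 * psi u := by
    have h3 := G_le_poly u
    have ha : (1:ℝ) ≤ 1 + u ^ 2 := by nlinarith [sq_nonneg u]
    have h4 : u ^ 2 ≤ (1 + u ^ 2) ^ 3 := by
      have := pow_le_pow_right₀ ha (show 1 ≤ 3 by norm_num)
      nlinarith
    calc u ^ 2 * G u ≤ (1 + u ^ 2) ^ 3 * (65536 / (1 + u ^ 2) ^ 4) :=
          mul_le_mul h4 h3 hG.le (by positivity)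
      _ = 65536 * psi u := by unfold psi; field_simp
  -- individual lower bounds
  have b1 : Λ * (G u + (u ^ 2 - 1) * G u * κ / 2 - 65536 * psi u * κ ^ 2) ≤ Λ * r * G (u * r) := by
    rw [mul_assoc Λ r]
    apply mul_le_mul_of_nonneg_left _ hΛ
    have : (1 - κ / 2) * G (u * r) ≤ r * G (u * r) := by gcongr
    have h2 : (1 - κ / 2) * (G u * (1 + u ^ 2 * κ / 2 - u ^ 2 * κ ^ 2 / 2)) ≤ (1 - κ / 2) * G (u * r) :=
      mul_le_mul_of_nonneg_left sG (by linarith)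
    have h3 := mul_le_mul_of_nonneg_right haG (sq_nonneg κ)
    have h4 : 0 ≤ u ^ 2 * G u * κ ^ 2 * (1 + κ) := by positivity
    nlinarith
  have b2 : K1 * θ * (κ / 4) * G u ≤ K1 * θ * Real.log (1 + κ) * r * G (u * r) := by
    have : κ / 4 ≤ Real.log (1 + κ) * r := by
      have := mul_le_mul hln (show 1 / 2 ≤ r by linarith) (by norm_num) (by linarith)
      linarith
    calc K1 * θ * (κ / 4) * G u ≤ K1 * θ * (Real.log (1 + κ) * r) * G (u * r) := by
          have hl0 : 0 ≤ Real.log (1 + κ) := by linarith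
          gcongr
      _ = _ := by ring
  have b3 : H * (G u + u ^ 2 * G u * κ / 2 - 65536 * psi u * κ ^ 2) ≤ H * G (u * r) := by
    apply mul_le_mul_of_nonneg_left _ hH0
    have h3 := mul_le_mul_of_nonneg_right haG (sq_nonneg κ)
    have h4 : 0 ≤ u ^ 2 * G u * κ ^ 2 := by positivity
    nlinarith
  have hap : u ^ 2 * psi u ^ 2 ≤ psi u := by
    unfold psi
    have : u ^ 2 * (1 / (1 + u ^ 2)) ≤ 1 := by rw [mul_one_div, div_le_one (by positivity)]; linarith
    have h5 : 0 < 1 / (1 + u ^ 2) := by positivity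
    nlinarith
  have b4 : K2 * θ * (psi u + κ * (u ^ 2 * psi u ^ 2 - psi u / 2) - 2 * psi u * κ ^ 2) ≤ K2 * θ * r * psi (u * r) := by
    rw [mul_assoc (K2 * θ)]
    apply mul_le_mul_of_nonneg_left _ (by positivity)
    have hp' := psi_pos (u * r)
    have : (1 - κ / 2) * psi (u * r) ≤ r * psi (u * r) := by gcongr
    have h2 := mul_le_mul_of_nonneg_left sP (show 0 ≤ 1 - κ / 2 by linarith)
    have h3 := mul_le_mul_of_nonneg_right hap (sq_nonneg κ)
    have h4 : 0 ≤ psi u * κ ^ 2 * κ := by positivity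
    nlinarith
  have b5 : H * (psi u + κ * (u ^ 2 * psi u ^ 2) - psi u * κ ^ 2) ≤ H * psi (u * r) := by
    apply mul_le_mul_of_nonneg_left _ hH0
    linarith
  have g1 := mul_le_mul_of_nonneg_left (gain1 u) (show 0 ≤ K2 * θ * κ by positivity)
  have g2 := mul_le_mul_of_nonneg_left (gain2 u) (show 0 ≤ H * κ by positivity)
  set M := 1 + (Λ + H) + (K2 * θ + H) with hMdef
  have hv2 := V2_bd (show 0 ≤ Λ + H by positivity) (show 0 ≤ K2 * θ + H by positivity) u
  rw [← hMdef] at hv2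
  have l1 : |V2 (Λ + H) (K2 * θ + H) u| * χ * κ / 2 ≤ CT * M * psi u * χ * κ / 2 := by gcongr
  have hM0 : 0 < M := by positivity
  have l2 : (65536 * psi u * κ ^ 2) * (1 + Λ + H) + (K2 * θ) * (2 * psi u * κ ^ 2) + H * (psi u * κ ^ 2)
      ≤ CT * M * psi u * θ * κ := by
    have hk2 : κ ^ 2 ≤ θ * κ := by nlinarith
    have h5 : (65536 * psi u * κ ^ 2) * (1 + Λ + H) + (K2 * θ) * (2 * psi u * κ ^ 2) + H * (psi u * κ ^ 2)
       ≤ CT * M * psi u * κ ^ 2 := by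
      have : CT * M * psi u * κ ^ 2 - ((65536 * psi u * κ ^ 2) * (1 + Λ + H) + (K2 * θ) * (2 * psi u * κ ^ 2) + H * (psi u * κ ^ 2))
        = (psi u * κ ^ 2) * (CT * M - 65536 * (1 + Λ + H) - 2 * (K2 * θ) - H) := by ring
      have h6 : 0 ≤ CT * M - 65536 * (1 + Λ + H) - 2 * (K2 * θ) - H := by
        have h7 : 0 ≤ K2 * θ := by positivity
        rw [hMdef, hCT]; nlinarith
      have := mul_nonneg (show 0 ≤ psi u * κ ^ 2 by positivity) h6
      linarith
    have : CT * M * psi u * κ ^ 2 ≤ CT * M * psi u * (θ * κ) :=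
      mul_le_mul_of_nonneg_left hk2 (by rw [hCT]; positivity)
    linarith
  have l3 : CT * M * psi u * θ * κ * 33 + CT * M * psi u * χ * κ / 2 ≤
      K2 * θ * κ * (psi u / 4) + H * κ * (psi u / 16) := by
    have e1 : K2 * θ * κ * (psi u / 4) + H * κ * (psi u / 16) = psi u * κ * CT * 8 * (40 * θ + 40 * χ) := by
      rw [hH]; unfold K2 K3 C3; ring
    rw [e1]
    have hCT0 : 0 ≤ CT := by rw [hCT]; norm_num
    have : psi u * κ * CT * M * (40 * θ + 40 * χ) ≤ psi u * κ * CT * 8 * (40 * θ + 40 * χ) := by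
      gcongr
    have h5 : 0 ≤ psi u * κ * CT * M * θ := by positivity
    have h6 : 0 ≤ psi u * κ * CT * M * χ := by positivity
    linarith
  have e2 : K1 * θ * (κ / 4) * G u = K2 * θ * κ * (E7 * G u) := by unfold K1; ring
  have e3 : (6 * u ^ 2 - 2) / (1 + u ^ 2) ^ 3 = 2 * ((3 * u ^ 2 - 1) / (1 + u ^ 2) ^ 3) := by ring
  unfold VV
  have eV : V2 (Λ + H) (K2 * θ + H) u = cpi * u * G u + (Λ + H) * ((u ^ 2 - 1) * G u) + (K2 * θ + H) * (2 * ((3 * u ^ 2 - 1) / (1 + u ^ 2) ^ 3)) := by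
    unfold V2; rw [e3]
  generalize hq : (3 * u ^ 2 - 1) / (1 + u ^ 2) ^ 3 = q at *
  have eV' : V2 (Λ + H) (K2 * θ + H) u * κ / 2 = (cpi * u * G u + (Λ + H) * ((u ^ 2 - 1) * G u) + (K2 * θ + H) * (2 * q)) * κ / 2 := by rw [eV]
  rw [eV']
  linarith
end SN

namespace SN

lemma Nt_le_G {v : ℝ} (hv : 0 ≤ v) : Nt v ≤ G v := by
  have hc0 := cpi_pos
  have h1 : (∫ t in Set.Ioi v, G t) = ∫ t in Set.Ioi (0:ℝ), G (t + v) := by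
    have := (measurePreserving_add_right volume v).setIntegral_preimage_emb
      (measurableEmbedding_addRight v) G (Set.Ioi v)
    rw [← this]
    congr 2
    ext t; simp
  have h2 : (∫ t in Set.Ioi (0:ℝ), G (t + v)) ≤ ∫ t in Set.Ioi (0:ℝ), G v * G t := by
    apply setIntegral_mono_on (G_integrable.comp_add_right v).integrableOn
      (G_integrable.const_mul _).integrableOn measurableSet_Ioi
    intro t ht
    have ht' : 0 < t := ht
    unfold G; rw [← Real.exp_add]; apply Real.exp_le_exp.2
    nlinarith [mul_nonneg ht'.le hv]
  have h3 : (∫ t in Set.Ioi (0:ℝ), G t) ≤ ∫ t, G t :=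
    setIntegral_le_integral G_integrable (Filter.Eventually.of_forall fun t => (G_pos t).le)
  rw [Nt_eq, h1]
  rw [integral_const_mul] at h2
  calc cpi * ∫ t in Set.Ioi (0:ℝ), G (t + v) ≤ cpi * (G v * ∫ t, G t) := by
        apply mul_le_mul_of_nonneg_left _ hc0.le
        exact h2.trans (mul_le_mul_of_nonneg_left h3 (G_pos v).le)
    _ = G v * (cpi * ∫ t, G t) := by ring
    _ = G v := by rw [G_integral, mul_one]

lemma Nt_scale {z ρ : ℝ} (hρ : 1 ≤ ρ) : Nt (z / ρ) ≤ Nt z + (ρ - 1) := by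
  have hρ0 : 0 < ρ := by linarith
  rcases le_or_gt z 0 with hz | hz
  · have : z ≤ z / ρ := by rw [le_div_iff₀ hρ0]; nlinarith
    have := Nt_anti this
    linarith
  · rcases eq_or_lt_of_le hρ with h | h
    · simp [← h]
    have hlt : z / ρ < z := by rw [div_lt_iff₀ hρ0]; nlinarith
    obtain ⟨c, ⟨hc1, hc2⟩, hc3⟩ := Nt_mvt hlt
    set w := z / ρ with hw
    have hw0 : 0 < w := by positivity
    have hz' : z = w * ρ := by rw [hw]; field_simp
    have hG : G c ≤ G w := G_anti (by nlinarith)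
    have hwG : w * G w ≤ 1 := by
      unfold G
      rw [neg_div, Real.exp_neg, mul_inv_le_iff₀ (Real.exp_pos _)]
      have := Real.add_one_le_exp (w ^ 2 / 2)
      nlinarith [sq_nonneg (w - 1)]
    have : cpi * G c * (z - w) ≤ 1 * G w * (z - w) := by
      have : cpi * G c ≤ 1 * G w := mul_le_mul cpi_le_one hG (G_pos c).le (by norm_num)
      nlinarith
    rw [hz'] at this hc3 ⊢
    nlinarith

lemma K2_pos : 0 < K2 := by unfold K2 C3 CT; norm_num
lemma K3_pos : 0 < K3 := by unfold K3 C3 CT; norm_num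
lemma E7_ge : 1 ≤ E7 := by
  unfold E7; have := Real.one_le_exp (show (0:ℝ) ≤ 7 by norm_num); linarith
lemma K1_ge : 4 * K2 ≤ K1 := by
  unfold K1; have := E7_ge; have := K2_pos; nlinarith
lemma K2_ge : 2 ≤ K2 := by unfold K2 C3 CT; norm_num
lemma K1_pos : 0 < K1 := by have := K1_ge; have := K2_pos; linarith

noncomputable def Lam (s γ ρ : ℝ) : ℝ := (2 * s + K1 * γ * Real.log (ρ ^ 2 / s ^ 2)) / ρ
noncomputable def Pot (s γ χ ρ D : ℝ) : ℝ :=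
  VV (Lam s γ ρ + K3 * χ) (K2 * (γ / ρ) + K3 * χ) (D / ρ)

lemma VV_nonneg {A B : ℝ} (hA : 0 ≤ A) (hB : 0 ≤ B) (u : ℝ) : 0 ≤ VV A B u := by
  unfold VV; have := Nt_nonneg u; have := G_pos u; have := psi_pos u; positivity

lemma VV_le {A B : ℝ} (hA : 0 ≤ A) (hB : 0 ≤ B) (u : ℝ) : VV A B u ≤ Nt u + A + B := by
  unfold VV
  have := mul_le_mul_of_nonneg_left (G_le_one u) hA
  have := mul_le_mul_of_nonneg_left (psi_le_one u) hB
  linarith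

lemma Lam_nonneg {s γ ρ : ℝ} (hs : 0 < s) (hγ : 0 ≤ γ) (hρ : s ≤ ρ) : 0 ≤ Lam s γ ρ := by
  unfold Lam
  have h1 : 1 ≤ ρ ^ 2 / s ^ 2 := by rw [le_div_iff₀ (by positivity)]; nlinarith
  have := Real.log_nonneg h1
  have := K1_pos
  have : 0 < ρ := by linarith
  positivity

lemma M_le {s γ χ ρ : ℝ} (hs : 0 < s) (hγ : 0 ≤ γ) (hsγ : K1 * γ ≤ s) (hρ : s ≤ ρ)
    (hχ : 0 ≤ χ) (hχ1 : K3 * χ ≤ 1) :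
    1 + (Lam s γ ρ + K3 * χ) + (K2 * (γ / ρ) + K3 * χ) ≤ 8 := by
  have hρ0 : 0 < ρ := by linarith
  have h1 : K2 * (γ / ρ) ≤ 1 := by
    rw [← mul_div_assoc, div_le_one hρ0]
    have := K1_ge; have := K2_pos; nlinarith
  have hlog : Real.log (ρ ^ 2 / s ^ 2) ≤ 2 * (ρ / s) := by
    rw [← div_pow, Real.log_pow]
    have := Real.log_le_self (show 0 ≤ ρ / s by positivity)
    push_cast; linarith
  have h2 : Lam s γ ρ ≤ 4 := by
    unfold Lam
    rw [div_le_iff₀ hρ0]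
    have h1' : 1 ≤ ρ ^ 2 / s ^ 2 := by rw [le_div_iff₀ (by positivity)]; nlinarith
    have := Real.log_nonneg h1'
    have h3 : K1 * γ * Real.log (ρ ^ 2 / s ^ 2) ≤ s * (2 * (ρ / s)) :=
      mul_le_mul hsγ hlog this hs.le
    have : s * (2 * (ρ / s)) = 2 * ρ := by field_simp
    linarith
  linarith

lemma pot_step {s γ χ ρ σ2 D : ℝ} (hs : 0 < s) (hγ : 0 ≤ γ) (hsγ : K1 * γ ≤ s) (hρ : s ≤ ρ)
    (hχ : 0 ≤ χ) (hχ1 : K3 * χ ≤ 1) (h0 : 0 ≤ σ2) (h1 : σ2 ≤ γ ^ 2) :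
    VV (Lam s γ ρ + K3 * χ) (K2 * (γ / ρ) + K3 * χ) (D / ρ)
      + V2 (Lam s γ ρ + K3 * χ) (K2 * (γ / ρ) + K3 * χ) (D / ρ) / (2 * ρ ^ 2) * σ2
      + |V2 (Lam s γ ρ + K3 * χ) (K2 * (γ / ρ) + K3 * χ) (D / ρ)| / (2 * ρ ^ 2) * (χ * σ2)
      + CT * 32 * (1 + (Lam s γ ρ + K3 * χ) + (K2 * (γ / ρ) + K3 * χ)) * psi (D / ρ) / ρ ^ 3 * (γ * σ2)
    ≤ Pot s γ χ (Real.sqrt (ρ ^ 2 + σ2)) D := by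
  have hρ0 : 0 < ρ := by linarith
  have hL := Lam_nonneg hs hγ hρ
  have hM := M_le hs hγ hsγ hρ hχ hχ1
  set ρ' := Real.sqrt (ρ ^ 2 + σ2) with hρ'
  have hρ'2 : ρ' ^ 2 = ρ ^ 2 + σ2 := Real.sq_sqrt (by positivity)
  have hρ'0 : 0 < ρ' := Real.sqrt_pos.2 (by positivity)
  set κ := σ2 / ρ ^ 2 with hκ
  set θ := γ / ρ with hθ
  have hκ0 : 0 ≤ κ := by positivity
  have hθ0 : 0 ≤ θ := by positivity
  have hθ1 : θ ≤ 1 / 8 := by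
    rw [hθ, div_le_iff₀ hρ0]; have := K1_ge; have := K2_ge; nlinarith
  have hκθ2 : κ ≤ θ ^ 2 := by rw [hκ, hθ, div_pow]; gcongr
  have hκθ : κ ≤ θ := by nlinarith
  have hr2 : (ρ / ρ') ^ 2 * (1 + κ) = 1 := by
    rw [div_pow, hρ'2, hκ]; field_simp
  have hu : D / ρ * (ρ / ρ') = D / ρ' := by field_simp
  have := one_step (u := D / ρ) hL hθ0 hχ hκ0 hκθ (by linarith) (show 0 < ρ / ρ' by positivity) hr2 hM
  rw [hu] at this
  have eL : (Lam s γ ρ + K1 * θ * Real.log (1 + κ)) * (ρ / ρ') = Lam s γ ρ' := by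
    unfold Lam
    have : ρ' ^ 2 / s ^ 2 = ρ ^ 2 / s ^ 2 * (1 + κ) := by rw [hρ'2, hκ]; field_simp
    rw [this, Real.log_mul (by positivity) (by positivity), hθ]
    field_simp
    ring
  have eB : K2 * θ * (ρ / ρ') = K2 * (γ / ρ') := by rw [hθ]; field_simp
  rw [eL, eB] at this
  unfold Pot
  refine le_trans (le_of_eq ?_) this
  rw [hκ, hθ]; field_simp

lemma pot_taylor {s γ χ ρ : ℝ} (hs : 0 < s) (hγ : 0 ≤ γ) (hρ : s ≤ ρ) (hχ : 0 ≤ χ) (D ζ : ℝ) :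
    Pot s γ χ ρ (D - ζ) ≤ VV (Lam s γ ρ + K3 * χ) (K2 * (γ / ρ) + K3 * χ) (D / ρ)
      + (- V1 (Lam s γ ρ + K3 * χ) (K2 * (γ / ρ) + K3 * χ) (D / ρ) / ρ) * ζ
      + V2 (Lam s γ ρ + K3 * χ) (K2 * (γ / ρ) + K3 * χ) (D / ρ) / (2 * ρ ^ 2) * ζ ^ 2
      + CT * 32 * (1 + (Lam s γ ρ + K3 * χ) + (K2 * (γ / ρ) + K3 * χ)) * psi (D / ρ) / ρ ^ 3 * |ζ| ^ 3 := by
  have hρ0 : 0 < ρ := by linarith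
  have hL := Lam_nonneg hs hγ hρ
  have := K3_pos; have := K2_pos
  have := taylor_VV (show 0 ≤ Lam s γ ρ + K3 * χ by positivity)
    (show 0 ≤ K2 * (γ / ρ) + K3 * χ by positivity) (D / ρ) (- ζ / ρ)
  unfold Pot
  rw [show (D - ζ) / ρ = D / ρ + -ζ / ρ by ring]
  refine this.trans (le_of_eq ?_)
  rw [abs_div, abs_neg, abs_of_pos hρ0, div_pow, div_pow]
  ring

lemma pot_terminal {s γ χ ρ D : ℝ} (hs : 0 < s) (hγ : 0 ≤ γ) (hρ : s ≤ ρ) (hρ2 : ρ ^ 2 ≤ 3 * s ^ 2)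
    (hχ : 0 ≤ χ) (hD : D ≤ 0) : 1 ≤ Pot s γ χ ρ D := by
  have hρ0 : 0 < ρ := by linarith
  have := K3_pos; have := K2_pos; have hK1 := K1_pos
  have hA : 1 ≤ Lam s γ ρ + K3 * χ := by
    have h1 : 1 ≤ Lam s γ ρ := by
      unfold Lam
      rw [le_div_iff₀ hρ0]
      have h1' : 1 ≤ ρ ^ 2 / s ^ 2 := by rw [le_div_iff₀ (by positivity)]; nlinarith
      have := Real.log_nonneg h1'
      have h3 : ρ ≤ 2 * s := by nlinarith
      have : 0 ≤ K1 * γ * Real.log (ρ ^ 2 / s ^ 2) := by positivity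
      linarith
    have : 0 ≤ K3 * χ := by positivity
    linarith
  unfold Pot VV
  have hu : D / ρ ≤ 0 := div_nonpos_of_nonpos_of_nonneg hD hρ0.le
  set u := D / ρ
  have h1 := Nt_le_G (show 0 ≤ -u by linarith)
  rw [Nt_neg, G_neg] at h1
  have := psi_pos u
  have : 0 ≤ (K2 * (γ / ρ) + K3 * χ) * psi u := by positivity
  have := G_pos u
  nlinarith

lemma Nt_cont : Continuous Nt := continuous_iff_continuousAt.2 fun x => (Nt_hasDerivAt x).continuousAt

lemma pot_meas (s γ χ : ℝ) : Measurable (fun p : ℝ × ℝ => Pot s γ χ p.1 p.2) := by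
  have h1 := Nt_cont.measurable
  have h2 := G_cont.measurable
  unfold Pot VV Lam psi
  fun_prop

section
variable {Ω : Type*} {m0 : MeasurableSpace Ω} {P : Measure Ω} [IsProbabilityMeasure P]

lemma cond_pull {m : MeasurableSpace Ω} (hm : m ≤ m0) {p a : Ω → ℝ}
    (hp : StronglyMeasurable[m] p) (hpb : ∃ C, ∀ᵐ ω ∂P, |p ω| ≤ C) (ha : Integrable a P) :
    P[fun ω => p ω * a ω|m] =ᵐ[P] fun ω => p ω * (P[a|m]) ω := by
  obtain ⟨C, hC⟩ := hpb
  exact condExp_stronglyMeasurable_mul_of_bound hm hp ha C hC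

lemma int_pull {m : MeasurableSpace Ω} (hm : m ≤ m0) {p a : Ω → ℝ}
    (hp : StronglyMeasurable[m] p) (hpb : ∃ C, ∀ᵐ ω ∂P, |p ω| ≤ C) (ha : Integrable a P) :
    Integrable (fun ω => p ω * a ω) P := by
  obtain ⟨C, hC⟩ := hpb
  exact ha.bdd_mul (hp.mono hm).aestronglyMeasurable hC

/-- pull-out for four terms -/
lemma cond_step {m : MeasurableSpace Ω} (hm : m ≤ m0) {H p0 p1 p2 p3 a0 a1 a2 a3 : Ω → ℝ}
    (hH : Integrable H P)
    (hp0 : StronglyMeasurable[m] p0) (hb0 : ∃ C, ∀ᵐ ω ∂P, |p0 ω| ≤ C) (ha0 : Integrable a0 P)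
    (hp1 : StronglyMeasurable[m] p1) (hb1 : ∃ C, ∀ᵐ ω ∂P, |p1 ω| ≤ C) (ha1 : Integrable a1 P)
    (hp2 : StronglyMeasurable[m] p2) (hb2 : ∃ C, ∀ᵐ ω ∂P, |p2 ω| ≤ C) (ha2 : Integrable a2 P)
    (hp3 : StronglyMeasurable[m] p3) (hb3 : ∃ C, ∀ᵐ ω ∂P, |p3 ω| ≤ C) (ha3 : Integrable a3 P)
    (hle : ∀ᵐ ω ∂P, H ω ≤ p0 ω * a0 ω + p1 ω * a1 ω + p2 ω * a2 ω + p3 ω * a3 ω) :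
    ∀ᵐ ω ∂P, (P[H|m]) ω ≤ p0 ω * (P[a0|m]) ω + p1 ω * (P[a1|m]) ω
      + p2 ω * (P[a2|m]) ω + p3 ω * (P[a3|m]) ω := by
  have i0 := int_pull hm hp0 hb0 ha0
  have i1 := int_pull hm hp1 hb1 ha1
  have i2 := int_pull hm hp2 hb2 ha2
  have i3 := int_pull hm hp3 hb3 ha3
  have hmono := condExp_mono (m := m) hH (((i0.add i1).add i2).add i3) hle
  have e1 := condExp_add (m := m) ((i0.add i1).add i2) i3
  have e2 := condExp_add (m := m) (i0.add i1) i2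
  have e3 := condExp_add (m := m) i0 i1
  filter_upwards [hmono, e1, e2, e3, cond_pull hm hp0 hb0 ha0, cond_pull hm hp1 hb1 ha1,
    cond_pull hm hp2 hb2 ha2, cond_pull hm hp3 hb3 ha3] with ω h e1 e2 e3 q0 q1 q2 q3
  rw [e1] at h
  simp only [Pi.add_apply] at h e2 e3
  rw [e2] at h
  rw [e3, q0, q1, q2, q3] at h
  exact h

variable {F : ℕ → MeasurableSpace Ω}

lemma prod_sm (hF : Monotone F) {g : ℕ → Ω → ℝ} (hg : ∀ k, StronglyMeasurable[F (k + 1)] (g k)) (k : ℕ) :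
    StronglyMeasurable[F k] (fun ω => ∏ i ∈ Finset.range k, g i ω) := by
  apply Finset.stronglyMeasurable_fun_prod
  intro i hi
  exact (hg i).mono (hF (Finset.mem_range.1 hi))

lemma sum_sm (hF : Monotone F) {g : ℕ → Ω → ℝ} (hg : ∀ k, StronglyMeasurable[F (k + 1)] (g k)) (k : ℕ) :
    StronglyMeasurable[F k] (fun ω => ∑ i ∈ Finset.range k, g i ω) := by
  apply Finset.stronglyMeasurable_fun_sum
  intro i hi
  exact (hg i).mono (hF (Finset.mem_range.1 hi))

lemma prod_bdd {g : ℕ → Ω → ℝ} (hg : ∀ k, ∃ C, ∀ᵐ ω ∂P, |g k ω| ≤ C) (k : ℕ) :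
    ∃ C, ∀ᵐ ω ∂P, |∏ i ∈ Finset.range k, g i ω| ≤ C := by
  induction k with
  | zero => exact ⟨1, by simp⟩
  | succ k ih =>
    obtain ⟨C, hC⟩ := ih
    obtain ⟨D, hD⟩ := hg k
    refine ⟨C * D, ?_⟩
    filter_upwards [hC, hD] with ω h1 h2
    rw [Finset.prod_range_succ, abs_mul]
    exact mul_le_mul h1 h2 (abs_nonneg _) ((abs_nonneg _).trans h1)

lemma int_of_bdd {f : Ω → ℝ} (hf : AEStronglyMeasurable f P) (hb : ∃ C, ∀ᵐ ω ∂P, |f ω| ≤ C) :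
    Integrable f P := by
  obtain ⟨C, hC⟩ := hb
  exact Integrable.of_bound hf C hC

lemma bdd_mul' {f g : Ω → ℝ} (hf : ∃ C, ∀ᵐ ω ∂P, |f ω| ≤ C) (hg : ∃ C, ∀ᵐ ω ∂P, |g ω| ≤ C) :
    ∃ C, ∀ᵐ ω ∂P, |f ω * g ω| ≤ C := by
  obtain ⟨C, hC⟩ := hf
  obtain ⟨D, hD⟩ := hg
  refine ⟨C * D, ?_⟩
  filter_upwards [hC, hD] with ω h1 h2
  rw [abs_mul]
  exact mul_le_mul h1 h2 (abs_nonneg _) ((abs_nonneg _).trans h1)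

lemma wsm (hF : Monotone F) (hFle : ∀ k, F k ≤ m0) {g V : ℕ → Ω → ℝ} (n : ℕ)
    (hg : ∀ k, StronglyMeasurable[F (k + 1)] (g k)) (hg0 : ∀ k, ∀ᵐ ω ∂P, 0 ≤ g k ω)
    (hgb : ∀ k, ∃ C, ∀ᵐ ω ∂P, |g k ω| ≤ C)
    (hV : ∀ k ≤ n, StronglyMeasurable[F k] (V k)) (hVb : ∀ k ≤ n, ∃ C, ∀ᵐ ω ∂P, |V k ω| ≤ C)
    (hstep : ∀ k < n, ∀ᵐ ω ∂P, (P[fun ω => g k ω * V (k + 1) ω|F k]) ω ≤ V k ω) :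
    ∫ ω, (∏ i ∈ Finset.range n, g i ω) * V n ω ∂P ≤ ∫ ω, V 0 ω ∂P := by
  have key : ∀ k ≤ n, ∫ ω, (∏ i ∈ Finset.range k, g i ω) * V k ω ∂P ≤ ∫ ω, V 0 ω ∂P := by
    intro k
    induction k with
    | zero => intro _; simp
    | succ k ih =>
      intro hk
      have hk' : k < n := hk
      refine le_trans ?_ (ih hk'.le)
      have hM := prod_sm hF hg k
      have hMb := prod_bdd hgb k
      have hgV : Integrable (fun ω => g k ω * V (k + 1) ω) P :=
        int_of_bdd ((((hg k).mul (hV (k + 1) hk)).mono (hFle _)).aestronglyMeasurable)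
          (bdd_mul' (hgb k) (hVb _ hk))
      have e1 : ∫ ω, (∏ i ∈ Finset.range (k + 1), g i ω) * V (k + 1) ω ∂P
          = ∫ ω, (∏ i ∈ Finset.range k, g i ω) * (P[fun ω => g k ω * V (k + 1) ω|F k]) ω ∂P := by
        rw [← integral_congr_ae (cond_pull (hFle k) hM hMb hgV), integral_condExp (hFle k)]
        congr 1; funext ω; rw [Finset.prod_range_succ]; ring
      rw [e1]
      apply integral_mono_ae (int_pull (hFle k) hM hMb integrable_condExp)
        (int_pull (hFle k) hM hMb (int_of_bdd ((hV k hk'.le).mono (hFle k)).aestronglyMeasurable (hVb k hk'.le)))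
      filter_upwards [hstep k hk', (ae_all_iff.2 hg0)] with ω h1 h2
      exact mul_le_mul_of_nonneg_left h1 (Finset.prod_nonneg fun i _ => h2 i)
  exact key n le_rfl
end
end SN

namespace SN

structure BEh {Ω : Type*} {m0 : MeasurableSpace Ω} (P : Measure Ω) (F : ℕ → MeasurableSpace Ω)
    (n : ℕ) (g ζ σ2 : ℕ → Ω → ℝ) (γ χ δ : ℝ) : Prop where
  mono : Monotone F
  le : ∀ k, F k ≤ m0
  gm : ∀ k, StronglyMeasurable[F (k + 1)] (g k)
  zm : ∀ k, StronglyMeasurable[F (k + 1)] (ζ k)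
  sm : ∀ k, StronglyMeasurable[F k] (σ2 k)
  g0 : ∀ k, ∀ᵐ ω ∂P, 0 ≤ g k ω
  gb : ∀ k, ∃ C, ∀ᵐ ω ∂P, |g k ω| ≤ C
  i1 : ∀ k, Integrable (fun ω => g k ω * ζ k ω) P
  i2 : ∀ k, Integrable (fun ω => g k ω * ζ k ω ^ 2) P
  i3 : ∀ k, Integrable (fun ω => g k ω * |ζ k ω| ^ 3) P
  c0 : ∀ k, ∀ᵐ ω ∂P, (P[g k|F k]) ω = 1
  c1 : ∀ k, ∀ᵐ ω ∂P, (P[fun ω => g k ω * ζ k ω|F k]) ω = 0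
  c2 : ∀ k, ∀ᵐ ω ∂P, |(P[fun ω => g k ω * ζ k ω ^ 2|F k]) ω - σ2 k ω| ≤ χ * σ2 k ω
  c3 : ∀ k, ∀ᵐ ω ∂P, (P[fun ω => g k ω * |ζ k ω| ^ 3|F k]) ω ≤ γ * σ2 k ω
  s0 : ∀ k, ∀ᵐ ω ∂P, 0 ≤ σ2 k ω
  s1 : ∀ k, ∀ᵐ ω ∂P, σ2 k ω ≤ γ ^ 2
  sn : ∀ᵐ ω ∂P, |∑ i ∈ Finset.range n, σ2 i ω - 1| ≤ δ ^ 2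

variable {Ω : Type*} {m0 : MeasurableSpace Ω} {P : Measure Ω} [IsProbabilityMeasure P]
  {F : ℕ → MeasurableSpace Ω} {n : ℕ} {g ζ σ2 : ℕ → Ω → ℝ} {γ χ δ : ℝ}

/-- total mass -/
lemma mass_one (hF : Monotone F) (hFle : ∀ k, F k ≤ m0)
    (hg : ∀ k, StronglyMeasurable[F (k + 1)] (g k)) (hg0 : ∀ k, ∀ᵐ ω ∂P, 0 ≤ g k ω)
    (hgb : ∀ k, ∃ C, ∀ᵐ ω ∂P, |g k ω| ≤ C) (hc0 : ∀ k, ∀ᵐ ω ∂P, (P[g k|F k]) ω = 1) :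
    ∫ ω, (∏ i ∈ Finset.range n, g i ω) ∂P = 1 := by
  induction n with
  | zero => simp
  | succ k ih =>
    rw [← ih]
    have hgi : Integrable (g k) P := int_of_bdd ((hg k).mono (hFle _)).aestronglyMeasurable (hgb k)
    have e := cond_pull (P := P) (hFle k) (prod_sm hF hg k) (prod_bdd hgb k) hgi
    have : ∫ ω, (∏ i ∈ Finset.range (k+1), g i ω) ∂P = ∫ ω, (∏ i ∈ Finset.range k, g i ω) * g k ω ∂P := by
      congr 1; funext ω; rw [Finset.prod_range_succ]
    rw [this, ← integral_condExp (hFle k), integral_congr_ae e]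
    apply integral_congr_ae
    filter_upwards [hc0 k] with ω h
    rw [h, mul_one]

lemma V1_bd {A B : ℝ} (hA : 0 ≤ A) (hB : 0 ≤ B) (u : ℝ) : |V1 A B u| ≤ 1 + A + B := by
  unfold V1
  have hG := G_pos u
  have h1 : |cpi * G u| ≤ 1 := by
    rw [abs_of_pos (mul_pos cpi_pos hG)]
    have := mul_le_mul cpi_le_one (G_le_one u) hG.le zero_le_one
    linarith
  have h2 : |u * G u| ≤ 1 := by
    rw [abs_mul, abs_of_pos hG]
    unfold G
    rw [neg_div, Real.exp_neg, mul_inv_le_iff₀ (Real.exp_pos _)]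
    have := Real.add_one_le_exp (u ^ 2 / 2)
    have := abs_le_half u
    linarith
  have h3 : |-(2 * u) / (1 + u ^ 2) ^ 2| ≤ 1 := by
    rw [abs_div, abs_neg, abs_mul, abs_of_pos (show 0 < (1 + u ^ 2) ^ 2 by positivity),
      div_le_one (by positivity)]
    have := abs_le_half u
    norm_num
    nlinarith [sq_nonneg u]
  have t1 := abs_add_le (-(cpi * G u) + A * (-(u * G u))) (B * (-(2 * u) / (1 + u ^ 2) ^ 2))
  have t2 := abs_add_le (-(cpi * G u)) (A * (-(u * G u)))
  rw [abs_mul, abs_of_nonneg hB] at t1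
  rw [abs_mul, abs_neg, abs_neg, abs_of_nonneg hA] at t2
  have := mul_le_mul_of_nonneg_left h2 hA
  have := mul_le_mul_of_nonneg_left h3 hB
  linarith

/-- main case of the Berry-Esseen bound -/
lemma be_main (h : BEh P F n g ζ σ2 γ χ δ) (hγ : 0 < γ) (hδ : 0 ≤ δ) (hχ : 0 ≤ χ)
    (hχ1 : K3 * χ ≤ 1) (z : ℝ) :
    ∫ ω, (∏ i ∈ Finset.range n, g i ω) * (if z ≤ ∑ i ∈ Finset.range n, ζ i ω then 1 else 0) ∂P
      ≤ Pot (δ + K1 * γ) γ χ (Real.sqrt (1 + δ ^ 2 + (δ + K1 * γ) ^ 2)) z := by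
  set s := δ + K1 * γ with hs
  have hK1 := K1_pos; have hK2 := K2_pos; have hK3 := K3_pos
  have hs0 : 0 < s := by positivity
  have hsγ : K1 * γ ≤ s := by linarith
  set v : ℕ → Ω → ℝ := fun k ω => 1 + δ ^ 2 + s ^ 2 - ∑ i ∈ Finset.range k, σ2 i ω with hv
  set V : ℕ → Ω → ℝ := fun k ω => Pot s γ χ (Real.sqrt (v k ω)) (z - ∑ i ∈ Finset.range k, ζ i ω) with hV
  have hvm : ∀ k, StronglyMeasurable[F k] (v k) := fun k =>
    stronglyMeasurable_const.sub (sum_sm h.mono (fun i => (h.sm i).mono (h.mono (Nat.le_succ i))) k)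
  have hvm' : ∀ k, StronglyMeasurable[F k] (v (k + 1)) := by
    intro k
    apply stronglyMeasurable_const.sub
    apply Finset.stronglyMeasurable_fun_sum
    intro i hi
    exact (h.sm i).mono (h.mono (Nat.lt_succ_iff.1 (Finset.mem_range.1 hi)))
  have hDm : ∀ k, StronglyMeasurable[F k] (fun ω => z - ∑ i ∈ Finset.range k, ζ i ω) := fun k =>
    stronglyMeasurable_const.sub (sum_sm h.mono h.zm k)
  have hs0' := ae_all_iff.2 h.s0
  have hvs : ∀ k ≤ n, ∀ᵐ ω ∂P, s ≤ Real.sqrt (v k ω) := by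
    intro k hk
    filter_upwards [hs0', h.sn] with ω h1 h2
    apply Real.le_sqrt_of_sq_le
    have : ∑ i ∈ Finset.range k, σ2 i ω ≤ ∑ i ∈ Finset.range n, σ2 i ω :=
      Finset.sum_le_sum_of_subset_of_nonneg (Finset.range_mono hk) (fun i _ _ => h1 i)
    have := (abs_le.1 h2).2
    simp only [hv]
    linarith
  have hVm : ∀ k ≤ n, StronglyMeasurable[F k] (V k) := by
    intro k _
    have := (pot_meas s γ χ).comp ((hvm k).measurable.sqrt.prodMk (hDm k).measurable)
    exact this.stronglyMeasurable
  have hVnn : ∀ {ρ : ℝ} (D : ℝ), s ≤ ρ → 0 ≤ Pot s γ χ ρ D := by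
    intro ρ D hρ
    have hL := Lam_nonneg hs0 hγ.le hρ
    have : 0 < ρ := by linarith
    exact VV_nonneg (by positivity) (by positivity) _
  have hVb : ∀ k ≤ n, ∃ C, ∀ᵐ ω ∂P, |V k ω| ≤ C := by
    intro k hk
    refine ⟨8, ?_⟩
    filter_upwards [hvs k hk] with ω h1
    have hL := Lam_nonneg hs0 hγ.le h1
    have : 0 < Real.sqrt (v k ω) := by linarith
    rw [abs_of_nonneg (hVnn _ h1)]
    have hle := VV_le (A := Lam s γ (Real.sqrt (v k ω)) + K3 * χ) (B := K2 * (γ / Real.sqrt (v k ω)) + K3 * χ)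
      (by positivity) (by positivity) ((z - ∑ i ∈ Finset.range k, ζ i ω) / Real.sqrt (v k ω))
    have := M_le hs0 hγ.le hsγ h1 hχ hχ1
    have := Nt_le_one ((z - ∑ i ∈ Finset.range k, ζ i ω) / Real.sqrt (v k ω))
    exact hle.trans (by linarith)
  have hstep : ∀ k < n, ∀ᵐ ω ∂P, (P[fun ω => g k ω * V (k + 1) ω|F k]) ω ≤ V k ω := by
    intro k hk
    have hρ := hvs (k + 1) hk
    set ρ : Ω → ℝ := fun ω => Real.sqrt (v (k + 1) ω) with hρd
    set D : Ω → ℝ := fun ω => z - ∑ i ∈ Finset.range k, ζ i ω with hD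
    have hρm : Measurable[F k] ρ := (hvm' k).measurable.sqrt
    have hDm' : Measurable[F k] D := (hDm k).measurable
    set A : Ω → ℝ := fun ω => Lam s γ (ρ ω) + K3 * χ with hA
    set B : Ω → ℝ := fun ω => K2 * (γ / ρ ω) + K3 * χ with hB
    have hAB : ∀ᵐ ω ∂P, 0 ≤ A ω ∧ 0 ≤ B ω ∧ 1 + A ω + B ω ≤ 8 := by
      filter_upwards [hρ] with ω h1
      have hL := Lam_nonneg hs0 hγ.le h1
      have : 0 < ρ ω := by simp only [hρd]; linarith
      have h2 := M_le hs0 hγ.le hsγ h1 hχ hχ1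
      refine ⟨by simp only [hA, hρd]; positivity, by simp only [hB]; positivity, h2⟩
    have hAm : Measurable[F k] A := by simp only [hA, Lam]; fun_prop
    have hBm : Measurable[F k] B := by simp only [hB]; fun_prop
    set p0 : Ω → ℝ := fun ω => VV (A ω) (B ω) (D ω / ρ ω) with hp0
    set p1 : Ω → ℝ := fun ω => - V1 (A ω) (B ω) (D ω / ρ ω) / ρ ω with hp1
    set p2 : Ω → ℝ := fun ω => V2 (A ω) (B ω) (D ω / ρ ω) / (2 * ρ ω ^ 2) with hp2
    set p3 : Ω → ℝ := fun ω => CT * 32 * (1 + A ω + B ω) * psi (D ω / ρ ω) / ρ ω ^ 3 with hp3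
    have hNm := Nt_cont.measurable
    have hGm := G_cont.measurable
    have m0' : Measurable[F k] p0 := by simp only [hp0, VV, psi]; fun_prop
    have m1' : Measurable[F k] p1 := by simp only [hp1, V1]; fun_prop
    have m2' : Measurable[F k] p2 := by simp only [hp2, V2]; fun_prop
    have m3' : Measurable[F k] p3 := by simp only [hp3, psi]; fun_prop
    have b0 : ∃ C, ∀ᵐ ω ∂P, |p0 ω| ≤ C := by
      refine ⟨8, ?_⟩
      filter_upwards [hAB] with ω ⟨h1, h2, h3⟩
      simp only [hp0]
      rw [abs_of_nonneg (VV_nonneg h1 h2 _)]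
      have := VV_le h1 h2 (D ω / ρ ω)
      have := Nt_le_one (D ω / ρ ω)
      linarith
    have b1 : ∃ C, ∀ᵐ ω ∂P, |p1 ω| ≤ C := by
      refine ⟨8 / s, ?_⟩
      filter_upwards [hAB, hρ] with ω ⟨h1, h2, h3⟩ h4
      have h5 : 0 < ρ ω := lt_of_lt_of_le hs0 h4
      simp only [hp1]
      rw [abs_div, abs_neg, abs_of_pos h5]
      have := V1_bd h1 h2 (D ω / ρ ω)
      exact div_le_div₀ (by norm_num) (by linarith) hs0 h4
    have hCT : 0 < CT := by unfold CT; norm_num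
    have b2 : ∃ C, ∀ᵐ ω ∂P, |p2 ω| ≤ C := by
      refine ⟨CT * 8 * 1 / (2 * s ^ 2), ?_⟩
      filter_upwards [hAB, hρ] with ω ⟨h1, h2, h3⟩ h4
      have h5 : 0 < ρ ω := lt_of_lt_of_le hs0 h4
      simp only [hp2]
      rw [abs_div, abs_of_pos (show 0 < 2 * ρ ω ^ 2 by positivity)]
      have h6 := V2_bd h1 h2 (D ω / ρ ω)
      have h7 : CT * (1 + A ω + B ω) * psi (D ω / ρ ω) ≤ CT * 8 * 1 :=
        mul_le_mul (by nlinarith) (psi_le_one _) (psi_pos _).le (by positivity)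
      have h8 : s ^ 2 ≤ ρ ω ^ 2 := pow_le_pow_left₀ hs0.le h4 2
      exact div_le_div₀ (by positivity) (h6.trans h7) (by positivity) (by linarith)
    have b3 : ∃ C, ∀ᵐ ω ∂P, |p3 ω| ≤ C := by
      refine ⟨CT * 32 * 8 * 1 / s ^ 3, ?_⟩
      filter_upwards [hAB, hρ] with ω ⟨h1, h2, h3⟩ h4
      have h5 : 0 < ρ ω := lt_of_lt_of_le hs0 h4
      have h9 := psi_pos (D ω / ρ ω)
      simp only [hp3]
      rw [abs_of_nonneg (by positivity)]
      have h7 : CT * 32 * (1 + A ω + B ω) * psi (D ω / ρ ω) ≤ CT * 32 * 8 * 1 :=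
        mul_le_mul (by nlinarith) (psi_le_one _) (psi_pos _).le (by positivity)
      have h8 : s ^ 3 ≤ ρ ω ^ 3 := pow_le_pow_left₀ hs0.le h4 3
      exact div_le_div₀ (by positivity) h7 (by positivity) (by linarith)
    have hgi : Integrable (g k) P := int_of_bdd ((h.gm k).mono (h.le _)).aestronglyMeasurable (h.gb k)
    have hgV : Integrable (fun ω => g k ω * V (k + 1) ω) P :=
      int_of_bdd ((((h.gm k).mul (hVm (k + 1) hk)).mono (h.le _)).aestronglyMeasurable)
        (bdd_mul' (h.gb k) (hVb _ hk))
    have hcs := cond_step (P := P) (h.le k) hgV m0'.stronglyMeasurable b0 hgi m1'.stronglyMeasurable b1 (h.i1 k)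
      m2'.stronglyMeasurable b2 (h.i2 k) m3'.stronglyMeasurable b3 (h.i3 k) (by
        filter_upwards [hρ, h.g0 k] with ω h1 h2
        have ht := pot_taylor hs0 hγ.le h1 hχ (D ω) (ζ k ω)
        have hVe : V (k + 1) ω = Pot s γ χ (Real.sqrt (v (k + 1) ω)) (D ω - ζ k ω) := by
          simp only [hV, hD]; rw [Finset.sum_range_succ]; congr 1; ring
        rw [hVe]
        have := mul_le_mul_of_nonneg_left ht h2
        refine this.trans (le_of_eq ?_)
        simp only [hp0, hp1, hp2, hp3, hA, hB, hρd]
        ring)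
    filter_upwards [hcs, h.c0 k, h.c1 k, h.c2 k, h.c3 k, h.s0 k, h.s1 k, hρ, hAB] with ω q e0 e1 e2 e3 t0 t1 hr ⟨hA0, hB0, _⟩
    rw [e0, e1] at q
    have hps := pot_step (D := D ω) hs0 hγ.le hsγ hr hχ hχ1 t0 t1
    have hvv : Real.sqrt (v (k+1) ω) ^ 2 + σ2 k ω = v k ω := by
      rw [Real.sq_sqrt (by
        by_contra hneg
        push Not at hneg
        rw [Real.sqrt_eq_zero_of_nonpos hneg.le] at hr
        linarith)]
      simp only [hv]; rw [Finset.sum_range_succ]; ring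
    rw [hvv] at hps
    refine le_trans q (le_trans ?_ hps)
    have hp3n : 0 ≤ p3 ω := by
      have h5 : 0 < ρ ω := lt_of_lt_of_le hs0 hr
      have h9 := psi_pos (D ω / ρ ω)
      simp only [hp3]; positivity
    have a3 := mul_le_mul_of_nonneg_left e3 hp3n
    have a2 : p2 ω * (P[fun ω => g k ω * ζ k ω ^ 2|F k]) ω ≤ p2 ω * σ2 k ω + |p2 ω| * (χ * σ2 k ω) := by
      have : p2 ω * ((P[fun ω => g k ω * ζ k ω ^ 2|F k]) ω - σ2 k ω) ≤ |p2 ω| * (χ * σ2 k ω) := by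
        refine (le_abs_self _).trans ?_
        rw [abs_mul]
        exact mul_le_mul_of_nonneg_left e2 (abs_nonneg _)
      linarith
    have ea : |p2 ω| = |V2 (A ω) (B ω) (D ω / ρ ω)| / (2 * ρ ω ^ 2) := by
      simp only [hp2]
      rw [abs_div, abs_of_nonneg (show 0 ≤ 2 * ρ ω ^ 2 by positivity)]
    rw [ea] at a2
    simp only [hp0, hp2, hp3, hA, hB, hρd] at a2 a3 ⊢
    linarith
  have hmain := wsm h.mono h.le n h.gm h.g0 h.gb hVm hVb hstep
  have hV0 : ∫ ω, V 0 ω ∂P = Pot s γ χ (Real.sqrt (1 + δ ^ 2 + s ^ 2)) z := by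
    simp [hV, hv]
  rw [hV0] at hmain
  refine le_trans ?_ hmain
  have hMm := ((prod_sm h.mono h.gm n).mono (h.le n)).aestronglyMeasurable (μ := P)
  have hMi := int_of_bdd hMm (prod_bdd h.gb n)
  have hMVi : Integrable (fun ω => (∏ i ∈ Finset.range n, g i ω) * V n ω) P :=
    int_of_bdd (hMm.mul ((hVm n le_rfl).mono (h.le n)).aestronglyMeasurable)
      (bdd_mul' (prod_bdd h.gb n) (hVb n le_rfl))
  apply integral_mono_of_nonneg _ hMVi
  · filter_upwards [ae_all_iff.2 h.g0, h.sn, hvs n le_rfl] with ω h1 h2 h3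
    apply mul_le_mul_of_nonneg_left _ (Finset.prod_nonneg fun i _ => h1 i)
    split_ifs with hz
    · apply pot_terminal hs0 hγ.le h3 _ hχ (by linarith)
      rw [Real.sq_sqrt (by
        by_contra hneg
        push Not at hneg
        rw [Real.sqrt_eq_zero_of_nonpos hneg.le] at h3
        linarith)]
      have := (abs_le.1 h2).1
      have : δ ^ 2 ≤ s ^ 2 := by
        apply pow_le_pow_left₀ hδ; rw [hs]; nlinarith
      simp only [hv]; linarith
    · exact hVnn _ h3
  · filter_upwards [ae_all_iff.2 h.g0] with ω h1
    apply mul_nonneg (Finset.prod_nonneg fun i _ => h1 i)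
    split_ifs <;> norm_num
end SN

namespace SN
variable {Ω : Type*} {m0 : MeasurableSpace Ω} {P : Measure Ω} [IsProbabilityMeasure P]
  {F : ℕ → MeasurableSpace Ω} {n : ℕ} {g ζ σ2 : ℕ → Ω → ℝ} {γ χ δ : ℝ}

noncomputable def CBE : ℝ := 5 * K1 + K2 + 2 * K3 + 4
lemma CBE_pos : 0 < CBE := by
  have := K1_pos; have := K2_pos; have := K3_pos; unfold CBE; positivity

lemma ite_le_int (h : BEh P F n g ζ σ2 γ χ δ) (z : ℝ) :
    ∫ ω, (∏ i ∈ Finset.range n, g i ω) * (if z ≤ ∑ i ∈ Finset.range n, ζ i ω then 1 else 0) ∂P ≤ 1 := by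
  refine le_trans ?_ (le_of_eq (mass_one (P := P) (n := n) h.mono h.le h.gm h.g0 h.gb h.c0))
  have hMm := ((prod_sm h.mono h.gm n).mono (h.le n)).aestronglyMeasurable (μ := P)
  have hMi := int_of_bdd hMm (prod_bdd h.gb n)
  apply integral_mono_of_nonneg _ hMi
  · filter_upwards [ae_all_iff.2 h.g0] with ω h1
    have := Finset.prod_nonneg (s := Finset.range n) fun i _ => h1 i
    split_ifs <;> simp [this]
  · filter_upwards [ae_all_iff.2 h.g0] with ω h1
    apply mul_nonneg (Finset.prod_nonneg fun i _ => h1 i)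
    split_ifs <;> norm_num

lemma be_upper (h : BEh P F n g ζ σ2 γ χ δ) (hγ : 0 < γ) (hδ : 0 ≤ δ) (hχ : 0 ≤ χ) (z : ℝ) :
    ∫ ω, (∏ i ∈ Finset.range n, g i ω) * (if z ≤ ∑ i ∈ Finset.range n, ζ i ω then 1 else 0) ∂P
      ≤ Nt z + CBE * (δ + γ * (1 + |Real.log γ|) + χ) := by
  have hK1 := K1_pos; have hK2 := K2_pos; have hK3 := K3_pos
  have hN := Nt_nonneg z
  have hl := abs_nonneg (Real.log γ)
  have hγl : 0 ≤ γ * |Real.log γ| := by positivity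
  have hone := ite_le_int h z
  by_cases hχ1 : K3 * χ ≤ 1
  swap
  · push Not at hχ1
    have : K3 * χ ≤ CBE * χ := by unfold CBE; nlinarith
    have : 0 ≤ CBE * (δ + γ * (1 + |Real.log γ|)) := by have := CBE_pos; positivity
    nlinarith
  by_cases hs1 : δ + K1 * γ ≤ 1
  swap
  · push Not at hs1
    have : δ + K1 * γ ≤ CBE * (δ + γ) := by unfold CBE; nlinarith
    have : 0 ≤ CBE * (γ * |Real.log γ| + χ) := by have := CBE_pos; positivity
    nlinarith
  refine (be_main h hγ hδ hχ hχ1 z).trans ?_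
  have hsd : δ ≤ δ + K1 * γ := by have : 0 < K1 * γ := by positivity
                                  linarith
  have hγs : γ ≤ δ + K1 * γ := by have := K1_ge; have := K2_ge; nlinarith
  set s := δ + K1 * γ with hs
  have hs0 : 0 < s := by positivity
  set ρ := Real.sqrt (1 + δ ^ 2 + s ^ 2) with hρ
  have hρ2 : ρ ^ 2 = 1 + δ ^ 2 + s ^ 2 := Real.sq_sqrt (by positivity)
  have hρ1 : 1 ≤ ρ := Real.one_le_sqrt.2 (by nlinarith [sq_nonneg δ, sq_nonneg s])
  have hρs : s ≤ ρ := hs1.trans hρ1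
  have hL := Lam_nonneg hs0 hγ.le hρs
  have h1 := VV_le (A := Lam s γ ρ + K3 * χ) (B := K2 * (γ / ρ) + K3 * χ) (by positivity) (by positivity) (z / ρ)
  have h2 := Nt_scale (z := z) hρ1
  have h3 : ρ - 1 ≤ δ + s := by nlinarith [sq_nonneg δ, sq_nonneg s]
  have h4 : K2 * (γ / ρ) ≤ K2 * γ := by
    gcongr; exact div_le_self hγ.le hρ1
  have h5 : Lam s γ ρ ≤ 2 * s + K1 * γ * (2 + 2 * |Real.log γ|) := by
    unfold Lam
    have hlog : Real.log (ρ ^ 2 / s ^ 2) ≤ 2 + 2 * |Real.log γ| := by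
      rw [Real.log_div (by positivity) (by positivity), Real.log_pow s]
      have a1 : Real.log (ρ ^ 2) ≤ 2 := by
        have := Real.log_le_sub_one_of_pos (show 0 < ρ ^ 2 by positivity)
        nlinarith
      have a2 : Real.log γ ≤ Real.log s := Real.log_le_log hγ hγs
      have a3 := neg_le_abs (Real.log γ)
      push_cast; linarith
    have h1' : 1 ≤ ρ ^ 2 / s ^ 2 := by rw [le_div_iff₀ (by positivity)]; nlinarith
    have := Real.log_nonneg h1'
    refine (div_le_self (by positivity) hρ1).trans ?_
    gcongr
  unfold Pot
  have h6 : 0 ≤ K1 * δ := by positivity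
  have h7 : 0 ≤ K2 * δ := by positivity
  have h8 : 0 ≤ K3 * δ := by positivity
  have h9 : 0 ≤ K2 * (γ * |Real.log γ|) := by positivity
  have h10 : 0 ≤ K3 * (γ * |Real.log γ|) := by positivity
  have h11 : 0 ≤ K1 * (γ * |Real.log γ|) := by positivity
  have h12 : 0 ≤ K1 * χ := by positivity
  have h13 : 0 ≤ K2 * χ := by positivity
  have h14 : 0 ≤ K3 * γ := by positivity
  unfold CBE
  nlinarith

lemma BEh.neg (h : BEh P F n g ζ σ2 γ χ δ) : BEh P F n g (fun k ω => - ζ k ω) σ2 γ χ δ where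
  mono := h.mono
  le := h.le
  gm := h.gm
  zm := fun k => (h.zm k).neg
  sm := h.sm
  g0 := h.g0
  gb := h.gb
  i1 := fun k => by simpa using (h.i1 k).neg
  i2 := fun k => by simpa using (h.i2 k)
  i3 := fun k => by simpa using (h.i3 k)
  c0 := h.c0
  c1 := fun k => by
    have e := condExp_neg (μ := P) (fun ω => g k ω * ζ k ω) (F k)
    have e2 : (fun ω => g k ω * -ζ k ω) = -(fun ω => g k ω * ζ k ω) := by funext ω; simp
    rw [e2]
    filter_upwards [e, h.c1 k] with ω h1 h2
    rw [h1]; simp [h2]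
  c2 := by simpa using h.c2
  c3 := by simpa using h.c3
  s0 := h.s0
  s1 := h.s1
  sn := h.sn

lemma be_lower (h : BEh P F n g ζ σ2 γ χ δ) (hγ : 0 < γ) (hδ : 0 ≤ δ) (hχ : 0 ≤ χ) (z : ℝ) :
    Nt z - CBE * (δ + γ * (1 + |Real.log γ|) + χ) ≤
    ∫ ω, (∏ i ∈ Finset.range n, g i ω) * (if z ≤ ∑ i ∈ Finset.range n, ζ i ω then 1 else 0) ∂P := by
  have hu := be_upper h.neg hγ hδ hχ (-z)
  rw [Nt_neg] at hu
  have hm := mass_one (P := P) (n := n) h.mono h.le h.gm h.g0 h.gb h.c0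
  have hMm := ((prod_sm h.mono h.gm n).mono (h.le n)).aestronglyMeasurable (μ := P)
  have hMi := int_of_bdd hMm (prod_bdd h.gb n)
  have hYm : Measurable (fun ω => ∑ i ∈ Finset.range n, ζ i ω) :=
    ((sum_sm h.mono h.zm n).mono (h.le n)).measurable
  have int1 : ∀ (S : Set Ω) (hS : MeasurableSet S) [DecidablePred (· ∈ S)], Integrable (fun ω => (∏ i ∈ Finset.range n, g i ω) * (if ω ∈ S then 1 else 0)) P := by
    intro S hS _
    have := hMi.indicator hS
    refine this.congr (Filter.Eventually.of_forall fun ω => ?_)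
    by_cases hω : ω ∈ S <;> simp [hω]
  have I1 := int1 {ω | z ≤ ∑ i ∈ Finset.range n, ζ i ω} (measurableSet_le measurable_const hYm)
  have I2 := int1 {ω | -z ≤ ∑ i ∈ Finset.range n, -ζ i ω} (measurableSet_le measurable_const (by
    simp only [Finset.sum_neg_distrib]; exact hYm.neg))
  simp only [Set.mem_setOf_eq] at I1 I2
  have : (1:ℝ) ≤ ∫ ω, ((∏ i ∈ Finset.range n, g i ω) * (if z ≤ ∑ i ∈ Finset.range n, ζ i ω then 1 else 0)
      + (∏ i ∈ Finset.range n, g i ω) * (if -z ≤ ∑ i ∈ Finset.range n, -ζ i ω then 1 else 0)) ∂P := by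
    refine le_trans (le_of_eq hm.symm) ?_
    apply integral_mono_ae hMi (I1.add I2)
    filter_upwards [ae_all_iff.2 h.g0] with ω h1
    have h0 := Finset.prod_nonneg (s := Finset.range n) fun i _ => h1 i
    simp only [Finset.sum_neg_distrib, neg_le_neg_iff]
    rcases le_total z (∑ i ∈ Finset.range n, ζ i ω) with h2 | h2
    · simp only [h2, if_true, Pi.add_apply]
      split_ifs <;> simp [h0]
    · simp only [h2, if_true, Pi.add_apply]
      split_ifs <;> simp [h0]
  rw [integral_add I1 I2] at this
  linarith

lemma Nt_tendsto : Tendsto Nt atTop (𝓝 0) := by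
  apply squeeze_zero' (g := fun v => 1 / v)
  · exact Filter.Eventually.of_forall Nt_nonneg
  · filter_upwards [eventually_gt_atTop 0] with v hv
    refine (Nt_le_G hv.le).trans ?_
    unfold G
    rw [neg_div, Real.exp_neg, ← one_div]
    apply one_div_le_one_div_of_le hv
    have := Real.add_one_le_exp (v ^ 2 / 2)
    nlinarith [sq_nonneg (v - 1)]
  · simpa using tendsto_inv_atTop_zero (𝕜 := ℝ)

lemma gauss_lap {x : ℝ} (hx : 0 < x) :
    IntegrableOn (fun s => x * Real.exp (-x * s) * (Nt 0 - Nt s)) (Set.Ioi 0) ∧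
    ∫ s in Set.Ioi 0, x * Real.exp (-x * s) * (Nt 0 - Nt s) = Real.exp (x ^ 2 / 2) * Nt x := by
  set Φ : ℝ → ℝ := fun s => -(Real.exp (-x * s) * (Nt 0 - Nt s)) - Real.exp (x ^ 2 / 2) * Nt (x + s) with hΦ
  have hd : ∀ s, HasDerivAt Φ (x * Real.exp (-x * s) * (Nt 0 - Nt s)) s := by
    intro s
    have h1 : HasDerivAt (fun s => Real.exp (-x * s)) (Real.exp (-x * s) * (-x * 1)) s :=
      ((hasDerivAt_id s).const_mul (-x)).exp
    have h2 : HasDerivAt (fun s => Nt 0 - Nt s) (-(-(cpi * G s))) s := (Nt_hasDerivAt s).const_sub _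
    have h3 : HasDerivAt (fun s => Nt (x + s)) (-(cpi * G (x + s))) s := (Nt_hasDerivAt (x + s)).comp_const_add x s
    have := ((h1.mul h2).neg).sub (h3.const_mul (Real.exp (x ^ 2 / 2)))
    refine this.congr_deriv ?_
    have e : Real.exp (x ^ 2 / 2) * G (x + s) = Real.exp (-x * s) * G s := by
      unfold G; rw [← Real.exp_add, ← Real.exp_add]; congr 1; ring
    linear_combination cpi * e
  have hlim : Tendsto Φ atTop (𝓝 0) := by
    have t1 : Tendsto (fun s => Real.exp (-x * s)) atTop (𝓝 0) := by
      apply Real.tendsto_exp_atBot.comp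
      exact tendsto_id.const_mul_atTop_of_neg (by linarith)
    have t2 : Tendsto (fun s => Nt 0 - Nt s) atTop (𝓝 (Nt 0 - 0)) := tendsto_const_nhds.sub Nt_tendsto
    have t3 : Tendsto (fun s => Nt (x + s)) atTop (𝓝 0) :=
      Nt_tendsto.comp (tendsto_atTop_add_const_left _ _ tendsto_id)
    have := ((t1.mul t2).neg).sub (t3.const_mul (Real.exp (x ^ 2 / 2)))
    rw [show (0:ℝ) = -(0*(Nt 0 - 0)) - Real.exp (x^2/2)*0 by simp]; exact this
  have hnn : ∀ s ∈ Set.Ioi (0:ℝ), 0 ≤ x * Real.exp (-x * s) * (Nt 0 - Nt s) := by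
    intro s hs
    have := Nt_anti (le_of_lt hs)
    have : 0 ≤ Nt 0 - Nt s := by linarith
    positivity
  refine ⟨integrableOn_Ioi_deriv_of_nonneg' (fun s _ => hd s) hnn hlim, ?_⟩
  rw [integral_Ioi_of_hasDerivAt_of_nonneg' (fun s _ => hd s) hnn hlim]
  simp [hΦ]

lemma laplace {M Y : Ω → ℝ} (hM0 : ∀ᵐ ω ∂P, 0 ≤ M ω) (hM : Integrable M P)
    (hY : Measurable Y) {x d D : ℝ} (hx : 0 ≤ x) (hd : 0 ≤ d) (hD : 0 ≤ D)
    (hU : ∀ z, ∫ ω, M ω * (if z ≤ Y ω then 1 else 0) ∂P ≤ Nt z + D)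
    (hL : ∀ z, Nt z - D ≤ ∫ ω, M ω * (if z ≤ Y ω then 1 else 0) ∂P) :
    ∫ ω, M ω * (if 0 ≤ Y ω + d then Real.exp (-x * (Y ω + d)) else 0) ∂P
      ≤ Real.exp (x ^ 2 / 2) * Nt x + d + 2 * D := by
  have hNd : Nt (-d) ≤ Nt 0 + d := by
    rcases eq_or_lt_of_le hd with h | h
    · simp [← h]
    obtain ⟨c, _, hc⟩ := Nt_mvt (show -d < 0 by linarith)
    have h1 : cpi * G c ≤ 1 * 1 := mul_le_mul cpi_le_one (G_le_one c) (G_pos c).le zero_le_one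
    nlinarith
  rcases eq_or_lt_of_le hx with hx0 | hx0
  · rw [← hx0]
    have := hU (-d)
    have e : ∀ ω, (0 ≤ Y ω + d) = (-d ≤ Y ω) := fun ω => by
      rw [eq_iff_iff]; constructor <;> intro h <;> linarith
    simp only [e, neg_zero, zero_mul, Real.exp_zero]
    simp
    simp at this
    linarith
  -- Fubini
  set S : Set (Ω × ℝ) := {p | 0 ≤ Y p.1 + d ∧ Y p.1 + d < p.2} with hS
  have hYd : Measurable (fun p : Ω × ℝ => Y p.1 + d) := (hY.comp measurable_fst).add_const d
  have hSm : MeasurableSet S :=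
    (measurableSet_le measurable_const hYd).inter (measurableSet_lt hYd measurable_snd)
  set f : Ω → ℝ → ℝ := fun ω s => S.indicator (fun p => M p.1 * (x * Real.exp (-x * p.2))) (ω, s) with hf
  have hexp : ∀ c : ℝ, IntegrableOn (fun s => x * Real.exp (-x * s)) (Set.Ioi c) := fun c =>
    (integrableOn_exp_mul_Ioi (by linarith) c).const_mul x
  have hexpv : ∀ c : ℝ, ∫ s in Set.Ioi c, x * Real.exp (-x * s) = Real.exp (-x * c) := fun c => by
    rw [integral_const_mul, integral_exp_mul_Ioi (by linarith)]; field_simp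
  have hfi : Integrable (Function.uncurry f) (P.prod (volume.restrict (Set.Ioi 0))) :=
    (hM.mul_prod (hexp 0)).indicator hSm
  have hsw := integral_integral_swap hfi
  have e1 : ∀ ω, ∫ s in Set.Ioi 0, f ω s = M ω * (if 0 ≤ Y ω + d then Real.exp (-x * (Y ω + d)) else 0) := by
    intro ω
    split_ifs with h
    · have : ∀ s, f ω s = (Set.Ioi (Y ω + d)).indicator (fun s => M ω * (x * Real.exp (-x * s))) s := by
        intro s
        simp only [hf, Set.indicator, hS, Set.mem_setOf_eq, h, true_and, Set.mem_Ioi]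
      simp_rw [this]
      rw [setIntegral_indicator measurableSet_Ioi]
      have : Set.Ioi (0:ℝ) ∩ Set.Ioi (Y ω + d) = Set.Ioi (Y ω + d) := by
        rw [Set.Ioi_inter_Ioi, sup_eq_right.2 h]
      rw [this, integral_const_mul, hexpv]
    · have : ∀ s, f ω s = 0 := by
        intro s
        simp only [hf, Set.indicator, hS, Set.mem_setOf_eq, h, false_and, if_false]
      simp [this]
  simp_rw [← e1]
  rw [hsw]
  have hMint : ∀ z, Integrable (fun ω => M ω * (if z ≤ Y ω then 1 else 0)) P := by
    intro z
    have := hM.indicator (measurableSet_le (measurable_const (a := z)) hY)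
    refine this.congr (Filter.Eventually.of_forall fun ω => ?_)
    by_cases hω : z ≤ Y ω <;> simp [hω, Set.indicator]
  have e2 : ∀ s ∈ Set.Ioi (0:ℝ), ∫ ω, f ω s ∂P ≤ x * Real.exp (-x * s) * (Nt 0 - Nt s) + (d + 2 * D) * (x * Real.exp (-x * s)) := by
    intro s hs
    have hs' : 0 < s := hs
    have : ∀ ω, f ω s = x * Real.exp (-x * s) * (M ω * (if -d ≤ Y ω then 1 else 0) - M ω * (if s - d ≤ Y ω then 1 else 0)) := by
      intro ω
      simp only [hf, Set.indicator, hS, Set.mem_setOf_eq]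
      by_cases h1 : -d ≤ Y ω
      · by_cases h2 : s - d ≤ Y ω
        · have : ¬ (Y ω + d < s) := by linarith
          simp [h1, h2, this]
        · have a : Y ω + d < s := by linarith
          have b : 0 ≤ Y ω + d := by linarith
          simp [h1, h2, a, b]; ring
      · have h2 : ¬ (s - d ≤ Y ω) := by intro h; apply h1; linarith
        have b : ¬ (0 ≤ Y ω + d) := by intro h; apply h1; linarith
        simp [h1, h2, b]
    simp_rw [this]
    rw [integral_const_mul, integral_sub (hMint _) (hMint _)]
    have a1 := hU (-d)
    have a2 := hL (s - d)
    have a3 := Nt_anti (show s - d ≤ s by linarith)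
    have a4 : 0 ≤ x * Real.exp (-x * s) := by positivity
    nlinarith
  obtain ⟨g1, g2⟩ := gauss_lap hx0
  have : ∫ s in Set.Ioi (0:ℝ), ∫ ω, f ω s ∂P ≤
      ∫ s in Set.Ioi (0:ℝ), (x * Real.exp (-x * s) * (Nt 0 - Nt s) + (d + 2 * D) * (x * Real.exp (-x * s))) := by
    apply setIntegral_mono_on hfi.integral_prod_right (g1.add ((hexp 0).const_mul _)) measurableSet_Ioi e2
  refine this.trans (le_of_eq ?_)
  rw [integral_add g1 ((hexp 0).const_mul _), g2, integral_const_mul, hexpv]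
  simp; ring
end SN

namespace SN

/-- elementary weight -/
noncomputable def fw (b y : ℝ) : ℝ := Real.exp (y - b * y ^ 2)

lemma fw_pos (b y : ℝ) : 0 < fw b y := Real.exp_pos _

lemma exp_one_le3 : Real.exp 1 ≤ 3 := by have := Real.exp_one_lt_d9; linarith

lemma fw_le {b : ℝ} (hb : 1 / 4 ≤ b) (y : ℝ) : fw b y ≤ 3 := by
  refine le_trans ?_ exp_one_le3
  unfold fw
  apply Real.exp_le_exp.2
  nlinarith [sq_nonneg (y - 2), sq_nonneg y]

lemma exp_third (u : ℝ) : |Real.exp u - 1 - u - u ^ 2 / 2| ≤ |u| ^ 3 * Real.exp |u| := by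
  have := Complex.norm_exp_sub_sum_le_norm_mul_exp (u : ℂ) 3
  simp only [Finset.sum_range_succ, Finset.sum_range_zero] at this
  have e : Complex.exp (u:ℂ) - (0 + (u:ℂ) ^ 0 / (Nat.factorial 0 : ℕ) + (u:ℂ) ^ 1 / (Nat.factorial 1 : ℕ) + (u:ℂ) ^ 2 / (Nat.factorial 2 : ℕ))
      = ((Real.exp u - 1 - u - u ^ 2 / 2 : ℝ) : ℂ) := by
    push_cast [Nat.factorial]; ring
  rw [e, Complex.norm_real, Complex.norm_real] at this
  exact this

lemma fw_exp {b : ℝ} (hb : 1 / 4 ≤ b) (hb1 : b ≤ 1) (y : ℝ) :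
    |fw b y - (1 + y + (1 / 2 - b) * y ^ 2)| ≤ 80 * |y| ^ 3 := by
  have ha := abs_nonneg y
  have hy2 : |y| ^ 2 = y ^ 2 := sq_abs y
  rcases le_total |y| 1 with h | h
  · have hu : |y - b * y ^ 2| ≤ 2 * |y| := by
      rw [abs_le]; have := abs_le.1 (le_refl |y|); constructor <;> nlinarith [sq_nonneg y]
    have h1 := exp_third (y - b * y ^ 2)
    have h2 : Real.exp |y - b * y ^ 2| ≤ 9 := by
      have : Real.exp |y - b * y ^ 2| ≤ Real.exp (1 + 1) := Real.exp_le_exp.2 (by linarith)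
      rw [Real.exp_add] at this
      have := exp_one_le3; have := Real.exp_pos 1
      nlinarith
    have h3 : |y - b * y ^ 2| ^ 3 * Real.exp |y - b * y ^ 2| ≤ (2 * |y|) ^ 3 * 9 := by gcongr
    have e : fw b y - (1 + y + (1 / 2 - b) * y ^ 2) = (Real.exp (y - b * y ^ 2) - 1 - (y - b * y ^ 2) - (y - b * y ^ 2) ^ 2 / 2)
      + (-(b * y ^ 3) + b ^ 2 * y ^ 4 / 2) := by unfold fw; ring
    rw [e]
    refine (abs_add_le _ _).trans ?_
    have h4 : |-(b * y ^ 3) + b ^ 2 * y ^ 4 / 2| ≤ 2 * |y| ^ 3 := by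
      refine (abs_add_le _ _).trans ?_
      have e1 : |-(b * y ^ 3)| = b * |y| ^ 3 := by rw [abs_neg, abs_mul, abs_pow, abs_of_nonneg (by linarith : 0 ≤ b)]
      have e2 : |b ^ 2 * y ^ 4 / 2| = b ^ 2 * |y| ^ 4 / 2 := by
        rw [abs_div, abs_mul, abs_pow y, abs_of_nonneg (sq_nonneg b)]; norm_num
      rw [e1, e2]
      have : |y| ^ 4 ≤ |y| ^ 3 := pow_le_pow_of_le_one ha h (by norm_num)
      have h3 : 0 ≤ |y| ^ 3 := by positivity
      have hb2 : b ^ 2 ≤ 1 := by nlinarith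
      nlinarith [pow_nonneg ha 4]
    nlinarith [pow_nonneg ha 3]
  · have h1 := fw_le hb y
    have h0 := fw_pos b y
    have h2 : |y| ≤ |y| ^ 3 := le_self_pow₀ h (by norm_num)
    have h3 : y ^ 2 ≤ |y| ^ 3 := by rw [← hy2]; exact pow_le_pow_right₀ h (by norm_num)
    have := abs_le.1 (le_refl |y|)
    rw [abs_le]; constructor <;> nlinarith [sq_nonneg y]

lemma fw_one {b : ℝ} (hb : 1 / 4 ≤ b) (hb1 : b ≤ 1) (y : ℝ) : |fw b y - 1| ≤ 82 * |y| := by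
  have ha := abs_nonneg y
  have hl := abs_le.1 (le_refl |y|)
  rcases le_total |y| 1 with h | h
  · have h1 := abs_le.1 (fw_exp hb hb1 y)
    have hy2 : y ^ 2 ≤ |y| := by rw [← sq_abs]; nlinarith
    have hy3 : |y| ^ 3 ≤ |y| := pow_le_of_le_one ha h (by norm_num)
    rw [abs_le]; constructor <;> nlinarith [sq_nonneg y]
  · have h1 := fw_le hb y
    have h0 := fw_pos b y
    rw [abs_le]; constructor <;> linarith

lemma fw_poly (y : ℝ) : (1 + |y|) ^ 3 * fw (1 / 2) y ≤ 6561 := by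
  have h1 : (1 + |y|) ^ 3 ≤ Real.exp (3 * |y|) := by
    have := Real.add_one_le_exp |y|
    rw [show 3 * |y| = (3:ℕ) * |y| by norm_num, Real.exp_nat_mul]
    gcongr; linarith
  have h2 : (1 + |y|) ^ 3 * fw (1 / 2) y ≤ Real.exp (3 * |y|) * fw (1 / 2) y := by
    have := fw_pos (1/2) y; gcongr
  refine h2.trans ?_
  unfold fw
  rw [← Real.exp_add]
  have h3 : Real.exp (3 * |y| + (y - 1 / 2 * y ^ 2)) ≤ Real.exp ((8:ℕ) * 1) := by
    apply Real.exp_le_exp.2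
    have := le_abs_self y
    rw [← sq_abs y]
    push_cast
    nlinarith [sq_nonneg (|y| - 4)]
  refine h3.trans ?_
  rw [Real.exp_nat_mul]
  have : Real.exp 1 ^ 8 ≤ 3 ^ 8 := by have := exp_one_le3; gcongr
  norm_num at this ⊢
  linarith

lemma half_fac (y : ℝ) : |1 - y / 2| ≤ 1 + |y| := by
  have hl := abs_le.1 (le_refl |y|)
  rw [abs_le]; constructor <;> linarith

lemma fw_h1 (y : ℝ) : |(1 - y / 2) * fw (1 / 2) y - (1 + y / 2)| ≤ 200 * y ^ 2 := by
  have ha := abs_nonneg y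
  have hl := abs_le.1 (le_refl |y|)
  rw [← sq_abs y]
  rcases le_total |y| 1 with h | h
  · have h1 := fw_exp (b := 1/2) (by norm_num) (by norm_num) y
    have e : (1 - y / 2) * fw (1 / 2) y - (1 + y / 2) = (1 - y / 2) * (fw (1/2) y - (1 + y + (1 / 2 - 1/2) * y ^ 2)) + -(y ^ 2 / 2) := by ring
    rw [e]
    refine (abs_add_le _ _).trans ?_
    rw [abs_mul, abs_neg, abs_of_nonneg (by positivity : 0 ≤ y ^ 2 / 2)]
    have h2 : |1 - y / 2| ≤ 3 / 2 := by rw [abs_le]; constructor <;> linarith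
    have h3 : |1 - y / 2| * |fw (1/2) y - (1 + y + (1 / 2 - 1/2) * y ^ 2)| ≤ 3 / 2 * (80 * |y| ^ 3) := by gcongr
    have h4 : |y| ^ 3 ≤ |y| ^ 2 := pow_le_pow_of_le_one ha h (by norm_num)
    have e5 := sq_abs y
    have := pow_nonneg ha 2
    linarith
  · have h1 := fw_le (b := 1/2) (by norm_num) y
    have h0 := fw_pos (1/2) y
    refine (abs_sub _ _).trans ?_
    rw [abs_mul, abs_of_pos h0]
    have h2 := half_fac y
    have h3 : |1 + y / 2| ≤ 1 + |y| := by rw [abs_le]; constructor <;> linarith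
    have h4 : |1 - y / 2| * fw (1/2) y ≤ (1 + |y|) * 3 := by gcongr
    nlinarith

lemma fw_h2 (y : ℝ) : |(1 - y / 2) ^ 2 * fw (1 / 2) y - 1| ≤ 7000 * |y| := by
  have ha := abs_nonneg y
  have hl := abs_le.1 (le_refl |y|)
  have h0 := fw_pos (1/2) y
  rcases le_total |y| 1 with h | h
  · have h1 := fw_one (b := 1/2) (by norm_num) (by norm_num) y
    have e : (1 - y / 2) ^ 2 * fw (1 / 2) y - 1 = (1 - y / 2) ^ 2 * (fw (1/2) y - 1) + (-y + y ^ 2 / 4) := by ring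
    rw [e]
    refine (abs_add_le _ _).trans ?_
    rw [abs_mul, abs_of_nonneg (sq_nonneg (1 - y / 2))]
    have h2 : (1 - y / 2) ^ 2 ≤ 9 / 4 := by nlinarith
    have h3 : (1 - y / 2) ^ 2 * |fw (1/2) y - 1| ≤ 9 / 4 * (82 * |y|) := by gcongr
    have h4 : |-y + y ^ 2 / 4| ≤ 2 * |y| := by
      have : y ^ 2 ≤ |y| := by rw [← sq_abs]; nlinarith
      rw [abs_le]; constructor <;> nlinarith [sq_nonneg y]
    linarith
  · have h1 := fw_poly y
    have h2 := half_fac y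
    have h3 : (1 - y / 2) ^ 2 * fw (1/2) y ≤ 6561 := by
      refine le_trans ?_ h1
      gcongr
      rw [← sq_abs]
      calc |1 - y / 2| ^ 2 ≤ (1 + |y|) ^ 2 := by gcongr
        _ ≤ _ := pow_le_pow_right₀ (by linarith) (by norm_num)
    have h4 : 0 ≤ (1 - y / 2) ^ 2 * fw (1/2) y := by positivity
    rw [abs_le]; constructor <;> linarith

lemma fw_h3 (y : ℝ) : |1 - y / 2| ^ 3 * fw (1 / 2) y ≤ 7000 := by
  have h0 := fw_pos (1/2) y
  have := fw_poly y
  have : |1 - y / 2| ^ 3 * fw (1 / 2) y ≤ (1 + |y|) ^ 3 * fw (1 / 2) y := by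
    have := half_fac y; gcongr
  linarith

lemma fw_meas (b : ℝ) : Continuous (fw b) := by unfold fw; fun_prop

end SN

namespace SN

noncomputable def sg {Ω : Type*} {m0 : MeasurableSpace Ω} (P : Measure Ω) (F : ℕ → MeasurableSpace Ω)
    (ξ : ℕ → Ω → ℝ) (k : ℕ) : Ω → ℝ := P[fun ω => ξ k ω ^ 2|F k]
noncomputable def ta {Ω : Type*} {m0 : MeasurableSpace Ω} (P : Measure Ω) (F : ℕ → MeasurableSpace Ω)
    (ξ : ℕ → Ω → ℝ) (k : ℕ) : Ω → ℝ := P[fun ω => |ξ k ω| ^ 3|F k]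

structure Setup {Ω : Type*} {m0 : MeasurableSpace Ω} (P : Measure Ω) (F : ℕ → MeasurableSpace Ω)
    (n : ℕ) (ξ : ℕ → Ω → ℝ) (γ ε δ : ℝ) : Prop where
  mono : Monotone F
  le : ∀ k, F k ≤ m0
  xm : ∀ k, StronglyMeasurable[F (k + 1)] (ξ k)
  i3 : ∀ k, Integrable (fun ω => |ξ k ω| ^ 3) P
  c1 : ∀ k, ∀ᵐ ω ∂P, (P[ξ k|F k]) ω = 0
  t1 : ∀ k, ∀ᵐ ω ∂P, ta P F ξ k ω ≤ γ * sg P F ξ k ω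
  tn : ∀ᵐ ω ∂P, ∑ i ∈ Finset.range n, ta P F ξ i ω ≤ ε
  sn : ∀ᵐ ω ∂P, |∑ i ∈ Finset.range n, sg P F ξ i ω - 1| ≤ δ ^ 2
  g0 : 0 < γ
  g1 : γ ≤ 1 / 4
  e0 : 0 < ε
  e1 : ε ≤ 1 / 4
  d0 : 0 ≤ δ
  d1 : δ ≤ 1 / 4

variable {Ω : Type*} {m0 : MeasurableSpace Ω} {P : Measure Ω} [IsProbabilityMeasure P]
  {F : ℕ → MeasurableSpace Ω} {n : ℕ} {ξ : ℕ → Ω → ℝ} {γ ε δ : ℝ}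

namespace Setup

lemma xm0 (h : Setup P F n ξ γ ε δ) (k : ℕ) : Measurable (ξ k) := ((h.xm k).mono (h.le _)).measurable

lemma i1 (h : Setup P F n ξ γ ε δ) (k : ℕ) : Integrable (ξ k) P := by
  apply Integrable.mono' ((integrable_const 1).add (h.i3 k)) (h.xm0 k).aestronglyMeasurable
  refine Filter.Eventually.of_forall fun ω => ?_
  simp only [Pi.add_apply, Real.norm_eq_abs]
  have ha := abs_nonneg (ξ k ω)
  rcases le_total |ξ k ω| 1 with h1 | h1
  · have := pow_nonneg ha 3; linarith
  · have : |ξ k ω| ≤ |ξ k ω| ^ 3 := le_self_pow₀ h1 (by norm_num)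
    linarith

lemma i2 (h : Setup P F n ξ γ ε δ) (k : ℕ) : Integrable (fun ω => ξ k ω ^ 2) P := by
  apply Integrable.mono' ((integrable_const 1).add (h.i3 k)) ((h.xm0 k).pow_const 2).aestronglyMeasurable
  refine Filter.Eventually.of_forall fun ω => ?_
  simp only [Pi.add_apply, Real.norm_eq_abs]
  have ha := abs_nonneg (ξ k ω)
  rw [abs_pow]
  rcases le_total |ξ k ω| 1 with h1 | h1
  · have := pow_nonneg ha 3; nlinarith
  · have : |ξ k ω| ^ 2 ≤ |ξ k ω| ^ 3 := pow_le_pow_right₀ h1 (by norm_num)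
    linarith

lemma sgm (h : Setup P F n ξ γ ε δ) (k : ℕ) : StronglyMeasurable[F k] (sg P F ξ k) :=
  stronglyMeasurable_condExp
lemma tam (h : Setup P F n ξ γ ε δ) (k : ℕ) : StronglyMeasurable[F k] (ta P F ξ k) :=
  stronglyMeasurable_condExp

lemma sg0 (h : Setup P F n ξ γ ε δ) (k : ℕ) : ∀ᵐ ω ∂P, 0 ≤ sg P F ξ k ω :=
  condExp_nonneg (Filter.Eventually.of_forall fun ω => sq_nonneg _)
lemma ta0 (h : Setup P F n ξ γ ε δ) (k : ℕ) : ∀ᵐ ω ∂P, 0 ≤ ta P F ξ k ω :=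
  condExp_nonneg (Filter.Eventually.of_forall fun ω => by positivity)

lemma sg1 (h : Setup P F n ξ γ ε δ) (k : ℕ) : ∀ᵐ ω ∂P, sg P F ξ k ω ≤ γ ^ 2 := by
  have hg := h.g0
  have hc : ∀ c : ℝ, ∃ C, ∀ᵐ ω ∂P, |(fun _ : Ω => c) ω| ≤ C := fun c => ⟨|c|, by simp⟩
  have := cond_step (P := P) (h.le k) (H := fun ω => ξ k ω ^ 2) (p0 := fun _ => γ ^ 2 / 3) (p1 := fun _ => 2 / (3 * γ))
    (p2 := fun _ => 0) (p3 := fun _ => 0) (a0 := fun _ => 1) (a1 := fun ω => |ξ k ω| ^ 3) (a2 := fun _ => 0)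
    (a3 := fun _ => 0) (h.i2 k) stronglyMeasurable_const (hc _) (integrable_const _)
    stronglyMeasurable_const (hc _) (h.i3 k) stronglyMeasurable_const (hc _) (integrable_const _)
    stronglyMeasurable_const (hc _) (integrable_const _) (Filter.Eventually.of_forall fun ω => by
      have ha := abs_nonneg (ξ k ω)
      rw [← sq_abs (ξ k ω)]
      generalize |ξ k ω| = a at ha
      have : 0 ≤ (γ - a) ^ 2 * (γ + 2 * a) / (3 * γ) := by positivity
      have e : (γ - a) ^ 2 * (γ + 2 * a) / (3 * γ) = γ ^ 2 / 3 + 2 / (3 * γ) * a ^ 3 - a ^ 2 := by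
        field_simp; ring
      simp only [mul_one, mul_zero, add_zero]
      linarith)
  filter_upwards [this, h.t1 k, h.sg0 k] with ω h1 h2 h3
  rw [condExp_const (h.le k)] at h1
  simp only [mul_one, zero_mul, add_zero] at h1
  change sg P F ξ k ω ≤ γ ^ 2 / 3 + 2 / (3 * γ) * ta P F ξ k ω at h1
  have : 2 / (3 * γ) * ta P F ξ k ω ≤ 2 / (3 * γ) * (γ * sg P F ξ k ω) := by gcongr
  have e : 2 / (3 * γ) * (γ * sg P F ξ k ω) = 2 / 3 * sg P F ξ k ω := by field_simp
  linarith

lemma sgb (h : Setup P F n ξ γ ε δ) (k : ℕ) : ∃ C, ∀ᵐ ω ∂P, |sg P F ξ k ω| ≤ C := by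
  refine ⟨γ ^ 2, ?_⟩
  filter_upwards [h.sg0 k, h.sg1 k] with ω h1 h2
  rwa [abs_of_nonneg h1]

lemma ta1 (h : Setup P F n ξ γ ε δ) (k : ℕ) : ∀ᵐ ω ∂P, ta P F ξ k ω ≤ γ ^ 3 := by
  filter_upwards [h.t1 k, h.sg1 k] with ω h1 h2
  have := h.g0; nlinarith

lemma tab (h : Setup P F n ξ γ ε δ) (k : ℕ) : ∃ C, ∀ᵐ ω ∂P, |ta P F ξ k ω| ≤ C := by
  refine ⟨γ ^ 3, ?_⟩
  filter_upwards [h.ta0 k, h.ta1 k] with ω h1 h2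
  rwa [abs_of_nonneg h1]

lemma sqb (h : Setup P F n ξ γ ε δ) (k : ℕ) : ∀ᵐ ω ∂P, |Real.sqrt (sg P F ξ k ω)| ≤ γ := by
  filter_upwards [h.sg0 k, h.sg1 k] with ω h1 h2
  rw [abs_of_nonneg (Real.sqrt_nonneg _)]
  exact Real.sqrt_le_iff.2 ⟨h.g0.le, h2⟩

lemma sqm (h : Setup P F n ξ γ ε δ) (k : ℕ) : StronglyMeasurable[F k] (fun ω => Real.sqrt (sg P F ξ k ω)) :=
  Real.continuous_sqrt.comp_stronglyMeasurable (h.sgm k)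

lemma sg3 (h : Setup P F n ξ γ ε δ) (k : ℕ) : ∀ᵐ ω ∂P, Real.sqrt (sg P F ξ k ω) ^ 3 ≤ ta P F ξ k ω := by
  have hc : ∀ c : ℝ, ∃ C, ∀ᵐ ω ∂P, |(fun _ : Ω => c) ω| ≤ C := fun c => ⟨|c|, by simp⟩
  set s : Ω → ℝ := fun ω => Real.sqrt (sg P F ξ k ω) with hs
  have hb3 : ∃ C, ∀ᵐ ω ∂P, |s ω ^ 3 / 3| ≤ C := by
    refine ⟨γ ^ 3 / 3, ?_⟩
    filter_upwards [h.sqb k] with ω h1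
    rw [abs_div, abs_pow]; 
    rw [abs_of_pos (by norm_num : (0:ℝ) < 3)]
    gcongr
  have i : Integrable (fun ω => s ω * ξ k ω ^ 2) P := int_pull (h.le k) (h.sqm k) ⟨γ, h.sqb k⟩ (h.i2 k)
  have := cond_step (P := P) (h.le k) (H := fun ω => s ω * ξ k ω ^ 2) (p0 := fun ω => s ω ^ 3 / 3) (p1 := fun _ => 2 / 3)
    (p2 := fun _ => 0) (p3 := fun _ => 0) (a0 := fun _ => 1) (a1 := fun ω => |ξ k ω| ^ 3) (a2 := fun _ => 0)
    (a3 := fun _ => 0) i (((h.sqm k).pow 3).div stronglyMeasurable_const) hb3 (integrable_const _)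
    stronglyMeasurable_const (hc _) (h.i3 k) stronglyMeasurable_const (hc _) (integrable_const _)
    stronglyMeasurable_const (hc _) (integrable_const _) (Filter.Eventually.of_forall fun ω => by
      have ha := abs_nonneg (ξ k ω)
      have hs0 : 0 ≤ s ω := Real.sqrt_nonneg _
      rw [← sq_abs (ξ k ω)]
      generalize |ξ k ω| = a at ha
      generalize s ω = t at hs0
      have : 0 ≤ (t - a) ^ 2 * (t + 2 * a) / 3 := by positivity
      simp only [mul_one, mul_zero, add_zero]
      nlinarith)
  filter_upwards [this, cond_pull (h.le k) (h.sqm k) ⟨γ, h.sqb k⟩ (h.i2 k), h.sg0 k] with ω h1 h2 h3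
  rw [h2, condExp_const (h.le k)] at h1
  simp only [mul_one, zero_mul, add_zero] at h1
  change s ω * sg P F ξ k ω ≤ s ω ^ 3 / 3 + 2 / 3 * ta P F ξ k ω at h1
  have e : s ω ^ 2 = sg P F ξ k ω := Real.sq_sqrt h3
  rw [← e] at h1
  nlinarith

lemma capp_up (h : Setup P F n ξ γ ε δ) (k : ℕ) {A : Ω → ℝ} (hA : Integrable A P) {α β κ C : ℝ}
    (hle : ∀ ω, A ω ≤ α + β * ξ k ω + κ * ξ k ω ^ 2 + C * |ξ k ω| ^ 3) :
    ∀ᵐ ω ∂P, (P[A|F k]) ω ≤ α + κ * sg P F ξ k ω + C * ta P F ξ k ω := by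
  have hc : ∀ c : ℝ, ∃ C, ∀ᵐ ω ∂P, |(fun _ : Ω => c) ω| ≤ C := fun c => ⟨|c|, by simp⟩
  have := cond_step (P := P) (h.le k) (H := A) (p0 := fun ω => α) (p1 := fun _ => β)
    (p2 := fun _ => κ) (p3 := fun _ => C) (a0 := fun _ => 1) (a1 := ξ k) (a2 := fun ω => ξ k ω ^ 2)
    (a3 := fun ω => |ξ k ω| ^ 3) hA stronglyMeasurable_const (hc _) (integrable_const _)
    stronglyMeasurable_const (hc _) (h.i1 k) stronglyMeasurable_const (hc _) (h.i2 k)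
    stronglyMeasurable_const (hc _) (h.i3 k) (Filter.Eventually.of_forall fun ω => by simpa using hle ω)
  filter_upwards [this, h.c1 k] with ω h1 h2
  rw [condExp_const (h.le k), h2] at h1
  simpa [sg, ta] using h1

lemma capp_int (h : Setup P F n ξ γ ε δ) (k : ℕ) {A : Ω → ℝ} (hA : AEStronglyMeasurable A P) {α β κ C : ℝ}
    (hle : ∀ ω, |A ω - (α + β * ξ k ω + κ * ξ k ω ^ 2)| ≤ C * |ξ k ω| ^ 3) : Integrable A P := by
  have i0 : Integrable (fun ω => α + β * ξ k ω + κ * ξ k ω ^ 2) P :=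
    ((integrable_const α).add ((h.i1 k).const_mul β)).add ((h.i2 k).const_mul κ)
  have : Integrable (fun ω => A ω - (α + β * ξ k ω + κ * ξ k ω ^ 2)) P :=
    Integrable.mono' ((h.i3 k).const_mul C) (hA.sub i0.1) (Filter.Eventually.of_forall hle)
  exact (this.add i0).congr (Filter.Eventually.of_forall fun ω => by simp)

lemma capp (h : Setup P F n ξ γ ε δ) (k : ℕ) {A : Ω → ℝ} (hA : AEStronglyMeasurable A P) {α β κ C : ℝ}
    (hle : ∀ ω, |A ω - (α + β * ξ k ω + κ * ξ k ω ^ 2)| ≤ C * |ξ k ω| ^ 3) :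
    ∀ᵐ ω ∂P, |(P[A|F k]) ω - (α + κ * sg P F ξ k ω)| ≤ C * ta P F ξ k ω := by
  have hi := h.capp_int k hA hle
  have h1 := h.capp_up k hi (α := α) (β := β) (κ := κ) (C := C) (fun ω => by linarith [(abs_le.1 (hle ω)).2])
  have h2 := h.capp_up k hi.neg (α := -α) (β := -β) (κ := -κ) (C := C) (fun ω => by
    have := (abs_le.1 (hle ω)).1
    simp only [Pi.neg_apply]; linarith)
  filter_upwards [h1, h2, condExp_neg (μ := P) A (F k)] with ω h1 h2 h3
  rw [h3] at h2
  simp only [Pi.neg_apply] at h2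
  rw [abs_le]; constructor <;> linarith

lemma neg (h : Setup P F n ξ γ ε δ) : Setup P F n (fun k ω => - ξ k ω) γ ε δ := by
  have e1 : sg P F (fun k ω => - ξ k ω) = sg P F ξ := by funext k; simp [sg]
  have e2 : ta P F (fun k ω => - ξ k ω) = ta P F ξ := by funext k; simp [ta]
  refine ⟨h.mono, h.le, fun k => (h.xm k).neg, fun k => by simpa using h.i3 k, fun k => ?_,
    by rw [e1, e2]; exact h.t1, by rw [e2]; exact h.tn, by rw [e1]; exact h.sn, h.g0, h.g1, h.e0, h.e1, h.d0, h.d1⟩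
  have e := condExp_neg (μ := P) (ξ k) (F k)
  have e3 : (fun ω => - ξ k ω) = - ξ k := rfl
  filter_upwards [e, h.c1 k] with ω h1 h2
  rw [e3, h1]; simp [h2]

end Setup
end SN

namespace SN

noncomputable def cc {Ω : Type*} {m0 : MeasurableSpace Ω} (P : Measure Ω) (F : ℕ → MeasurableSpace Ω)
    (ξ : ℕ → Ω → ℝ) (b l : ℝ) (k : ℕ) : Ω → ℝ := P[fun ω => fw b (l * ξ k ω)|F k]
noncomputable def gg {Ω : Type*} {m0 : MeasurableSpace Ω} (P : Measure Ω) (F : ℕ → MeasurableSpace Ω)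
    (ξ : ℕ → Ω → ℝ) (b l : ℝ) (k : ℕ) : Ω → ℝ := fun ω => (cc P F ξ b l k ω)⁻¹ * fw b (l * ξ k ω)

variable {Ω : Type*} {m0 : MeasurableSpace Ω} {P : Measure Ω} [IsProbabilityMeasure P]
  {F : ℕ → MeasurableSpace Ω} {n : ℕ} {ξ : ℕ → Ω → ℝ} {γ ε δ b l : ℝ}

namespace Setup

/-- small quantities -/
lemma small (h : Setup P F n ξ γ ε δ) (hl : 0 ≤ l) (hlg : l * γ ≤ 1 / 1000) (k : ℕ) :
    ∀ᵐ ω ∂P, 0 ≤ sg P F ξ k ω ∧ 0 ≤ ta P F ξ k ω ∧ sg P F ξ k ω ≤ γ ^ 2 ∧ ta P F ξ k ω ≤ γ * sg P F ξ k ω ∧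
      l ^ 2 * sg P F ξ k ω ≤ (l * γ) ^ 2 ∧ l ^ 3 * ta P F ξ k ω ≤ (l * γ) ^ 3 := by
  filter_upwards [h.sg0 k, h.ta0 k, h.sg1 k, h.t1 k, h.ta1 k] with ω a1 a2 a3 a4 a5
  refine ⟨a1, a2, a3, a4, ?_, ?_⟩
  · rw [mul_pow]; gcongr
  · rw [mul_pow]; gcongr

lemma fwi (h : Setup P F n ξ γ ε δ) (hb : 1 / 4 ≤ b) (k : ℕ) : Integrable (fun ω => fw b (l * ξ k ω)) P := by
  apply int_of_bdd ((fw_meas b).measurable.comp ((h.xm0 k).const_mul l)).aestronglyMeasurable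
  refine ⟨3, Filter.Eventually.of_forall fun ω => ?_⟩
  simp only [Function.comp]
  rw [abs_of_pos (fw_pos _ _)]; exact fw_le hb _

lemma cc_app (h : Setup P F n ξ γ ε δ) (hb : 1 / 4 ≤ b) (hb1 : b ≤ 1) (hl : 0 ≤ l) (k : ℕ) :
    ∀ᵐ ω ∂P, |cc P F ξ b l k ω - (1 + (1 / 2 - b) * l ^ 2 * sg P F ξ k ω)| ≤ 80 * l ^ 3 * ta P F ξ k ω := by
  apply h.capp k (h.fwi hb k).1 (β := l)
  intro ω
  have := fw_exp hb hb1 (l * ξ k ω)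
  rw [abs_mul, abs_of_nonneg hl] at this
  have e : fw b (l * ξ k ω) - (1 + l * ξ k ω + (1 / 2 - b) * l ^ 2 * ξ k ω ^ 2) = fw b (l * ξ k ω) - (1 + l * ξ k ω + (1 / 2 - b) * (l * ξ k ω) ^ 2) := by ring
  rw [e]
  refine this.trans (le_of_eq (by ring))

lemma cc_bd (h : Setup P F n ξ γ ε δ) (hb : 1 / 4 ≤ b) (hb1 : b ≤ 1) (hl : 0 ≤ l) (hlg : l * γ ≤ 1 / 1000) (k : ℕ) :
    ∀ᵐ ω ∂P, 1 / 2 ≤ cc P F ξ b l k ω := by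
  have hg := h.g0
  filter_upwards [h.cc_app hb hb1 hl k, h.small hl hlg k] with ω a1 ⟨s0, t0, s1, t1, a2, a3⟩
  have h1 := (abs_le.1 a1).1
  have hu : 0 ≤ l * γ := by positivity
  have h2 : (l * γ) ^ 2 ≤ 1 / 1000 := by nlinarith
  have h3 : (l * γ) ^ 3 ≤ 1 / 1000 := by nlinarith [sq_nonneg (l * γ)]
  have h4 : 0 ≤ l ^ 2 * sg P F ξ k ω := by positivity
  nlinarith

lemma cc_exp (h : Setup P F n ξ γ ε δ) (hb : 1 / 4 ≤ b) (hb1 : b ≤ 1) (hl : 0 ≤ l) (k : ℕ) :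
    ∀ᵐ ω ∂P, cc P F ξ b l k ω ≤ Real.exp ((1 / 2 - b) * l ^ 2 * sg P F ξ k ω + 80 * l ^ 3 * ta P F ξ k ω) := by
  filter_upwards [h.cc_app hb hb1 hl k] with ω a1
  have h1 := (abs_le.1 a1).2
  have := Real.add_one_le_exp ((1 / 2 - b) * l ^ 2 * sg P F ξ k ω + 80 * l ^ 3 * ta P F ξ k ω)
  linarith

lemma ccm (h : Setup P F n ξ γ ε δ) (k : ℕ) : StronglyMeasurable[F k] (fun ω => (cc P F ξ b l k ω)⁻¹) :=
  (stronglyMeasurable_condExp.measurable.inv).stronglyMeasurable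

lemma ccb (h : Setup P F n ξ γ ε δ) (hb : 1 / 4 ≤ b) (hb1 : b ≤ 1) (hl : 0 ≤ l) (hlg : l * γ ≤ 1 / 1000) (k : ℕ) :
    ∀ᵐ ω ∂P, |(cc P F ξ b l k ω)⁻¹| ≤ 2 := by
  filter_upwards [h.cc_bd hb hb1 hl hlg k] with ω h1
  rw [abs_of_nonneg (by positivity)]
  exact inv_le_of_inv_le₀ (by norm_num) (by linarith)

lemma ggm (h : Setup P F n ξ γ ε δ) (k : ℕ) : StronglyMeasurable[F (k + 1)] (gg P F ξ b l k) :=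
  ((h.ccm k).mono (h.mono (Nat.le_succ k))).mul ((fw_meas b).comp_stronglyMeasurable ((h.xm k).const_mul l))

lemma gg0 (h : Setup P F n ξ γ ε δ) (hb : 1 / 4 ≤ b) (hb1 : b ≤ 1) (hl : 0 ≤ l) (hlg : l * γ ≤ 1 / 1000) (k : ℕ) :
    ∀ᵐ ω ∂P, 0 ≤ gg P F ξ b l k ω := by
  filter_upwards [h.cc_bd hb hb1 hl hlg k] with ω h1
  have := fw_pos b (l * ξ k ω)
  unfold gg; positivity

lemma ggb (h : Setup P F n ξ γ ε δ) (hb : 1 / 4 ≤ b) (hb1 : b ≤ 1) (hl : 0 ≤ l) (hlg : l * γ ≤ 1 / 1000) (k : ℕ) :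
    ∃ C, ∀ᵐ ω ∂P, |gg P F ξ b l k ω| ≤ C := by
  apply bdd_mul' ⟨2, h.ccb hb hb1 hl hlg k⟩
  refine ⟨3, Filter.Eventually.of_forall fun ω => ?_⟩
  rw [abs_of_pos (fw_pos _ _)]; exact fw_le hb _

/-- conditional expectation with respect to tilted weights -/
lemma ggc (h : Setup P F n ξ γ ε δ) (hb : 1 / 4 ≤ b) (hb1 : b ≤ 1) (hl : 0 ≤ l) (hlg : l * γ ≤ 1 / 1000) (k : ℕ)
    {A : Ω → ℝ} (hA : Integrable (fun ω => fw b (l * ξ k ω) * A ω) P) :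
    Integrable (fun ω => gg P F ξ b l k ω * A ω) P ∧
    ∀ᵐ ω ∂P, (P[fun ω => gg P F ξ b l k ω * A ω|F k]) ω = (cc P F ξ b l k ω)⁻¹ * (P[fun ω => fw b (l * ξ k ω) * A ω|F k]) ω := by
  have e : (fun ω => gg P F ξ b l k ω * A ω) = fun ω => (cc P F ξ b l k ω)⁻¹ * (fw b (l * ξ k ω) * A ω) := by
    funext ω; unfold gg; ring
  rw [e]
  exact ⟨int_pull (h.le k) (h.ccm k) ⟨2, h.ccb hb hb1 hl hlg k⟩ hA,
    cond_pull (h.le k) (h.ccm k) ⟨2, h.ccb hb hb1 hl hlg k⟩ hA⟩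

lemma ggc1 (h : Setup P F n ξ γ ε δ) (hb : 1 / 4 ≤ b) (hb1 : b ≤ 1) (hl : 0 ≤ l) (hlg : l * γ ≤ 1 / 1000) (k : ℕ) :
    ∀ᵐ ω ∂P, (P[gg P F ξ b l k|F k]) ω = 1 := by
  have := (h.ggc hb hb1 hl hlg k (A := fun _ => 1) (by simpa using h.fwi hb k)).2
  simp only [mul_one] at this
  filter_upwards [this, h.cc_bd hb hb1 hl hlg k] with ω h1 h2
  have e : (fun ω => gg P F ξ b l k ω) = gg P F ξ b l k := rfl
  rw [e] at h1
  rw [h1]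
  change (cc P F ξ b l k ω)⁻¹ * cc P F ξ b l k ω = 1
  exact inv_mul_cancel₀ (by linarith)

/-- product comparison -/
lemma prod_le (h : Setup P F n ξ γ ε δ) (hb : 1 / 4 ≤ b) (hb1 : b ≤ 1) (hl : 0 ≤ l) (hlg : l * γ ≤ 1 / 1000) :
    ∀ᵐ ω ∂P, Real.exp (l * ∑ i ∈ Finset.range n, ξ i ω - b * l ^ 2 * ∑ i ∈ Finset.range n, ξ i ω ^ 2) ≤
      (∏ i ∈ Finset.range n, gg P F ξ b l i ω) *
        Real.exp ((1 / 2 - b) * l ^ 2 * (∑ i ∈ Finset.range n, sg P F ξ i ω) + 80 * l ^ 3 * ε) := by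
  filter_upwards [ae_all_iff.2 (h.cc_bd hb hb1 hl hlg), ae_all_iff.2 (h.cc_exp hb hb1 hl),
    ae_all_iff.2 (h.gg0 hb hb1 hl hlg), h.tn] with ω h1 h2 h3 h4
  have e : Real.exp (l * ∑ i ∈ Finset.range n, ξ i ω - b * l ^ 2 * ∑ i ∈ Finset.range n, ξ i ω ^ 2)
      = (∏ i ∈ Finset.range n, gg P F ξ b l i ω) * ∏ i ∈ Finset.range n, cc P F ξ b l i ω := by
    rw [← Finset.prod_mul_distrib, Finset.mul_sum, Finset.mul_sum, ← Finset.sum_sub_distrib, Real.exp_sum]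
    refine Finset.prod_congr rfl fun i _ => ?_
    have := h1 i
    have hne : cc P F ξ b l i ω ≠ 0 := by linarith
    unfold gg
    field_simp
    unfold fw
    congr 1; ring
  rw [e]
  apply mul_le_mul_of_nonneg_left _ (Finset.prod_nonneg fun i _ => h3 i)
  calc ∏ i ∈ Finset.range n, cc P F ξ b l i ω ≤ ∏ i ∈ Finset.range n, Real.exp ((1 / 2 - b) * l ^ 2 * sg P F ξ i ω + 80 * l ^ 3 * ta P F ξ i ω) :=
        Finset.prod_le_prod (fun i _ => by linarith [h1 i]) (fun i _ => h2 i)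
    _ = Real.exp ((1 / 2 - b) * l ^ 2 * (∑ i ∈ Finset.range n, sg P F ξ i ω) + 80 * l ^ 3 * ∑ i ∈ Finset.range n, ta P F ξ i ω) := by
        rw [← Real.exp_sum, Finset.sum_add_distrib, Finset.mul_sum, Finset.mul_sum]
    _ ≤ _ := by
        apply Real.exp_le_exp.2
        have : 80 * l ^ 3 * ∑ i ∈ Finset.range n, ta P F ξ i ω ≤ 80 * l ^ 3 * ε := by gcongr
        linarith

lemma gg_mass (h : Setup P F n ξ γ ε δ) (hb : 1 / 4 ≤ b) (hb1 : b ≤ 1) (hl : 0 ≤ l) (hlg : l * γ ≤ 1 / 1000) :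
    Integrable (fun ω => ∏ i ∈ Finset.range n, gg P F ξ b l i ω) P ∧ ∫ ω, ∏ i ∈ Finset.range n, gg P F ξ b l i ω ∂P = 1 :=
  ⟨int_of_bdd ((prod_sm h.mono h.ggm n).mono (h.le n)).aestronglyMeasurable (prod_bdd (h.ggb hb hb1 hl hlg) n),
    mass_one h.mono h.le h.ggm (h.gg0 hb hb1 hl hlg) (h.ggb hb hb1 hl hlg) (h.ggc1 hb hb1 hl hlg)⟩

end Setup
end SN

namespace SN

noncomputable def et {Ω : Type*} (ξ : ℕ → Ω → ℝ) (l : ℝ) (k : ℕ) : Ω → ℝ := fun ω => ξ k ω * (1 - l * ξ k ω / 2)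
noncomputable def mm {Ω : Type*} {m0 : MeasurableSpace Ω} (P : Measure Ω) (F : ℕ → MeasurableSpace Ω)
    (ξ : ℕ → Ω → ℝ) (l : ℝ) (k : ℕ) : Ω → ℝ :=
  fun ω => (cc P F ξ (1/2) l k ω)⁻¹ * (P[fun ω => fw (1/2) (l * ξ k ω) * et ξ l k ω|F k]) ω

variable {Ω : Type*} {m0 : MeasurableSpace Ω} {P : Measure Ω} [IsProbabilityMeasure P]
  {F : ℕ → MeasurableSpace Ω} {n : ℕ} {ξ : ℕ → Ω → ℝ} {γ ε δ l : ℝ}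

namespace Setup

lemma etm (h : Setup P F n ξ γ ε δ) (l : ℝ) (k : ℕ) : StronglyMeasurable[F (k+1)] (et ξ l k) := by
  have h1 := ((h.xm k).const_mul l).div (stronglyMeasurable_const (b := (2:ℝ)))
  exact (h.xm k).mul ((stronglyMeasurable_const (b := (1:ℝ))).sub h1)

lemma fwm (h : Setup P F n ξ γ ε δ) (l : ℝ) (k : ℕ) : StronglyMeasurable[F (k+1)] (fun ω => fw (1/2) (l * ξ k ω)) :=
  (fw_meas _).comp_stronglyMeasurable ((h.xm k).const_mul l)

lemma em1 (h : Setup P F n ξ γ ε δ) (hl : 0 ≤ l) (k : ℕ) :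
    Integrable (fun ω => fw (1/2) (l * ξ k ω) * et ξ l k ω) P ∧
    ∀ᵐ ω ∂P, |(P[fun ω => fw (1/2) (l * ξ k ω) * et ξ l k ω|F k]) ω - l / 2 * sg P F ξ k ω| ≤ 200 * l ^ 2 * ta P F ξ k ω := by
  have hm : AEStronglyMeasurable (fun ω => fw (1/2) (l * ξ k ω) * et ξ l k ω) P :=
    (((h.fwm l k).mul (h.etm l k)).mono (h.le _)).aestronglyMeasurable
  have hle : ∀ ω, |fw (1/2) (l * ξ k ω) * et ξ l k ω - (0 + 1 * ξ k ω + l / 2 * ξ k ω ^ 2)| ≤ 200 * l ^ 2 * |ξ k ω| ^ 3 := by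
    intro ω
    have h1 := fw_h1 (l * ξ k ω)
    have e : fw (1/2) (l * ξ k ω) * et ξ l k ω - (0 + 1 * ξ k ω + l / 2 * ξ k ω ^ 2)
        = ξ k ω * ((1 - l * ξ k ω / 2) * fw (1 / 2) (l * ξ k ω) - (1 + l * ξ k ω / 2)) := by unfold et; ring
    rw [e, abs_mul]
    calc |ξ k ω| * |(1 - l * ξ k ω / 2) * fw (1 / 2) (l * ξ k ω) - (1 + l * ξ k ω / 2)| ≤ |ξ k ω| * (200 * (l * ξ k ω) ^ 2) := by gcongr
      _ = 200 * l ^ 2 * |ξ k ω| ^ 3 := by rw [← sq_abs (l * ξ k ω), abs_mul, abs_of_nonneg hl]; ring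
  refine ⟨h.capp_int k hm hle, ?_⟩
  filter_upwards [h.capp k hm hle] with ω h1
  simpa using h1

lemma em2 (h : Setup P F n ξ γ ε δ) (hl : 0 ≤ l) (k : ℕ) :
    Integrable (fun ω => fw (1/2) (l * ξ k ω) * et ξ l k ω ^ 2) P ∧
    ∀ᵐ ω ∂P, |(P[fun ω => fw (1/2) (l * ξ k ω) * et ξ l k ω ^ 2|F k]) ω - sg P F ξ k ω| ≤ 7000 * l * ta P F ξ k ω := by
  have hm : AEStronglyMeasurable (fun ω => fw (1/2) (l * ξ k ω) * et ξ l k ω ^ 2) P :=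
    (((h.fwm l k).mul ((h.etm l k).pow 2)).mono (h.le _)).aestronglyMeasurable
  have hle : ∀ ω, |fw (1/2) (l * ξ k ω) * et ξ l k ω ^ 2 - (0 + 0 * ξ k ω + 1 * ξ k ω ^ 2)| ≤ 7000 * l * |ξ k ω| ^ 3 := by
    intro ω
    have h1 := fw_h2 (l * ξ k ω)
    have e : fw (1/2) (l * ξ k ω) * et ξ l k ω ^ 2 - (0 + 0 * ξ k ω + 1 * ξ k ω ^ 2)
        = ξ k ω ^ 2 * ((1 - l * ξ k ω / 2) ^ 2 * fw (1 / 2) (l * ξ k ω) - 1) := by unfold et; ring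
    rw [e, abs_mul, abs_of_nonneg (sq_nonneg (ξ k ω))]
    calc ξ k ω ^ 2 * |(1 - l * ξ k ω / 2) ^ 2 * fw (1 / 2) (l * ξ k ω) - 1| ≤ ξ k ω ^ 2 * (7000 * |l * ξ k ω|) := by gcongr
      _ = 7000 * l * |ξ k ω| ^ 3 := by rw [← sq_abs (ξ k ω), abs_mul, abs_of_nonneg hl]; ring
  refine ⟨h.capp_int k hm hle, ?_⟩
  filter_upwards [h.capp k hm hle] with ω h1
  simpa using h1

lemma em3 (h : Setup P F n ξ γ ε δ) (hl : 0 ≤ l) (k : ℕ) :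
    Integrable (fun ω => fw (1/2) (l * ξ k ω) * |et ξ l k ω| ^ 3) P ∧
    ∀ᵐ ω ∂P, |(P[fun ω => fw (1/2) (l * ξ k ω) * |et ξ l k ω| ^ 3|F k]) ω| ≤ 7000 * ta P F ξ k ω := by
  have hm : AEStronglyMeasurable (fun ω => fw (1/2) (l * ξ k ω) * |et ξ l k ω| ^ 3) P :=
    (((h.fwm l k).mul ((h.etm l k).norm.pow 3)).mono (h.le _)).aestronglyMeasurable
  have hle : ∀ ω, |fw (1/2) (l * ξ k ω) * |et ξ l k ω| ^ 3 - (0 + 0 * ξ k ω + 0 * ξ k ω ^ 2)| ≤ 7000 * |ξ k ω| ^ 3 := by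
    intro ω
    have h1 := fw_h3 (l * ξ k ω)
    have h0 := fw_pos (1/2) (l * ξ k ω)
    have e : fw (1/2) (l * ξ k ω) * |et ξ l k ω| ^ 3 - (0 + 0 * ξ k ω + 0 * ξ k ω ^ 2)
        = |ξ k ω| ^ 3 * (|1 - l * ξ k ω / 2| ^ 3 * fw (1 / 2) (l * ξ k ω)) := by unfold et; rw [abs_mul]; ring
    rw [e, abs_of_nonneg (by positivity), mul_comm (7000:ℝ)]
    gcongr
  refine ⟨h.capp_int k hm hle, ?_⟩
  filter_upwards [h.capp k hm hle] with ω h1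
  simpa using h1

lemma cinv (h : Setup P F n ξ γ ε δ) (hl : 0 ≤ l) (hlg : l * γ ≤ 1 / 1000) (k : ℕ) :
    ∀ᵐ ω ∂P, |cc P F ξ (1/2) l k ω - 1| ≤ 80 * l ^ 3 * ta P F ξ k ω := by
  filter_upwards [h.cc_app (b := 1/2) (by norm_num) (by norm_num) hl k] with ω h1
  simpa using h1

lemma mmm (h : Setup P F n ξ γ ε δ) (k : ℕ) : StronglyMeasurable[F k] (mm P F ξ l k) :=
  (h.ccm k).mul stronglyMeasurable_condExp

/-- estimate on the drift -/
lemma mm_app (h : Setup P F n ξ γ ε δ) (hl : 0 ≤ l) (hlg : l * γ ≤ 1 / 1000) (k : ℕ) :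
    ∀ᵐ ω ∂P, |mm P F ξ l k ω - l / 2 * sg P F ξ k ω| ≤ 600 * l ^ 2 * ta P F ξ k ω := by
  filter_upwards [h.cinv hl hlg k, (h.em1 hl k).2, h.small hl hlg k,
    h.cc_bd (b := 1/2) (by norm_num) (by norm_num) hl hlg k] with ω h1 h2 ⟨s0, t0, s1, t1, a2, a3⟩ h4
  unfold mm
  set c := cc P F ξ (1/2) l k ω
  set e := (P[fun ω => fw (1/2) (l * ξ k ω) * et ξ l k ω|F k]) ω
  have hc : 0 < c := by linarith
  have ee : c⁻¹ * e - l / 2 * sg P F ξ k ω = c⁻¹ * ((e - l / 2 * sg P F ξ k ω) - (c - 1) * (l / 2 * sg P F ξ k ω)) := by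
    field_simp; ring
  rw [ee, abs_mul, abs_of_pos (inv_pos.2 hc)]
  have hi : c⁻¹ ≤ 2 := inv_le_of_inv_le₀ (by norm_num) (by linarith)
  have hu : 0 ≤ l * γ := mul_nonneg hl h.g0.le
  have h5 : |(e - l / 2 * sg P F ξ k ω) - (c - 1) * (l / 2 * sg P F ξ k ω)| ≤ 300 * l ^ 2 * ta P F ξ k ω := by
    refine (abs_sub _ _).trans ?_
    rw [abs_mul, abs_of_nonneg (by positivity : 0 ≤ l / 2 * sg P F ξ k ω)]
    have h6 : |c - 1| * (l / 2 * sg P F ξ k ω) ≤ 80 * l ^ 3 * ta P F ξ k ω * (l / 2 * sg P F ξ k ω) := by gcongr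
    have e7 : 80 * l ^ 3 * ta P F ξ k ω * (l / 2 * sg P F ξ k ω) = 40 * (l ^ 2 * ta P F ξ k ω) * (l ^ 2 * sg P F ξ k ω) := by ring
    have h8 : l ^ 2 * sg P F ξ k ω ≤ 1 := by nlinarith
    have h9 : 0 ≤ l ^ 2 * ta P F ξ k ω := by positivity
    nlinarith
  calc c⁻¹ * |(e - l / 2 * sg P F ξ k ω) - (c - 1) * (l / 2 * sg P F ξ k ω)| ≤ 2 * (300 * l ^ 2 * ta P F ξ k ω) := by gcongr
    _ = _ := by ring

lemma mm_bd (h : Setup P F n ξ γ ε δ) (hl : 0 ≤ l) (hlg : l * γ ≤ 1 / 1000) (k : ℕ) :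
    ∀ᵐ ω ∂P, |mm P F ξ l k ω| ≤ 2 * l * sg P F ξ k ω := by
  filter_upwards [h.mm_app hl hlg k, h.small hl hlg k] with ω h1 ⟨s0, t0, s1, t1, a2, a3⟩
  have e : 600 * l ^ 2 * ta P F ξ k ω ≤ 600 * l ^ 2 * (γ * sg P F ξ k ω) := by gcongr
  have e2 : 600 * l ^ 2 * (γ * sg P F ξ k ω) = 600 * (l * γ) * (l * sg P F ξ k ω) := by ring
  have h9 : 0 ≤ l * sg P F ξ k ω := by positivity
  have := abs_le.1 h1
  rw [abs_le]; constructor <;> nlinarith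

lemma mmb (h : Setup P F n ξ γ ε δ) (hl : 0 ≤ l) (hlg : l * γ ≤ 1 / 1000) (k : ℕ) :
    ∀ᵐ ω ∂P, |mm P F ξ l k ω| ≤ 2 * l * γ ^ 2 := by
  filter_upwards [h.mm_bd hl hlg k, h.small hl hlg k] with ω h1 ⟨s0, t0, s1, t1, a2, a3⟩
  refine h1.trans ?_
  gcongr

set_option maxHeartbeats 2000000 in
lemma beh (h : Setup P F n ξ γ ε δ) (hl : 0 ≤ l) (hlg : l * γ ≤ 1 / 1000) :
    BEh P F n (gg P F ξ (1/2) l) (fun k ω => et ξ l k ω - mm P F ξ l k ω) (sg P F ξ) (60000 * γ) (15000 * (l * γ)) δ := by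
  have hb : (1:ℝ) / 4 ≤ 1 / 2 := by norm_num
  have hb1 : (1:ℝ) / 2 ≤ 1 := by norm_num
  have hγ := h.g0
  have hu : 0 ≤ l * γ := mul_nonneg hl h.g0.le
  have G1 := fun k => h.ggc hb hb1 hl hlg k (h.em1 hl k).1
  have G2 := fun k => h.ggc hb hb1 hl hlg k (h.em2 hl k).1
  have G3 := fun k => h.ggc hb hb1 hl hlg k (h.em3 hl k).1
  have Gi : ∀ k, Integrable (gg P F ξ (1/2) l k) P := fun k =>
    int_of_bdd ((h.ggm k).mono (h.le _)).aestronglyMeasurable (h.ggb hb hb1 hl hlg k)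
  have mb : ∀ k, ∃ C, ∀ᵐ ω ∂P, |mm P F ξ l k ω| ≤ C := fun k => ⟨_, h.mmb hl hlg k⟩
  have I1 := fun k => int_pull (h.le k) (h.mmm k) (mb k) (Gi k)
  have C1 := fun k => cond_pull (h.le k) (h.mmm k) (mb k) (Gi k)
  have zm : ∀ k, StronglyMeasurable[F (k+1)] (fun ω => et ξ l k ω - mm P F ξ l k ω) := fun k =>
    (h.etm l k).sub ((h.mmm k).mono (h.mono (Nat.le_succ k)))
  -- first moment
  have ez1 : ∀ k, (fun ω => gg P F ξ (1/2) l k ω * (et ξ l k ω - mm P F ξ l k ω)) =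
      (fun ω => gg P F ξ (1/2) l k ω * et ξ l k ω) - (fun ω => mm P F ξ l k ω * gg P F ξ (1/2) l k ω) := by
    intro k; funext ω; simp only [Pi.sub_apply]; ring
  -- second moment
  have mb2 : ∀ k, ∃ C, ∀ᵐ ω ∂P, |2 * mm P F ξ l k ω| ≤ C := fun k => bdd_mul' ⟨2, by simp⟩ (mb k)
  have msq : ∀ k, ∃ C, ∀ᵐ ω ∂P, |mm P F ξ l k ω ^ 2| ≤ C := fun k => by
    simpa [pow_two] using bdd_mul' (mb k) (mb k)
  have m2m : ∀ k, StronglyMeasurable[F k] (fun ω => 2 * mm P F ξ l k ω) := fun k => (h.mmm k).const_mul 2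
  have msm : ∀ k, StronglyMeasurable[F k] (fun ω => mm P F ξ l k ω ^ 2) := fun k => (h.mmm k).pow 2
  have J1 := fun k => int_pull (h.le k) (m2m k) (mb2 k) (G1 k).1
  have D1 := fun k => cond_pull (h.le k) (m2m k) (mb2 k) (G1 k).1
  have J2 := fun k => int_pull (h.le k) (msm k) (msq k) (Gi k)
  have D2 := fun k => cond_pull (h.le k) (msm k) (msq k) (Gi k)
  have ez2 : ∀ k, (fun ω => gg P F ξ (1/2) l k ω * (et ξ l k ω - mm P F ξ l k ω) ^ 2) =
      ((fun ω => gg P F ξ (1/2) l k ω * et ξ l k ω ^ 2) - (fun ω => 2 * mm P F ξ l k ω * (gg P F ξ (1/2) l k ω * et ξ l k ω)))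
       + (fun ω => mm P F ξ l k ω ^ 2 * gg P F ξ (1/2) l k ω) := by
    intro k; funext ω; simp only [Pi.sub_apply, Pi.add_apply]; ring
  -- third moment
  have mcb : ∀ k, ∃ C, ∀ᵐ ω ∂P, |4 * |mm P F ξ l k ω| ^ 3| ≤ C := fun k => by
    refine ⟨4 * (2 * l * γ ^ 2) ^ 3, ?_⟩
    filter_upwards [h.mmb hl hlg k] with ω h1
    rw [abs_of_nonneg (by positivity)]; gcongr
  have mcm : ∀ k, StronglyMeasurable[F k] (fun ω => 4 * |mm P F ξ l k ω| ^ 3) := fun k =>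
    ((h.mmm k).norm.pow 3).const_mul 4
  have L1 := fun k => int_pull (h.le k) (mcm k) (mcb k) (Gi k)
  have E1 := fun k => cond_pull (h.le k) (mcm k) (mcb k) (Gi k)
  have hz3 : ∀ k, ∀ᵐ ω ∂P, gg P F ξ (1/2) l k ω * |et ξ l k ω - mm P F ξ l k ω| ^ 3 ≤
      4 * (gg P F ξ (1/2) l k ω * |et ξ l k ω| ^ 3) + 4 * |mm P F ξ l k ω| ^ 3 * gg P F ξ (1/2) l k ω := by
    intro k
    filter_upwards [h.gg0 hb hb1 hl hlg k] with ω h0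
    have : |et ξ l k ω - mm P F ξ l k ω| ^ 3 ≤ 4 * |et ξ l k ω| ^ 3 + 4 * |mm P F ξ l k ω| ^ 3 := by
      have h1 := abs_sub (et ξ l k ω) (mm P F ξ l k ω)
      have ha := abs_nonneg (et ξ l k ω)
      have hb := abs_nonneg (mm P F ξ l k ω)
      refine (pow_le_pow_left₀ (abs_nonneg _) h1 3).trans ?_
      nlinarith [mul_nonneg (add_nonneg ha hb) (sq_nonneg (|et ξ l k ω| - |mm P F ξ l k ω|))]
    nlinarith
  have K1 := fun k => (G3 k).1.const_mul 4
  have i3 : ∀ k, Integrable (fun ω => gg P F ξ (1/2) l k ω * |et ξ l k ω - mm P F ξ l k ω| ^ 3) P := by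
    intro k
    apply Integrable.mono' ((K1 k).add (L1 k)) (((h.ggm k).mul ((zm k).norm.pow 3)).mono (h.le _)).aestronglyMeasurable
    filter_upwards [hz3 k, h.gg0 hb hb1 hl hlg k] with ω h1 h0
    simp only [Pi.add_apply]
    refine le_trans (le_of_eq ?_) h1
    exact abs_of_nonneg (mul_nonneg h0 (pow_nonneg (abs_nonneg _) 3))
  refine ⟨h.mono, h.le, h.ggm, zm, h.sgm, h.gg0 hb hb1 hl hlg, h.ggb hb hb1 hl hlg, fun k => ?_, fun k => ?_, i3,
    h.ggc1 hb hb1 hl hlg, fun k => ?_, fun k => ?_, fun k => ?_, h.sg0, fun k => ?_, h.sn⟩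
  · rw [ez1]; exact (G1 k).1.sub (I1 k)
  · rw [ez2]; exact ((G2 k).1.sub (J1 k)).add (J2 k)
  · rw [ez1]
    filter_upwards [condExp_sub (G1 k).1 (I1 k) (F k), (G1 k).2, C1 k, h.ggc1 hb hb1 hl hlg k] with ω h1 h2 h3 h4
    rw [h1, Pi.sub_apply, h2, h3, h4]
    unfold mm; ring
  · rw [ez2]
    filter_upwards [condExp_add ((G2 k).1.sub (J1 k)) (J2 k) (F k), condExp_sub (G2 k).1 (J1 k) (F k),
      (G1 k).2, (G2 k).2, D1 k, D2 k, h.ggc1 hb hb1 hl hlg k, (h.em2 hl k).2, h.mm_bd hl hlg k, h.small hl hlg k,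
      h.cinv hl hlg k, h.cc_bd hb hb1 hl hlg k]
      with ω h1 h2 h3 h4 h5 h6 h7 h8 h9 ⟨s0, t0, s1, t1, a2, a3⟩ h10 h11
    rw [h1, Pi.add_apply, h2, Pi.sub_apply, h4, h5, h6, h3, h7]
    have em : (cc P F ξ (1/2) l k ω)⁻¹ * (P[fun ω => fw (1/2) (l * ξ k ω) * et ξ l k ω|F k]) ω = mm P F ξ l k ω := rfl
    rw [em]
    set c := cc P F ξ (1/2) l k ω
    set e := (P[fun ω => fw (1/2) (l * ξ k ω) * et ξ l k ω ^ 2|F k]) ω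
    set s := sg P F ξ k ω
    set t := ta P F ξ k ω
    set m := mm P F ξ l k ω
    have hc : 0 < c := by linarith
    have hi : c⁻¹ ≤ 2 := inv_le_of_inv_le₀ (by norm_num) (by linarith)
    have ee : c⁻¹ * e - 2 * m * m + m ^ 2 * 1 - s = c⁻¹ * ((e - s) - (c - 1) * s) - m ^ 2 := by field_simp; ring
    rw [ee]
    refine (abs_sub _ _).trans ?_
    rw [abs_mul, abs_of_pos (inv_pos.2 hc), abs_of_nonneg (sq_nonneg m)]
    have us : 0 ≤ l * γ * s := by positivity
    have q1 : l * t ≤ l * γ * s := by nlinarith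
    have q2 : |(e - s) - (c - 1) * s| ≤ 7001 * (l * γ * s) := by
      refine (abs_sub _ _).trans ?_
      rw [abs_mul, abs_of_nonneg s0]
      have : |c - 1| * s ≤ 80 * l ^ 3 * t * s := by gcongr
      have e5 : 80 * l ^ 3 * t * s = 80 * (l * t) * (l ^ 2 * s) := by ring
      have lt0 : 0 ≤ l * t := by positivity
      have l2 : l ^ 2 * s ≤ 1 / 1000 := by nlinarith
      have : 80 * (l * t) * (l ^ 2 * s) ≤ 80 * (l * t) * (1 / 1000) := by gcongr
      linarith
    have q3 : m ^ 2 ≤ l * γ * s := by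
      rw [← sq_abs]
      calc |m| ^ 2 ≤ (2 * l * s) ^ 2 := by gcongr
        _ = 4 * (l ^ 2 * s) * s := by ring
        _ ≤ 4 * (l * γ) ^ 2 * s := by gcongr
        _ ≤ l * γ * s := by nlinarith
    have q4 : c⁻¹ * |(e - s) - (c - 1) * s| ≤ 2 * (7001 * (l * γ * s)) := by gcongr
    linarith
  · have hmono := condExp_mono (m := F k) (i3 k) ((K1 k).add (L1 k)) (hz3 k)
    have sm := condExp_smul (μ := P) (4:ℝ) (fun ω => gg P F ξ (1/2) l k ω * |et ξ l k ω| ^ 3) (F k)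
    have esm : ((4:ℝ) • fun ω => gg P F ξ (1/2) l k ω * |et ξ l k ω| ^ 3) = fun ω => 4 * (gg P F ξ (1/2) l k ω * |et ξ l k ω| ^ 3) := by
      funext ω; simp
    rw [esm] at sm
    filter_upwards [hmono, condExp_add (K1 k) (L1 k) (F k), sm, (G3 k).2, E1 k, h.ggc1 hb hb1 hl hlg k, (h.em3 hl k).2,
      h.mm_bd hl hlg k, h.small hl hlg k, h.cc_bd hb hb1 hl hlg k]
      with ω h1 h2 h3 h4 h5 h6 h7 h8 ⟨s0, t0, s1, t1, a2, a3⟩ h11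
    refine h1.trans ?_
    rw [h2, Pi.add_apply, h3, Pi.smul_apply, h4, h5, h6, smul_eq_mul]
    set c := cc P F ξ (1/2) l k ω
    set e := (P[fun ω => fw (1/2) (l * ξ k ω) * |et ξ l k ω| ^ 3|F k]) ω
    set s := sg P F ξ k ω
    set t := ta P F ξ k ω
    set m := mm P F ξ l k ω
    have hc : 0 < c := by linarith
    have hi : c⁻¹ ≤ 2 := inv_le_of_inv_le₀ (by norm_num) (by linarith)
    have q1 : c⁻¹ * e ≤ 2 * (7000 * t) := by
      calc c⁻¹ * e ≤ c⁻¹ * |e| := by gcongr; exact le_abs_self e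
        _ ≤ 2 * (7000 * t) := by gcongr
    have q2 : |m| ^ 3 ≤ γ * s := by
      calc |m| ^ 3 ≤ (2 * l * s) ^ 3 := by gcongr
        _ = 8 * (l * (l ^ 2 * s) * s * s) := by ring
        _ ≤ 8 * (l * (l * γ) ^ 2 * γ ^ 2 * s) := by gcongr
        _ = 8 * (l * γ) ^ 3 * (γ * s) := by ring
        _ ≤ 1 * (γ * s) := by
            gcongr
            have : (l * γ) ^ 3 ≤ (1 / 1000) ^ 3 := by gcongr
            linarith
        _ = _ := by ring
    linarith
  · filter_upwards [h.sg1 k] with ω h1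
    nlinarith [sq_nonneg γ]

end Setup
end SN

namespace SN

noncomputable def Ps (v : ℝ) : ℝ := v ^ 2 / (1 + v ^ 2)
noncomputable def Ps1 (v : ℝ) : ℝ := 2 * v / (1 + v ^ 2) ^ 2

lemma Ps_nonneg (v : ℝ) : 0 ≤ Ps v := by unfold Ps; positivity
lemma Ps_le (v : ℝ) : Ps v ≤ 1 := by unfold Ps; rw [div_le_one (by positivity)]; linarith
lemma Ps_half {v : ℝ} (h : 1 ≤ |v|) : 1 / 2 ≤ Ps v := by
  unfold Ps; rw [div_le_div_iff₀ (by norm_num) (by positivity)]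
  have : 1 ≤ v ^ 2 := by rw [← sq_abs]; nlinarith
  linarith
lemma Ps1_bd (v : ℝ) : |Ps1 v| ≤ 1 := by
  unfold Ps1
  rw [abs_div, abs_mul, abs_of_pos (show 0 < (1 + v ^ 2) ^ 2 by positivity), div_le_one (by positivity)]
  have := abs_le_half v
  norm_num
  nlinarith [sq_nonneg v]

lemma Ps_t1 (v s : ℝ) : |Ps (v + s) - Ps v - Ps1 v * s| ≤ 2 * |s| := by
  have h1 : |Ps (v + s) - Ps v| ≤ |s| := by
    have e : Ps (v + s) - Ps v = s * ((v + (v + s)) / ((1 + v ^ 2) * (1 + (v + s) ^ 2))) := by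
      unfold Ps; field_simp; ring
    rw [e, abs_mul]
    have : |(v + (v + s)) / ((1 + v ^ 2) * (1 + (v + s) ^ 2))| ≤ 1 := by
      rw [abs_div, abs_of_pos (show 0 < (1 + v ^ 2) * (1 + (v + s) ^ 2) by positivity), div_le_one (by positivity)]
      have a := abs_le_half v
      have b := abs_le_half (v + s)
      have c := abs_add_le v (v + s)
      nlinarith [mul_nonneg (sq_nonneg v) (sq_nonneg (v + s)), sq_nonneg v, sq_nonneg (v + s)]
    nlinarith [abs_nonneg s]
  refine (abs_sub _ _).trans ?_
  rw [abs_mul]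
  have := Ps1_bd v
  nlinarith [abs_nonneg s]

lemma Ps_t2 (v s : ℝ) : |Ps (v + s) - Ps v - Ps1 v * s| ≤ 2 * s ^ 2 := by
  have e : Ps (v + s) - Ps v - Ps1 v * s = s ^ 2 * ((1 - v ^ 2 - 2 * v * (v + s)) / ((1 + v ^ 2) ^ 2 * (1 + (v + s) ^ 2))) := by
    unfold Ps Ps1; field_simp; ring
  rw [e, abs_mul, abs_of_nonneg (sq_nonneg s)]
  have : |(1 - v ^ 2 - 2 * v * (v + s)) / ((1 + v ^ 2) ^ 2 * (1 + (v + s) ^ 2))| ≤ 2 := by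
    rw [abs_div, abs_of_pos (show 0 < (1 + v ^ 2) ^ 2 * (1 + (v + s) ^ 2) by positivity), div_le_iff₀ (by positivity)]
    generalize v + s = w
    have h1 : 0 ≤ v ^ 2 * w ^ 2 := by positivity
    have h2 : 0 ≤ v ^ 4 := by positivity
    have h3 : 0 ≤ v ^ 4 * w ^ 2 := by positivity
    rw [abs_le]; constructor <;> nlinarith [sq_nonneg (v - w), sq_nonneg (v + w), sq_nonneg v, sq_nonneg w]
  nlinarith [sq_nonneg s]

lemma Ps_t3 {a σ θ : ℝ} (ha : 0 ≤ a) (hσ : 0 ≤ σ) (hθ : 0 < θ) (v : ℝ) :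
    |Ps (v + (a ^ 2 - σ ^ 2) / θ ^ 2) - Ps v - Ps1 v * ((a ^ 2 - σ ^ 2) / θ ^ 2)| ≤ 2 * (a ^ 3 + σ ^ 3) / θ ^ 3 := by
  set s := (a ^ 2 - σ ^ 2) / θ ^ 2 with hs
  have hm0 : 0 ≤ max a σ := le_max_of_le_left ha
  have hsb : |s| ≤ (max a σ / θ) ^ 2 := by
    rw [hs, abs_div, abs_of_pos (show 0 < θ ^ 2 by positivity), div_pow]
    gcongr
    have h1 : a ^ 2 ≤ max a σ ^ 2 := by have := le_max_left a σ; gcongr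
    have h2 : σ ^ 2 ≤ max a σ ^ 2 := by have := le_max_right a σ; gcongr
    rw [abs_le]; constructor <;> nlinarith [sq_nonneg a, sq_nonneg σ]
  have hm3 : max a σ ^ 3 ≤ a ^ 3 + σ ^ 3 := by
    rcases max_choice a σ with h | h <;> rw [h]
    · have := pow_nonneg hσ 3; linarith
    · have := pow_nonneg ha 3; linarith
  have h3 : (max a σ / θ) ^ 3 ≤ (a ^ 3 + σ ^ 3) / θ ^ 3 := by rw [div_pow]; gcongr
  rw [mul_div_assoc]
  set u := max a σ / θ with hu
  have hu0 : 0 ≤ u := by positivity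
  rcases le_total 1 u with h | h
  · have := Ps_t1 v s
    have : u ^ 2 ≤ u ^ 3 := pow_le_pow_right₀ h (by norm_num)
    linarith
  · have := Ps_t2 v s
    have h5 : s ^ 2 ≤ (u ^ 2) ^ 2 := by rw [← sq_abs s]; gcongr
    have h6 : (u ^ 2) ^ 2 = u ^ 4 := by ring
    have : u ^ 4 ≤ u ^ 3 := pow_le_pow_of_le_one hu0 h (by norm_num)
    linarith

lemma Ps_meas : Continuous Ps := by
  unfold Ps
  exact (continuous_pow 2).div (by fun_prop) (fun v => by positivity)
lemma Ps1_meas : Continuous Ps1 := by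
  unfold Ps1
  exact (by fun_prop : Continuous fun v : ℝ => 2 * v).div (by fun_prop) (fun v => by positivity)

variable {Ω : Type*} {m0 : MeasurableSpace Ω} {P : Measure Ω} [IsProbabilityMeasure P]
  {F : ℕ → MeasurableSpace Ω} {n : ℕ} {ξ : ℕ → Ω → ℝ} {γ ε δ b l : ℝ}

namespace Setup

lemma gh (h : Setup P F n ξ γ ε δ) (hb : 1 / 4 ≤ b) (hb1 : b ≤ 1) (hl : 0 ≤ l) (hlg : l * γ ≤ 1 / 1000) (k : ℕ) :
    Integrable (fun ω => gg P F ξ b l k ω * (ξ k ω ^ 2 - sg P F ξ k ω)) P ∧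
    ∀ᵐ ω ∂P, |(P[fun ω => gg P F ξ b l k ω * (ξ k ω ^ 2 - sg P F ξ k ω)|F k]) ω| ≤ 170 * l * ta P F ξ k ω := by
  have fm : StronglyMeasurable[F (k+1)] (fun ω => fw b (l * ξ k ω)) :=
    (fw_meas _).comp_stronglyMeasurable ((h.xm k).const_mul l)
  have hm : AEStronglyMeasurable (fun ω => fw b (l * ξ k ω) * ξ k ω ^ 2) P :=
    ((fm.mul ((h.xm k).pow 2)).mono (h.le _)).aestronglyMeasurable
  have hle : ∀ ω, |fw b (l * ξ k ω) * ξ k ω ^ 2 - (0 + 0 * ξ k ω + 1 * ξ k ω ^ 2)| ≤ 82 * l * |ξ k ω| ^ 3 := by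
    intro ω
    have h1 := fw_one hb hb1 (l * ξ k ω)
    have e : fw b (l * ξ k ω) * ξ k ω ^ 2 - (0 + 0 * ξ k ω + 1 * ξ k ω ^ 2) = (fw b (l * ξ k ω) - 1) * ξ k ω ^ 2 := by ring
    rw [e, abs_mul, abs_of_nonneg (sq_nonneg (ξ k ω))]
    calc _ ≤ 82 * |l * ξ k ω| * ξ k ω ^ 2 := by gcongr
      _ = _ := by rw [← sq_abs (ξ k ω), abs_mul, abs_of_nonneg hl]; ring
  have I1 := h.capp_int k hm hle
  have A1 := h.capp k hm hle
  have I2 := int_pull (h.le k) (h.sgm k) (h.sgb k) (h.fwi (l := l) hb k)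
  have A2 := cond_pull (h.le k) (h.sgm k) (h.sgb k) (h.fwi (l := l) hb k)
  have e : (fun ω => fw b (l * ξ k ω) * (ξ k ω ^ 2 - sg P F ξ k ω)) = (fun ω => fw b (l * ξ k ω) * ξ k ω ^ 2)
    - (fun ω => sg P F ξ k ω * fw b (l * ξ k ω)) := by funext ω; simp only [Pi.sub_apply]; ring
  have I3 : Integrable (fun ω => fw b (l * ξ k ω) * (ξ k ω ^ 2 - sg P F ξ k ω)) P := by rw [e]; exact I1.sub I2
  obtain ⟨I4, A4⟩ := h.ggc hb hb1 hl hlg k I3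
  refine ⟨I4, ?_⟩
  filter_upwards [A4, A1, A2, condExp_sub I1 I2 (F k), h.ccb hb hb1 hl hlg k, h.cc_app hb hb1 hl k, h.small hl hlg k,
    h.sg3 k, h.sqb k] with ω a4 a1 a2 a5 a6 a7 ⟨s0, t0, s1, t1, q2, q3⟩ a8 a9
  rw [a4, abs_mul, e, a5, Pi.sub_apply, a2]
  change |(cc P F ξ b l k ω)⁻¹| * |(P[fun ω => fw b (l * ξ k ω) * ξ k ω ^ 2|F k]) ω - sg P F ξ k ω * cc P F ξ b l k ω| ≤ _
  set c := cc P F ξ b l k ω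
  set E := (P[fun ω => fw b (l * ξ k ω) * ξ k ω ^ 2|F k]) ω
  rw [abs_of_nonneg (Real.sqrt_nonneg _)] at a9
  set σ := Real.sqrt (sg P F ξ k ω) with hσ
  have hσ0 : 0 ≤ σ := Real.sqrt_nonneg _
  have hσ2 : σ ^ 2 = sg P F ξ k ω := Real.sq_sqrt s0
  set s := sg P F ξ k ω
  set t := ta P F ξ k ω
  have hu : 0 ≤ l * γ := mul_nonneg hl h.g0.le
  have lt0 : 0 ≤ l * t := by positivity
  have c1 : |c - 1| ≤ l ^ 2 * s + 80 * l ^ 3 * t := by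
    have := abs_le.1 a7
    have h0 : 0 ≤ l ^ 2 * s := by positivity
    rw [abs_le]; constructor <;> nlinarith
  have c2 : s * |c - 1| ≤ l * t := by
    calc s * |c - 1| ≤ s * (l ^ 2 * s + 80 * l ^ 3 * t) := by gcongr
      _ = l ^ 2 * (σ * σ ^ 3) + 80 * (l * t) * (l ^ 2 * s) := by rw [← hσ2]; ring
      _ ≤ l ^ 2 * (γ * t) + 80 * (l * t) * (1 / 1000) := by
          have := h.g0.le
          have h9 : l ^ 2 * s ≤ 1 / 1000 := by nlinarith
          gcongr
      _ = (l * γ) * (l * t) + 80 * (l * t) * (1 / 1000) := by ring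
      _ ≤ 1 / 1000 * (l * t) + 80 * (l * t) * (1 / 1000) := by gcongr
      _ ≤ l * t := by linarith
  have c3 : |E - s * c| ≤ 83 * (l * t) := by
    have e : E - s * c = (E - (0 + 1 * s)) - s * (c - 1) := by ring
    rw [e]
    refine (abs_sub _ _).trans ?_
    rw [abs_mul, abs_of_nonneg s0]
    linarith
  calc |c⁻¹| * |E - s * c| ≤ 2 * (83 * (l * t)) := by gcongr
    _ ≤ 170 * l * t := by linarith

lemma g3 (h : Setup P F n ξ γ ε δ) (hb : 1 / 4 ≤ b) (hb1 : b ≤ 1) (hl : 0 ≤ l) (hlg : l * γ ≤ 1 / 1000) (k : ℕ) :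
    Integrable (fun ω => gg P F ξ b l k ω * |ξ k ω| ^ 3) P ∧
    ∀ᵐ ω ∂P, (P[fun ω => gg P F ξ b l k ω * |ξ k ω| ^ 3|F k]) ω ≤ 6 * ta P F ξ k ω := by
  have fm : StronglyMeasurable[F (k+1)] (fun ω => fw b (l * ξ k ω)) :=
    (fw_meas _).comp_stronglyMeasurable ((h.xm k).const_mul l)
  have hm : AEStronglyMeasurable (fun ω => fw b (l * ξ k ω) * |ξ k ω| ^ 3) P :=
    ((fm.mul ((h.xm k).norm.pow 3)).mono (h.le _)).aestronglyMeasurable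
  have hle : ∀ ω, |fw b (l * ξ k ω) * |ξ k ω| ^ 3 - (0 + 0 * ξ k ω + 0 * ξ k ω ^ 2)| ≤ 3 * |ξ k ω| ^ 3 := by
    intro ω
    have h1 := fw_le hb (l * ξ k ω)
    have h0 := fw_pos b (l * ξ k ω)
    have e : fw b (l * ξ k ω) * |ξ k ω| ^ 3 - (0 + 0 * ξ k ω + 0 * ξ k ω ^ 2) = fw b (l * ξ k ω) * |ξ k ω| ^ 3 := by ring
    rw [e, abs_of_nonneg (by positivity)]
    gcongr
  have I1 := h.capp_int k hm hle
  obtain ⟨I4, A4⟩ := h.ggc hb hb1 hl hlg k I1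
  refine ⟨I4, ?_⟩
  filter_upwards [A4, h.capp k hm hle, h.ccb hb hb1 hl hlg k] with ω a4 a1 a6
  rw [a4]
  refine (le_abs_self _).trans ?_
  rw [abs_mul]
  simp only [zero_mul, add_zero, sub_zero] at a1
  calc _ ≤ 2 * (3 * ta P F ξ k ω) := by gcongr
    _ = _ := by ring

end Setup

noncomputable def sgp {Ω : Type*} {m0 : MeasurableSpace Ω} (P : Measure Ω) (F : ℕ → MeasurableSpace Ω)
    (ξ : ℕ → Ω → ℝ) (b l : ℝ) (k : ℕ) : Ω → ℝ :=
  fun ω => sg P F ξ k ω + (P[fun ω => gg P F ξ b l k ω * (ξ k ω ^ 2 - sg P F ξ k ω)|F k]) ω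

namespace Setup

lemma spm (h : Setup P F n ξ γ ε δ) (k : ℕ) : StronglyMeasurable[F k] (sgp P F ξ b l k) :=
  (h.sgm k).add stronglyMeasurable_condExp

lemma sp1 (h : Setup P F n ξ γ ε δ) (hb : 1 / 4 ≤ b) (hb1 : b ≤ 1) (hl : 0 ≤ l) (hlg : l * γ ≤ 1 / 1000) (k : ℕ) :
    ∀ᵐ ω ∂P, |sgp P F ξ b l k ω - sg P F ξ k ω| ≤ 170 * l * ta P F ξ k ω := by
  filter_upwards [(h.gh hb hb1 hl hlg k).2] with ω h1
  unfold sgp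
  simpa using h1

lemma sp2 (h : Setup P F n ξ γ ε δ) (hb : 1 / 4 ≤ b) (hb1 : b ≤ 1) (hl : 0 ≤ l) (hlg : l * γ ≤ 1 / 1000) (k : ℕ) :
    ∀ᵐ ω ∂P, 0 ≤ sgp P F ξ b l k ω ∧ sgp P F ξ b l k ω ≤ 2 * sg P F ξ k ω := by
  filter_upwards [h.sp1 hb hb1 hl hlg k, h.t1 k, h.sg0 k] with ω h1 h2 h3
  have := abs_le.1 h1
  have h4 : l * ta P F ξ k ω ≤ 1 / 1000 * sg P F ξ k ω := by
    calc _ ≤ l * (γ * sg P F ξ k ω) := by gcongr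
      _ = l * γ * sg P F ξ k ω := by ring
      _ ≤ _ := by gcongr
  constructor <;> linarith

lemma sp0 (h : Setup P F n ξ γ ε δ) (hb : 1 / 4 ≤ b) (hb1 : b ≤ 1) (hl : 0 ≤ l) (hlg : l * γ ≤ 1 / 1000) (k : ℕ) :
    ∀ᵐ ω ∂P, 0 ≤ sgp P F ξ b l k ω := by
  filter_upwards [h.sp2 hb hb1 hl hlg k] with ω h1 using h1.1

lemma sp3 (h : Setup P F n ξ γ ε δ) (hb : 1 / 4 ≤ b) (hb1 : b ≤ 1) (hl : 0 ≤ l) (hlg : l * γ ≤ 1 / 1000) (k : ℕ) :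
    ∀ᵐ ω ∂P, Real.sqrt (sgp P F ξ b l k ω) ^ 3 ≤ 3 * ta P F ξ k ω := by
  filter_upwards [h.sp2 hb hb1 hl hlg k, h.sg3 k, h.sg0 k] with ω h1 h2 h3
  have a1 : Real.sqrt (sgp P F ξ b l k ω) ≤ Real.sqrt 2 * Real.sqrt (sg P F ξ k ω) := by
    rw [← Real.sqrt_mul (by norm_num)]; exact Real.sqrt_le_sqrt h1.2
  have a2 : Real.sqrt 2 ≤ 3 / 2 := by rw [Real.sqrt_le_left (by norm_num)]; norm_num
  have a3 : Real.sqrt 2 ^ 2 = 2 := Real.sq_sqrt (by norm_num)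
  have a4 : Real.sqrt 2 ^ 3 ≤ 3 := by rw [pow_succ, a3]; linarith
  have := h.g0
  calc _ ≤ (Real.sqrt 2 * Real.sqrt (sg P F ξ k ω)) ^ 3 := by gcongr
    _ = Real.sqrt 2 ^ 3 * Real.sqrt (sg P F ξ k ω) ^ 3 := by ring
    _ ≤ _ := by gcongr

lemma gp (h : Setup P F n ξ γ ε δ) (hb : 1 / 4 ≤ b) (hb1 : b ≤ 1) (hl : 0 ≤ l) (hlg : l * γ ≤ 1 / 1000) (k : ℕ) :
    Integrable (fun ω => gg P F ξ b l k ω * (ξ k ω ^ 2 - sgp P F ξ b l k ω)) P ∧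
    ∀ᵐ ω ∂P, (P[fun ω => gg P F ξ b l k ω * (ξ k ω ^ 2 - sgp P F ξ b l k ω)|F k]) ω = 0 := by
  obtain ⟨I1, C1⟩ := h.gh hb hb1 hl hlg k
  have Gi : Integrable (gg P F ξ b l k) P :=
      int_of_bdd ((h.ggm k).mono (h.le _)).aestronglyMeasurable (h.ggb hb hb1 hl hlg k)
  set e : Ω → ℝ := P[fun ω => gg P F ξ b l k ω * (ξ k ω ^ 2 - sg P F ξ k ω)|F k] with he
  have em : StronglyMeasurable[F k] e := stronglyMeasurable_condExp
  have eb : ∃ C, ∀ᵐ ω ∂P, |e ω| ≤ C := by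
    refine ⟨170 * l * γ ^ 3, ?_⟩
    filter_upwards [C1, h.ta1 k] with ω h1 h2
    exact h1.trans (by gcongr)
  have I2 := int_pull (h.le k) em eb Gi
  have A2 := cond_pull (h.le k) em eb Gi
  have ee : (fun ω => gg P F ξ b l k ω * (ξ k ω ^ 2 - sgp P F ξ b l k ω)) =
     (fun ω => gg P F ξ b l k ω * (ξ k ω ^ 2 - sg P F ξ k ω)) - (fun ω => e ω * gg P F ξ b l k ω) := by
    funext ω; simp only [Pi.sub_apply, sgp, ← he]; ring
  rw [ee]
  refine ⟨I1.sub I2, ?_⟩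
  filter_upwards [condExp_sub I1 I2 (F k), A2, h.ggc1 hb hb1 hl hlg k] with ω h1 h2 h3
  rw [h1, Pi.sub_apply, h2, h3, ← he]; ring

set_option maxHeartbeats 1000000 in
lemma cheb2 (h : Setup P F n ξ γ ε δ) (hb : 1 / 4 ≤ b) (hb1 : b ≤ 1) (hl : 0 ≤ l) (hlg : l * γ ≤ 1 / 1000)
    {θ : ℝ} (hθ : 0 < θ) :
    ∫ ω, (∏ i ∈ Finset.range n, gg P F ξ b l i ω) *
      (if θ ^ 2 ≤ |∑ i ∈ Finset.range n, (ξ i ω ^ 2 - sgp P F ξ b l i ω)| then 1 else 0) ∂P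
      ≤ 40 * (ε / θ ^ 3) := by
  set R : ℝ := 20 * (1 / θ ^ 3) with hR
  have hR0 : 0 ≤ R := by positivity
  set v : ℕ → Ω → ℝ := fun k ω => (∑ i ∈ Finset.range k, (ξ i ω ^ 2 - sgp P F ξ b l i ω)) / θ ^ 2 with hv
  set A : ℕ → Ω → ℝ := fun k ω => R * ∑ i ∈ Finset.range k, ta P F ξ i ω with hA
  have xsm : ∀ i, StronglyMeasurable[F (i+1)] (fun ω => ξ i ω ^ 2 - sgp P F ξ b l i ω) := fun i =>
    ((h.xm i).pow 2).sub ((h.spm i).mono (h.mono (Nat.le_succ i)))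
  have vm : ∀ k, StronglyMeasurable[F k] (v k) := fun k =>
    (sum_sm h.mono xsm k).div stronglyMeasurable_const
  have Am : ∀ k, StronglyMeasurable[F k] (A (k+1)) := fun k => by
    refine StronglyMeasurable.const_mul (Finset.stronglyMeasurable_fun_sum _ fun i hi => ?_) R
    exact (h.tam i).mono (h.mono (Nat.lt_succ_iff.1 (Finset.mem_range.1 hi)))
  have Am' : ∀ k, StronglyMeasurable[F k] (A k) := fun k => 
    (sum_sm h.mono (fun i => (h.tam i).mono (h.mono (Nat.le_succ i))) k).const_mul R
  have Ab : ∀ k, ∀ᵐ ω ∂P, |A k ω| ≤ R * (k * γ ^ 3) := fun k => by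
    filter_upwards [ae_all_iff.2 h.ta0, ae_all_iff.2 h.ta1] with ω h0 h1
    have : 0 ≤ ∑ i ∈ Finset.range k, ta P F ξ i ω := Finset.sum_nonneg fun i _ => h0 i
    rw [hA]
    simp only
    rw [abs_of_nonneg (by positivity)]
    gcongr
    calc _ ≤ ∑ i ∈ Finset.range k, γ ^ 3 := Finset.sum_le_sum fun i _ => h1 i
      _ = _ := by simp
  have Psm : ∀ k, StronglyMeasurable[F k] (fun ω => Ps (v k ω)) := fun k => Ps_meas.comp_stronglyMeasurable (vm k)
  have VB : ∀ k j, ∃ C, ∀ᵐ ω ∂P, |Ps (v k ω) - A j ω| ≤ C := fun k j => by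
    refine ⟨1 + R * (j * γ ^ 3), ?_⟩
    filter_upwards [Ab j] with ω h1
    refine (abs_sub _ _).trans ?_
    have := Ps_le (v k ω)
    rw [abs_of_nonneg (Ps_nonneg _)]
    linarith
  have key := wsm (P := P) h.mono h.le (g := gg P F ξ b l) (V := fun k ω => Ps (v k ω) - A k ω) n h.ggm (h.gg0 hb hb1 hl hlg)
    (h.ggb hb hb1 hl hlg) (fun k _ => (Psm k).sub (Am' k)) (fun k _ => VB k k) ?_
  · have e0 : ∫ ω, (Ps (v 0 ω) - A 0 ω) ∂P = 0 := by simp [hv, hA, Ps]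
    rw [e0] at key
    obtain ⟨Mi, M1⟩ := h.gg_mass hb hb1 hl hlg
    have Mm := prod_sm h.mono (h.ggm (b := b) (l := l)) n
    have Mb := prod_bdd (h.ggb hb hb1 hl hlg) n
    have J : Integrable (fun ω => (∏ i ∈ Finset.range n, gg P F ξ b l i ω) * (Ps (v n ω) - A n ω)) P :=
      int_of_bdd ((Mm.mul ((Psm n).sub (Am' n))).mono (h.le n)).aestronglyMeasurable (bdd_mul' Mb (VB n n))
    have hle : ∫ ω, (∏ i ∈ Finset.range n, gg P F ξ b l i ω) *
      (if θ ^ 2 ≤ |∑ i ∈ Finset.range n, (ξ i ω ^ 2 - sgp P F ξ b l i ω)| then 1 else 0) ∂P ≤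
      ∫ ω, (2 * ((∏ i ∈ Finset.range n, gg P F ξ b l i ω) * (Ps (v n ω) - A n ω)) + 2 * (R * ε) * ∏ i ∈ Finset.range n, gg P F ξ b l i ω) ∂P := by
      apply integral_mono_of_nonneg _ ((J.const_mul 2).add (Mi.const_mul _))
      · filter_upwards [ae_all_iff.2 (h.gg0 hb hb1 hl hlg), h.tn] with ω h1 h2
        have hM := Finset.prod_nonneg (s := Finset.range n) fun i _ => h1 i
        have hA1 : A n ω ≤ R * ε := by simp only [hA]; gcongr
        have e : 2 * ((∏ i ∈ Finset.range n, gg P F ξ b l i ω) * (Ps (v n ω) - A n ω)) + 2 * (R * ε) * ∏ i ∈ Finset.range n, gg P F ξ b l i ω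
          = (∏ i ∈ Finset.range n, gg P F ξ b l i ω) * (2 * Ps (v n ω) + 2 * (R * ε - A n ω)) := by ring
        simp only [Pi.add_apply]
        rw [e]
        apply mul_le_mul_of_nonneg_left _ hM
        have := Ps_nonneg (v n ω)
        split_ifs with h3
        · have : 1 ≤ |v n ω| := by
            simp only [hv]
            rw [abs_div, abs_of_pos (show 0 < θ ^ 2 by positivity), le_div_iff₀ (by positivity)]
            linarith
          have := Ps_half this
          linarith
        · linarith
      · filter_upwards [ae_all_iff.2 (h.gg0 hb hb1 hl hlg)] with ω h1
        have hM := Finset.prod_nonneg (s := Finset.range n) fun i _ => h1 i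
        apply mul_nonneg hM
        split_ifs <;> norm_num
    refine hle.trans ?_
    rw [integral_add (J.const_mul 2) (Mi.const_mul _), integral_const_mul, integral_const_mul, M1]
    have : 2 * (R * ε) * 1 ≤ 40 * (ε / θ ^ 3) := by
      have e : 2 * (R * ε) * 1 = 40 * (ε / θ ^ 3) := by rw [hR]; ring
      rw [e]
    linarith
  · intro k hk
    obtain ⟨I1, C1⟩ := h.gp hb hb1 hl hlg k
    obtain ⟨I3, C3⟩ := h.g3 hb hb1 hl hlg k
    have Gi : Integrable (gg P F ξ b l k) P :=
      int_of_bdd ((h.ggm k).mono (h.le _)).aestronglyMeasurable (h.ggb hb hb1 hl hlg k)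
    have Hi : Integrable (fun ω => gg P F ξ b l k ω * (Ps (v (k+1) ω) - A (k+1) ω)) P :=
      int_of_bdd (((h.ggm k).mul ((Psm (k+1)).sub (Am' (k+1)))).mono (h.le _)).aestronglyMeasurable
        (bdd_mul' (h.ggb hb hb1 hl hlg k) (VB _ _))
    have := cond_step (P := P) (h.le k) (H := fun ω => gg P F ξ b l k ω * (Ps (v (k+1) ω) - A (k+1) ω))
      (p0 := fun ω => Ps (v k ω) - A (k+1) ω) (p1 := fun ω => Ps1 (v k ω) / θ ^ 2) (p2 := fun _ => 2 / θ ^ 3)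
      (p3 := fun ω => 2 * Real.sqrt (sgp P F ξ b l k ω) ^ 3 / θ ^ 3)
      (a0 := gg P F ξ b l k) (a1 := fun ω => gg P F ξ b l k ω * (ξ k ω ^ 2 - sgp P F ξ b l k ω))
      (a2 := fun ω => gg P F ξ b l k ω * |ξ k ω| ^ 3) (a3 := gg P F ξ b l k)
      Hi ((Psm k).sub (Am k)) (VB _ _) Gi
      ((Ps1_meas.comp_stronglyMeasurable (vm k)).div stronglyMeasurable_const)
      ⟨1 / θ ^ 2, Filter.Eventually.of_forall fun ω => by
        rw [abs_div, abs_of_pos (show 0 < θ ^ 2 by positivity)]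
        have := Ps1_bd (v k ω); gcongr⟩ I1
      stronglyMeasurable_const ⟨|2 / θ ^ 3|, by simp⟩ I3
      (((((Real.continuous_sqrt.comp_stronglyMeasurable (h.spm k))).pow 3).const_mul 2).div stronglyMeasurable_const)
      ⟨2 * (3 * γ ^ 3) / θ ^ 3, by
        filter_upwards [h.sp3 hb hb1 hl hlg k, h.ta1 k] with ω h1 h2
        have h3 := h1.trans (mul_le_mul_of_nonneg_left h2 (by norm_num : (0:ℝ) ≤ 3))
        rw [abs_of_nonneg (by positivity)]
        gcongr⟩ Gi ?_
    · filter_upwards [this, C1, C3, h.ggc1 hb hb1 hl hlg k, h.sp3 hb hb1 hl hlg k, h.ta0 k] with ω h1 h2 h3 h4 h5 h6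
      refine h1.trans ?_
      rw [h4]
      have eA : A (k+1) ω = A k ω + R * ta P F ξ k ω := by
        simp only [hA]; rw [Finset.sum_range_succ]; ring
      rw [eA]
      set E1 := (P[fun ω => gg P F ξ b l k ω * (ξ k ω ^ 2 - sgp P F ξ b l k ω)|F k]) ω
      set E3 := (P[fun ω => gg P F ξ b l k ω * |ξ k ω| ^ 3|F k]) ω
      set t := ta P F ξ k ω
      have b1 : Ps1 (v k ω) / θ ^ 2 * E1 = 0 := by rw [h2, mul_zero]
      have b2 : 2 / θ ^ 3 * E3 ≤ 2 / θ ^ 3 * (6 * t) := by gcongr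
      have b3 : 2 * Real.sqrt (sgp P F ξ b l k ω) ^ 3 / θ ^ 3 * 1 ≤ 2 * (3 * t) / θ ^ 3 := by rw [mul_one]; gcongr
      have eR : R * t = 20 * (t / θ ^ 3) := by rw [hR]; ring
      have : 0 ≤ t / θ ^ 3 := by positivity
      have e1 : 2 / θ ^ 3 * (6 * t) = 12 * (t / θ ^ 3) := by ring
      have e2 : 2 * (3 * t) / θ ^ 3 = 6 * (t / θ ^ 3) := by ring
      linarith
    · filter_upwards [h.gg0 hb hb1 hl hlg k, h.sp0 hb hb1 hl hlg k] with ω h0 s0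
      have ev : v (k+1) ω = v k ω + (|ξ k ω| ^ 2 - Real.sqrt (sgp P F ξ b l k ω) ^ 2) / θ ^ 2 := by
        simp only [hv]; rw [Finset.sum_range_succ, sq_abs, Real.sq_sqrt s0]; ring
      have t3 := (abs_le.1 (Ps_t3 (abs_nonneg (ξ k ω)) (Real.sqrt_nonneg (sgp P F ξ b l k ω)) hθ (v k ω))).2
      rw [← ev] at t3
      rw [sq_abs, Real.sq_sqrt s0] at t3
      have e : (Ps (v k ω) - A (k+1) ω) * gg P F ξ b l k ω + Ps1 (v k ω) / θ ^ 2 * (gg P F ξ b l k ω * (ξ k ω ^ 2 - sgp P F ξ b l k ω))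
          + 2 / θ ^ 3 * (gg P F ξ b l k ω * |ξ k ω| ^ 3) + 2 * Real.sqrt (sgp P F ξ b l k ω) ^ 3 / θ ^ 3 * gg P F ξ b l k ω
         = gg P F ξ b l k ω * (Ps (v k ω) - A (k+1) ω + Ps1 (v k ω) * ((ξ k ω ^ 2 - sgp P F ξ b l k ω) / θ ^ 2)
           + 2 * (|ξ k ω| ^ 3 + Real.sqrt (sgp P F ξ b l k ω) ^ 3) / θ ^ 3) := by ring
      rw [e]
      apply mul_le_mul_of_nonneg_left _ h0
      linarith

end Setup
end SN

namespace SN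

variable {Ω : Type*} {m0 : MeasurableSpace Ω} {P : Measure Ω} [IsProbabilityMeasure P]
  {F : ℕ → MeasurableSpace Ω} {n : ℕ} {ξ : ℕ → Ω → ℝ} {γ ε δ b l : ℝ}

/-- the sum, the quadratic variation -/
noncomputable def SS (ξ : ℕ → Ω → ℝ) (n : ℕ) (ω : Ω) : ℝ := ∑ i ∈ Finset.range n, ξ i ω
noncomputable def QQ (ξ : ℕ → Ω → ℝ) (n : ℕ) (ω : Ω) : ℝ := ∑ i ∈ Finset.range n, ξ i ω ^ 2
noncomputable def CVr {m0 : MeasurableSpace Ω} (P : Measure Ω) (F : ℕ → MeasurableSpace Ω) (ξ : ℕ → Ω → ℝ) (n : ℕ) (ω : Ω) : ℝ :=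
  ∑ i ∈ Finset.range n, sg P F ξ i ω
noncomputable def MM {m0 : MeasurableSpace Ω} (P : Measure Ω) (F : ℕ → MeasurableSpace Ω) (ξ : ℕ → Ω → ℝ) (b l : ℝ) (n : ℕ) (ω : Ω) : ℝ :=
  ∏ i ∈ Finset.range n, gg P F ξ b l i ω

lemma real_le_int {A : Set Ω} (hA : MeasurableSet A) {f : Ω → ℝ} (hf : Integrable f P)
    (h0 : ∀ᵐ ω ∂P, 0 ≤ f ω) (h1 : ∀ᵐ ω ∂P, ω ∈ A → 1 ≤ f ω) : P.real A ≤ ∫ ω, f ω ∂P := by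
  rw [← integral_indicator_one hA]
  apply integral_mono_ae ((integrable_const (1:ℝ)).indicator hA) hf
  filter_upwards [h0, h1] with ω a b
  by_cases h : ω ∈ A
  · simpa [h] using b h
  · simpa [h] using a

namespace Setup

lemma SSm (h : Setup P F n ξ γ ε δ) : Measurable (SS ξ n) :=
  Finset.measurable_sum _ fun i _ => h.xm0 i
lemma QQm (h : Setup P F n ξ γ ε δ) : Measurable (QQ ξ n) :=
  Finset.measurable_sum _ fun i _ => (h.xm0 i).pow_const 2
lemma VVm (h : Setup P F n ξ γ ε δ) : Measurable (CVr P F ξ n) :=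
  Finset.measurable_sum _ fun i _ => ((h.sgm i).mono (h.le i)).measurable
lemma MM0 (h : Setup P F n ξ γ ε δ) (hb : 1 / 4 ≤ b) (hb1 : b ≤ 1) (hl : 0 ≤ l) (hlg : l * γ ≤ 1 / 1000) :
    ∀ᵐ ω ∂P, 0 ≤ MM P F ξ b l n ω := by
  filter_upwards [ae_all_iff.2 (h.gg0 hb hb1 hl hlg)] with ω h1
  exact Finset.prod_nonneg fun i _ => h1 i
lemma MMi (h : Setup P F n ξ γ ε δ) (hb : 1 / 4 ≤ b) (hb1 : b ≤ 1) (hl : 0 ≤ l) (hlg : l * γ ≤ 1 / 1000) :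
    Integrable (MM P F ξ b l n) P := (h.gg_mass hb hb1 hl hlg).1

/-- bounded times the density is integrable -/
lemma MMint (h : Setup P F n ξ γ ε δ) (hb : 1 / 4 ≤ b) (hb1 : b ≤ 1) (hl : 0 ≤ l) (hlg : l * γ ≤ 1 / 1000)
    {f : Ω → ℝ} (hf : Measurable f) {C : ℝ} (hC : ∀ ω, |f ω| ≤ C) :
    Integrable (fun ω => MM P F ξ b l n ω * f ω) P :=
  (h.MMi hb hb1 hl hlg).mul_bdd (c := C) hf.aestronglyMeasurable (Filter.Eventually.of_forall hC)

lemma cheb3 (h : Setup P F n ξ γ ε δ) (hb : 1 / 4 ≤ b) (hb1 : b ≤ 1) (hl : 0 ≤ l) (hlg : l * γ ≤ 1 / 1000)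
    {θ : ℝ} (hθ : 0 < θ) (hd : 170 * l * ε ≤ θ ^ 2) :
    ∫ ω, MM P F ξ b l n ω * (if 2 * θ ^ 2 ≤ |QQ ξ n ω - CVr P F ξ n ω| then 1 else 0) ∂P ≤ 40 * (ε / θ ^ 3) := by
  refine le_trans ?_ (h.cheb2 hb hb1 hl hlg hθ)
  have hm : ∀ i, Measurable (fun ω => ξ i ω ^ 2 - sgp P F ξ b l i ω) := fun i =>
    ((h.xm0 i).pow_const 2).sub ((h.spm i).mono (h.le i)).measurable
  have hs : Measurable (fun ω => |∑ i ∈ Finset.range n, (ξ i ω ^ 2 - sgp P F ξ b l i ω)|) :=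
    (Finset.measurable_sum _ fun i _ => hm i).abs
  apply integral_mono_of_nonneg
  · filter_upwards [h.MM0 hb hb1 hl hlg] with ω h1
    apply mul_nonneg h1; split_ifs <;> norm_num
  · exact h.MMint hb hb1 hl hlg (f := fun ω => if θ ^ 2 ≤ |∑ i ∈ Finset.range n, (ξ i ω ^ 2 - sgp P F ξ b l i ω)| then 1 else 0)
      (Measurable.ite (measurableSet_le measurable_const hs) measurable_const measurable_const) (C := 1)
      (fun ω => by split_ifs <;> norm_num)
  · filter_upwards [h.MM0 hb hb1 hl hlg, ae_all_iff.2 (h.sp1 hb hb1 hl hlg), h.tn] with ω h1 h2 h3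
    apply mul_le_mul_of_nonneg_left _ h1
    have k1 : |∑ i ∈ Finset.range n, (sgp P F ξ b l i ω - sg P F ξ i ω)| ≤ θ ^ 2 := by
      calc _ ≤ ∑ i ∈ Finset.range n, 170 * l * ta P F ξ i ω :=
            (Finset.abs_sum_le_sum_abs _ _).trans (Finset.sum_le_sum fun i _ => h2 i)
        _ = 170 * l * ∑ i ∈ Finset.range n, ta P F ξ i ω := by rw [Finset.mul_sum]
        _ ≤ 170 * l * ε := by gcongr
        _ ≤ _ := hd
    have k2 : QQ ξ n ω - CVr P F ξ n ω = ∑ i ∈ Finset.range n, (ξ i ω ^ 2 - sgp P F ξ b l i ω) +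
      ∑ i ∈ Finset.range n, (sgp P F ξ b l i ω - sg P F ξ i ω) := by
      rw [← Finset.sum_add_distrib, QQ, CVr, ← Finset.sum_sub_distrib]
      exact Finset.sum_congr rfl fun i _ => by ring
    split_ifs with a1 a2
    · exact le_rfl
    · exfalso
      have := abs_add_le (∑ i ∈ Finset.range n, (ξ i ω ^ 2 - sgp P F ξ b l i ω)) (∑ i ∈ Finset.range n, (sgp P F ξ b l i ω - sg P F ξ i ω))
      rw [← k2] at this
      linarith
    · norm_num
    · norm_num

lemma region (h : Setup P F n ξ γ ε δ) (hb : 1 / 4 ≤ b) (hb1 : b ≤ 1) (hl : 0 ≤ l) (hlg : l * γ ≤ 1 / 1000)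
    {θ : ℝ} (hθ : 0 < θ) (hd : 170 * l * ε ≤ θ ^ 2) {A : Set Ω} (hA : MeasurableSet A) {κ : ℝ}
    (hAA : ∀ᵐ ω ∂P, ω ∈ A → κ ≤ l * SS ξ n ω - b * l ^ 2 * QQ ξ n ω - (1/2 - b) * l ^ 2 * CVr P F ξ n ω ∧
      2 * θ ^ 2 ≤ |QQ ξ n ω - CVr P F ξ n ω|) :
    P.real A ≤ Real.exp (-κ + 80 * l ^ 3 * ε) * (40 * (ε / θ ^ 3)) := by
  have hm : Measurable (fun ω => |QQ ξ n ω - CVr P F ξ n ω|) := (h.QQm.sub h.VVm).abs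
  have I := h.MMint hb hb1 hl hlg (f := fun ω => if 2 * θ ^ 2 ≤ |QQ ξ n ω - CVr P F ξ n ω| then 1 else 0)
      (Measurable.ite (measurableSet_le measurable_const hm) measurable_const measurable_const) (C := 1)
      (fun ω => by split_ifs <;> norm_num)
  refine (real_le_int hA (I.const_mul (Real.exp (-κ + 80 * l ^ 3 * ε))) ?_ ?_).trans ?_
  · filter_upwards [h.MM0 hb hb1 hl hlg] with ω h1
    apply mul_nonneg (Real.exp_pos _).le
    apply mul_nonneg h1; split_ifs <;> norm_num
  · filter_upwards [hAA, h.prod_le hb hb1 hl hlg, h.MM0 hb hb1 hl hlg] with ω h1 h2 h3 h4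
    obtain ⟨h5, h6⟩ := h1 h4
    rw [if_pos h6, mul_one]
    change Real.exp (l * SS ξ n ω - b * l ^ 2 * QQ ξ n ω) ≤ MM P F ξ b l n ω * Real.exp ((1 / 2 - b) * l ^ 2 * CVr P F ξ n ω + 80 * l ^ 3 * ε) at h2
    have h7 : Real.exp (l * SS ξ n ω - b * l ^ 2 * QQ ξ n ω) * Real.exp (-((1 / 2 - b) * l ^ 2 * CVr P F ξ n ω) - κ)
       ≤ MM P F ξ b l n ω * Real.exp ((1 / 2 - b) * l ^ 2 * CVr P F ξ n ω + 80 * l ^ 3 * ε) * Real.exp (-((1 / 2 - b) * l ^ 2 * CVr P F ξ n ω) - κ) := by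
      gcongr
    rw [mul_assoc (MM P F ξ b l n ω), ← Real.exp_add, ← Real.exp_add] at h7
    have h8 : 1 ≤ Real.exp (l * SS ξ n ω - b * l ^ 2 * QQ ξ n ω + (-((1 / 2 - b) * l ^ 2 * CVr P F ξ n ω) - κ)) :=
      Real.one_le_exp (by linarith)
    have e : (1 / 2 - b) * l ^ 2 * CVr P F ξ n ω + 80 * l ^ 3 * ε + (-((1 / 2 - b) * l ^ 2 * CVr P F ξ n ω) - κ) = -κ + 80 * l ^ 3 * ε := by ring
    rw [e] at h7
    linarith
  · rw [integral_const_mul]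
    have := h.cheb3 hb hb1 hl hlg hθ hd
    gcongr

end Setup
end SN

namespace SN

variable {Ω : Type*} {m0 : MeasurableSpace Ω} {P : Measure Ω} [IsProbabilityMeasure P]
  {F : ℕ → MeasurableSpace Ω} {n : ℕ} {ξ : ℕ → Ω → ℝ} {γ ε δ x τ : ℝ}

lemma QQ0 (ξ : ℕ → Ω → ℝ) (n : ℕ) (ω : Ω) : 0 ≤ QQ ξ n ω := Finset.sum_nonneg fun i _ => sq_nonneg _

noncomputable def DD (γ δ x : ℝ) : ℝ := CBE * (δ + (60000 * γ) * (1 + |Real.log (60000 * γ)|) + 15000 * (x * γ))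

namespace Setup

set_option maxHeartbeats 1000000 in
lemma partA (h : Setup P F n ξ γ ε δ) (hx : 0 ≤ x) (hlg : x * γ ≤ 1 / 1000) (hτ : 0 ≤ τ) {d : ℝ}
    (hd : d = x * τ ^ 2 / 2 + x * δ ^ 2 / 2 + 600 * x ^ 2 * ε) :
    P.real {ω | x * Real.sqrt (QQ ξ n ω) ≤ SS ξ n ω ∧ |Real.sqrt (QQ ξ n ω) - 1| ≤ τ} ≤
      Real.exp (x * d + x ^ 2 * δ ^ 2 / 2 + 680 * x ^ 3 * ε) * (Nt x + G x * (d + 2 * DD γ δ x)) := by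
  have hb : (1:ℝ) / 4 ≤ 1 / 2 := by norm_num
  have hb1 : (1:ℝ) / 2 ≤ 1 := by norm_num
  have hγ := h.g0
  have hε := h.e0
  have hδ := h.d0
  have hd0 : 0 ≤ d := by rw [hd]; positivity
  have hB := h.beh hx hlg
  have hχ : 0 ≤ 15000 * (x * γ) := by positivity
  have hD0 : 0 ≤ DD γ δ x := by have := CBE_pos; unfold DD; positivity
  set Y : Ω → ℝ := fun ω => ∑ i ∈ Finset.range n, (et ξ x i ω - mm P F ξ x i ω) with hYd
  have hY : Measurable Y := Finset.measurable_sum _ fun i _ =>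
    ((h.etm x i).mono (h.le _)).measurable.sub ((h.mmm i).mono (h.le _)).measurable
  have L := laplace (P := P) (M := MM P F ξ (1/2) x n) (Y := Y) (h.MM0 hb hb1 hx hlg) (h.MMi hb hb1 hx hlg) hY hx hd0 hD0
    (fun z => be_upper hB (by positivity) hδ hχ z) (fun z => be_lower hB (by positivity) hδ hχ z)
  set K := x * d + x ^ 2 * δ ^ 2 / 2 + 680 * x ^ 3 * ε with hK
  have qm : Measurable fun ω => Real.sqrt (QQ ξ n ω) := h.QQm.sqrt
  have hA : MeasurableSet {ω | x * Real.sqrt (QQ ξ n ω) ≤ SS ξ n ω ∧ |Real.sqrt (QQ ξ n ω) - 1| ≤ τ} :=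
    (measurableSet_le (qm.const_mul x) h.SSm).inter (measurableSet_le (qm.sub_const 1).abs measurable_const)
  have I := h.MMint hb hb1 hx hlg (f := fun ω => if 0 ≤ Y ω + d then Real.exp (-x * (Y ω + d)) else 0)
      (Measurable.ite (measurableSet_le measurable_const (hY.add_const d)) ((hY.add_const d).const_mul (-x)).exp measurable_const) (C := 1)
      (fun ω => by
        split_ifs with h1
        · rw [abs_of_pos (Real.exp_pos _)]
          exact Real.exp_le_one_iff.2 (by nlinarith)
        · norm_num)
  have R := real_le_int hA (I.const_mul (Real.exp (-(x^2)/2 + K))) ?_ ?_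
  · refine R.trans ?_
    rw [integral_const_mul]
    calc _ ≤ Real.exp (-(x^2)/2 + K) * (Real.exp (x ^ 2 / 2) * Nt x + d + 2 * DD γ δ x) := by gcongr
      _ = Real.exp K * ((Real.exp (-(x^2)/2) * Real.exp (x ^ 2 / 2)) * Nt x + Real.exp (-(x^2)/2) * (d + 2 * DD γ δ x)) := by
          rw [Real.exp_add]; ring
      _ = _ := by
          rw [← Real.exp_add, show -(x^2)/2 + x^2/2 = 0 by ring, Real.exp_zero, one_mul]; rfl
  · filter_upwards [h.MM0 hb hb1 hx hlg] with ω h1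
    apply mul_nonneg (Real.exp_pos _).le
    apply mul_nonneg h1
    split_ifs
    · exact (Real.exp_pos _).le
    · norm_num
  · filter_upwards [h.MM0 hb hb1 hx hlg, h.prod_le hb hb1 hx hlg, ae_all_iff.2 (h.mm_app hx hlg), h.tn, h.sn] with ω h1 h2 h3 h4 h5 ⟨a1, a2⟩
    set q := Real.sqrt (QQ ξ n ω) with hq
    have q2 : q ^ 2 = QQ ξ n ω := Real.sq_sqrt (QQ0 ξ n ω)
    change Real.exp (x * SS ξ n ω - 1/2 * x ^ 2 * QQ ξ n ω) ≤ MM P F ξ (1/2) x n ω * Real.exp _ at h2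
    rw [show ((1:ℝ)/2 - 1/2) = 0 by norm_num, zero_mul, zero_mul, zero_add] at h2
    have eE : ∑ i ∈ Finset.range n, et ξ x i ω = SS ξ n ω - x / 2 * QQ ξ n ω := by
      unfold SS QQ et
      rw [Finset.mul_sum, ← Finset.sum_sub_distrib]
      exact Finset.sum_congr rfl fun i _ => by ring
    set m := ∑ i ∈ Finset.range n, mm P F ξ x i ω with hm
    have eY : Y ω = SS ξ n ω - x / 2 * QQ ξ n ω - m := by
      simp only [hYd]; rw [Finset.sum_sub_distrib, eE]
    have m1 : |m - x / 2 * ∑ i ∈ Finset.range n, sg P F ξ i ω| ≤ 600 * x ^ 2 * ε := by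
      rw [hm, Finset.mul_sum, ← Finset.sum_sub_distrib]
      calc _ ≤ ∑ i ∈ Finset.range n, 600 * x ^ 2 * ta P F ξ i ω :=
            (Finset.abs_sum_le_sum_abs _ _).trans (Finset.sum_le_sum fun i _ => h3 i)
        _ = 600 * x ^ 2 * ∑ i ∈ Finset.range n, ta P F ξ i ω := by rw [Finset.mul_sum]
        _ ≤ _ := by gcongr
    set V := ∑ i ∈ Finset.range n, sg P F ξ i ω
    have m2 := abs_le.1 m1
    have v2 := abs_le.1 h5
    have m3 : |m - x / 2| ≤ x * δ ^ 2 / 2 + 600 * x ^ 2 * ε := by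
      rw [abs_le]; constructor <;> nlinarith
    have m4 := abs_le.1 m3
    have qq : (q - 1) ^ 2 ≤ τ ^ 2 := by rw [← sq_abs]; gcongr
    have s1 : x / 2 - x * τ ^ 2 / 2 ≤ SS ξ n ω - x / 2 * QQ ξ n ω := by
      rw [← q2]; nlinarith
    have hYd0 : 0 ≤ Y ω + d := by rw [eY, hd]; linarith
    rw [if_pos hYd0]
    set M := MM P F ξ (1/2) x n ω
    have e1 : 1 ≤ M * Real.exp (80 * x ^ 3 * ε) * Real.exp (-(x * SS ξ n ω - 1/2 * x ^ 2 * QQ ξ n ω)) := by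
      calc (1:ℝ) = Real.exp (x * SS ξ n ω - 1/2 * x ^ 2 * QQ ξ n ω) * Real.exp (-(x * SS ξ n ω - 1/2 * x ^ 2 * QQ ξ n ω)) := by
            rw [← Real.exp_add]; simp
        _ ≤ _ := by gcongr
    refine e1.trans ?_
    rw [mul_assoc, ← Real.exp_add, mul_left_comm, ← Real.exp_add]
    apply mul_le_mul_of_nonneg_left _ h1
    apply Real.exp_le_exp.2
    rw [eY, hK]
    have := mul_le_mul_of_nonneg_left m4.1 hx
    nlinarith

end Setup
end SN

namespace SN

variable {Ω : Type*} {m0 : MeasurableSpace Ω} {P : Measure Ω} [IsProbabilityMeasure P]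
  {F : ℕ → MeasurableSpace Ω} {n : ℕ} {ξ : ℕ → Ω → ℝ} {γ ε δ x τ θ : ℝ}

namespace Setup

lemma partB (h : Setup P F n ξ γ ε δ) (hx : 0 ≤ x) (hlg : x * γ ≤ 1 / 1000) (hθ : 0 < θ)
    (hτ : τ = 4 * θ ^ 2) (hτδ : 2 * δ ^ 2 ≤ τ) (hd : 170 * x * ε ≤ θ ^ 2) :
    P.real {ω | x * Real.sqrt (QQ ξ n ω) ≤ SS ξ n ω ∧ Real.sqrt (QQ ξ n ω) < 1 - τ} ≤
      Real.exp (-(x ^ 2 / 2 - x ^ 2 * δ ^ 2 / 2) + 80 * x ^ 3 * ε) * (40 * (ε / θ ^ 3)) := by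
  have qm : Measurable fun ω => Real.sqrt (QQ ξ n ω) := h.QQm.sqrt
  refine h.region (b := 1) (by norm_num) (by norm_num) hx hlg hθ hd
    ((measurableSet_le (qm.const_mul x) h.SSm).inter (measurableSet_lt qm measurable_const)) ?_
  filter_upwards [h.sn] with ω h5 ⟨a1, a2⟩
  change |CVr P F ξ n ω - 1| ≤ _ at h5
  set V := CVr P F ξ n ω
  simp only [Set.mem_ofPred_eq] at a1 a2
  set q := Real.sqrt (QQ ξ n ω) with hq
  have q0 : 0 ≤ q := Real.sqrt_nonneg _
  have q2 : q ^ 2 = QQ ξ n ω := Real.sq_sqrt (QQ0 ξ n ω)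
  have v2 := abs_le.1 h5
  have τ0 : 0 < τ := by rw [hτ]; positivity
  rw [← q2]
  have qq : q ^ 2 ≤ q := by nlinarith
  constructor
  · have h1 : x * (x * q) ≤ x * SS ξ n ω := by gcongr
    have h2 : x ^ 2 * q ^ 2 ≤ x ^ 2 * q := by gcongr
    have h3 : x ^ 2 * (1 - δ ^ 2) ≤ x ^ 2 * V := by
      apply mul_le_mul_of_nonneg_left _ (sq_nonneg x); linarith
    linarith
  · rw [abs_sub_comm]
    refine le_trans ?_ (le_abs_self _)
    linarith

lemma partCj (h : Setup P F n ξ γ ε δ) (hx : 0 ≤ x) (hlg : x * γ ≤ 1 / 1000) (hθ : 0 < θ)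
    (hτ : τ = 4 * θ ^ 2) (hτδ : 2 * δ ^ 2 ≤ τ) (hτ1 : τ ≤ 1) (hd : 170 * x * ε ≤ θ ^ 2) (j : ℕ) :
    P.real {ω | (x * Real.sqrt (QQ ξ n ω) ≤ SS ξ n ω ∧ 1 + τ < Real.sqrt (QQ ξ n ω)) ∧
      (3 ^ j ≤ Real.sqrt (QQ ξ n ω) ∧ Real.sqrt (QQ ξ n ω) ≤ 3 ^ (j + 1))} ≤
      Real.exp (-(x ^ 2 / 2 - x ^ 2 * δ ^ 2 / 2) + 80 * x ^ 3 * ε) * (40 * (ε / θ ^ 3)) * (1 / 27) ^ j := by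
  have qm : Measurable fun ω => Real.sqrt (QQ ξ n ω) := h.QQm.sqrt
  set a : ℝ := 3 ^ j with ha
  have a1 : 1 ≤ a := one_le_pow₀ (by norm_num)
  have hε := h.e0
  have lx : x / a ≤ x := div_le_self hx a1
  have l0 : 0 ≤ x / a := by positivity
  have R := h.region (b := 1/4) (l := x / a) (θ := a * θ) (κ := x ^ 2 / 2 - x ^ 2 * δ ^ 2 / 2)
    (A := {ω | (x * Real.sqrt (QQ ξ n ω) ≤ SS ξ n ω ∧ 1 + τ < Real.sqrt (QQ ξ n ω)) ∧
      (a ≤ Real.sqrt (QQ ξ n ω) ∧ Real.sqrt (QQ ξ n ω) ≤ 3 ^ (j + 1))}) (by norm_num) (by norm_num)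
    l0 ((mul_le_mul_of_nonneg_right lx h.g0.le).trans hlg) (by positivity)
    (by
      calc 170 * (x / a) * ε ≤ 170 * x * ε := by gcongr
        _ ≤ θ ^ 2 := hd
        _ ≤ a ^ 2 * θ ^ 2 := le_mul_of_one_le_left (by positivity) (one_le_pow₀ a1)
        _ = _ := by ring)
    (((measurableSet_le (qm.const_mul x) h.SSm).inter (measurableSet_lt measurable_const qm)).inter
      ((measurableSet_le (measurable_const (a := a)) qm).inter (measurableSet_le qm (measurable_const (a := (3:ℝ) ^ (j+1)))))) ?_
  · refine R.trans ?_
    have e : ε / (a * θ) ^ 3 = (ε / θ ^ 3) * (1 / 27) ^ j := by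
      rw [mul_pow, ha, ← pow_mul, mul_comm j 3, pow_mul, one_div, inv_pow]
      norm_num
      field_simp
    rw [e]
    have : Real.exp (-(x ^ 2 / 2 - x ^ 2 * δ ^ 2 / 2) + 80 * (x / a) ^ 3 * ε) ≤ Real.exp (-(x ^ 2 / 2 - x ^ 2 * δ ^ 2 / 2) + 80 * x ^ 3 * ε) := by
      gcongr
    calc _ ≤ Real.exp (-(x ^ 2 / 2 - x ^ 2 * δ ^ 2 / 2) + 80 * x ^ 3 * ε) * (40 * ((ε / θ ^ 3) * (1 / 27) ^ j)) := by gcongr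
      _ = _ := by ring
  filter_upwards [h.sn] with ω h5 ⟨⟨b1, b2⟩, ⟨b3, b4⟩⟩
  change |CVr P F ξ n ω - 1| ≤ _ at h5
  set V := CVr P F ξ n ω
  set q := Real.sqrt (QQ ξ n ω) with hq
  have q0 : 0 ≤ q := Real.sqrt_nonneg _
  have q2 : q ^ 2 = QQ ξ n ω := Real.sq_sqrt (QQ0 ξ n ω)
  have v2 := abs_le.1 h5
  have τ0 : 0 < τ := by rw [hτ]; positivity
  have b4' : q ≤ 3 * a := by rw [ha]; rw [pow_succ] at b4; linarith
  rw [← q2]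
  have ap : 0 < a := by linarith
  constructor
  · set r := q / a with hr
    have r1 : 1 ≤ r := by rw [hr, le_div_iff₀ ap]; linarith
    have r3 : r ≤ 3 := by rw [hr, div_le_iff₀ ap]; linarith
    have h1 : x ^ 2 * r ≤ x / a * SS ξ n ω := by
      calc _ = x / a * (x * q) := by rw [hr]; ring
        _ ≤ _ := by gcongr
    have h2 : (x / a) ^ 2 * q ^ 2 = x ^ 2 * r ^ 2 := by rw [hr]; ring
    have h3 : (x / a) ^ 2 * V ≤ x ^ 2 * (1 + δ ^ 2) := by
      have : 0 ≤ 1 + δ ^ 2 := by positivity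
      calc _ ≤ (x / a) ^ 2 * (1 + δ ^ 2) := by
            apply mul_le_mul_of_nonneg_left _ (sq_nonneg _); linarith
        _ ≤ _ := by gcongr
    have h4 : x ^ 2 * (3 / 4) ≤ x ^ 2 * (r - r ^ 2 / 4) := by
      apply mul_le_mul_of_nonneg_left _ (sq_nonneg x); nlinarith
    have h6 : 0 ≤ x ^ 2 * δ ^ 2 := by positivity
    have e : x / a * SS ξ n ω - 1 / 4 * (x / a) ^ 2 * q ^ 2 - (1 / 2 - 1 / 4) * (x / a) ^ 2 * V =
      x / a * SS ξ n ω - 1 / 4 * ((x / a) ^ 2 * q ^ 2) - 1 / 4 * ((x / a) ^ 2 * V) := by ring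
    rw [e, h2]
    linarith
  · refine le_trans ?_ (le_abs_self _)
    have e : 2 * (a * θ) ^ 2 = a ^ 2 * τ / 2 := by rw [hτ]; ring
    rw [e]
    rcases Nat.eq_zero_or_pos j with h0 | h0
    · have : a = 1 := by rw [ha, h0]; simp
      rw [this]; nlinarith
    · have a3 : 3 ≤ a := by
        calc (3:ℝ) = 3 ^ 1 := by norm_num
          _ ≤ _ := pow_le_pow_right₀ (by norm_num) h0
      have : a ^ 2 ≤ q ^ 2 := by gcongr
      have : a ^ 2 * τ ≤ a ^ 2 := mul_le_of_le_one_right (by positivity) hτ1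
      nlinarith

lemma partC (h : Setup P F n ξ γ ε δ) (hx : 0 ≤ x) (hlg : x * γ ≤ 1 / 1000) (hθ : 0 < θ)
    (hτ : τ = 4 * θ ^ 2) (hτδ : 2 * δ ^ 2 ≤ τ) (hτ1 : τ ≤ 1) (hd : 170 * x * ε ≤ θ ^ 2) :
    P.real {ω | x * Real.sqrt (QQ ξ n ω) ≤ SS ξ n ω ∧ 1 + τ < Real.sqrt (QQ ξ n ω)} ≤
      Real.exp (-(x ^ 2 / 2 - x ^ 2 * δ ^ 2 / 2) + 80 * x ^ 3 * ε) * (80 * (ε / θ ^ 3)) := by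
  have hε := h.e0
  set C := Real.exp (-(x ^ 2 / 2 - x ^ 2 * δ ^ 2 / 2) + 80 * x ^ 3 * ε) * (40 * (ε / θ ^ 3)) with hC
  have C0 : 0 ≤ C := by positivity
  have e : Real.exp (-(x ^ 2 / 2 - x ^ 2 * δ ^ 2 / 2) + 80 * x ^ 3 * ε) * (80 * (ε / θ ^ 3)) = 2 * C := by rw [hC]; ring
  rw [e]
  have τ0 : 0 < τ := by rw [hτ]; positivity
  set A : ℕ → Set Ω := fun j => {ω | (x * Real.sqrt (QQ ξ n ω) ≤ SS ξ n ω ∧ 1 + τ < Real.sqrt (QQ ξ n ω)) ∧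
      (3 ^ j ≤ Real.sqrt (QQ ξ n ω) ∧ Real.sqrt (QQ ξ n ω) ≤ 3 ^ (j + 1))} with hA
  have sub : {ω | x * Real.sqrt (QQ ξ n ω) ≤ SS ξ n ω ∧ 1 + τ < Real.sqrt (QQ ξ n ω)} ⊆ ⋃ j, A j := by
    intro ω hω
    obtain ⟨k, k1, k2⟩ := exists_nat_pow_near (x := Real.sqrt (QQ ξ n ω)) (y := 3) (by linarith [hω.2]) (by norm_num)
    exact Set.mem_iUnion.2 ⟨k, hω, k1, k2.le⟩
  have hs : HasSum (fun j : ℕ => C * (1 / 27 : ℝ) ^ j) (C * (1 - 1/27)⁻¹) :=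
    (hasSum_geometric_of_lt_one (by norm_num) (by norm_num)).mul_left C
  have le : P {ω | x * Real.sqrt (QQ ξ n ω) ≤ SS ξ n ω ∧ 1 + τ < Real.sqrt (QQ ξ n ω)} ≤ ENNReal.ofReal (2 * C) := by
    calc _ ≤ P (⋃ j, A j) := measure_mono sub
      _ ≤ ∑' j, P (A j) := measure_iUnion_le _
      _ ≤ ∑' j, ENNReal.ofReal (C * (1 / 27 : ℝ) ^ j) := by
          apply ENNReal.tsum_le_tsum
          intro j
          rw [← ofReal_measureReal]
          exact ENNReal.ofReal_le_ofReal (h.partCj hx hlg hθ hτ hτδ hτ1 hd j)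
      _ = ENNReal.ofReal (C * (1 - 1/27)⁻¹) := by
          rw [← ENNReal.ofReal_tsum_of_nonneg (fun j => by positivity) hs.summable, hs.tsum_eq]
      _ ≤ _ := ENNReal.ofReal_le_ofReal (by norm_num; linarith)
  exact ENNReal.toReal_le_of_le_ofReal (by linarith) le

/-- assembly -/
lemma total (h : Setup P F n ξ γ ε δ) (hx : 0 ≤ x) (hlg : x * γ ≤ 1 / 1000) (hθ : 0 < θ)
    (hτ : τ = 4 * θ ^ 2) (hτδ : 2 * δ ^ 2 ≤ τ) (hτ1 : τ ≤ 1) (hd : 170 * x * ε ≤ θ ^ 2) {d : ℝ}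
    (hdd : d = x * τ ^ 2 / 2 + x * δ ^ 2 / 2 + 600 * x ^ 2 * ε) :
    P.real {ω | x * Real.sqrt (QQ ξ n ω) ≤ SS ξ n ω} ≤
      Real.exp (x * d + x ^ 2 * δ ^ 2 / 2 + 680 * x ^ 3 * ε + 15 * (1 + x) * (d + 2 * DD γ δ x + 120 * (ε / θ ^ 3))) * Nt x := by
  have τ0 : 0 < τ := by rw [hτ]; positivity
  have hε := h.e0
  have hγ := h.g0
  have hδ := h.d0
  have hd0 : 0 ≤ d := by rw [hdd]; positivity
  have hD0 : 0 ≤ DD γ δ x := by have := CBE_pos; unfold DD; positivity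
  have pA := h.partA hx hlg τ0.le hdd
  have pB := h.partB hx hlg hθ hτ hτδ hd
  have pC := h.partC hx hlg hθ hτ hτδ hτ1 hd
  set K := x * d + x ^ 2 * δ ^ 2 / 2 + 680 * x ^ 3 * ε with hK
  have hK' : Real.exp (-(x ^ 2 / 2 - x ^ 2 * δ ^ 2 / 2) + 80 * x ^ 3 * ε) ≤ Real.exp K * G x := by
    rw [G, ← Real.exp_add]
    apply Real.exp_le_exp.2
    have : 0 ≤ x * d := by positivity
    have : 0 ≤ x ^ 3 * ε := by positivity
    rw [hK]; linarith
  have sub : {ω | x * Real.sqrt (QQ ξ n ω) ≤ SS ξ n ω} ⊆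
      ({ω | x * Real.sqrt (QQ ξ n ω) ≤ SS ξ n ω ∧ |Real.sqrt (QQ ξ n ω) - 1| ≤ τ} ∪
      {ω | x * Real.sqrt (QQ ξ n ω) ≤ SS ξ n ω ∧ Real.sqrt (QQ ξ n ω) < 1 - τ}) ∪
      {ω | x * Real.sqrt (QQ ξ n ω) ≤ SS ξ n ω ∧ 1 + τ < Real.sqrt (QQ ξ n ω)} := by
    intro ω hω
    by_cases h1 : Real.sqrt (QQ ξ n ω) < 1 - τ
    · exact Or.inl (Or.inr ⟨hω, h1⟩)
    by_cases h2 : 1 + τ < Real.sqrt (QQ ξ n ω)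
    · exact Or.inr ⟨hω, h2⟩
    · refine Or.inl (Or.inl ⟨hω, ?_⟩)
      rw [abs_le]; constructor <;> linarith
  have tot := (measureReal_mono (μ := P) sub).trans ((measureReal_union_le _ _).trans (add_le_add_left (measureReal_union_le _ _) _))
  have hH : 0 ≤ ε / θ ^ 3 := by positivity
  have G0 := G_pos x
  have N0 := Nt_nonneg x
  set H := ε / θ ^ 3
  have t2 : Real.exp (-(x ^ 2 / 2 - x ^ 2 * δ ^ 2 / 2) + 80 * x ^ 3 * ε) * (120 * H) ≤ Real.exp K * G x * (120 * H) := by gcongr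
  have E0 := Real.exp_pos K
  calc _ ≤ Real.exp K * (Nt x + G x * (d + 2 * DD γ δ x + 120 * H)) := by nlinarith
    _ ≤ Real.exp K * (Nt x + (15 * (1 + x) * Nt x) * (d + 2 * DD γ δ x + 120 * H)) := by
        have := mills hx
        gcongr
    _ = Real.exp K * (15 * (1 + x) * (d + 2 * DD γ δ x + 120 * H) + 1) * Nt x := by ring
    _ ≤ Real.exp K * Real.exp (15 * (1 + x) * (d + 2 * DD γ δ x + 120 * H)) * Nt x := by
        gcongr
        exact Real.add_one_le_exp _
    _ = _ := by rw [← Real.exp_add]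

end Setup
end SN

namespace SN

lemma ar_low {w p : ℝ} (hw : 0 ≤ w) (hp : 0 < p) : p / 2 ≤ (1 + w ^ 4) * (p / (1 + w ^ 3)) := by
  rw [← mul_div_assoc, le_div_iff₀ (by positivity)]
  have : w ^ 3 ≤ 1 + w ^ 4 * 2 := by
    rcases le_total w 1 with h | h
    · have : w ^ 3 ≤ 1 := pow_le_one₀ hw h
      have : 0 ≤ w ^ 4 := by positivity
      linarith
    · have h2 : w ^ 3 * 1 ≤ w ^ 3 * w := by gcongr
      have h3 : w ^ 4 = w ^ 3 * w := by ring
      have : 0 ≤ w ^ 3 := by positivity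
      rw [h3]; linarith
  nlinarith

lemma ar_low2 {w p : ℝ} (hw : 1 ≤ w) (hp : 0 < p) : w * p / 2 ≤ (1 + w ^ 4) * (p / (1 + w ^ 3)) := by
  rw [← mul_div_assoc, le_div_iff₀ (by positivity)]
  have : w * (1 + w ^ 3) ≤ 2 * (1 + w ^ 4) := by
    have : w * 1 ≤ w * w ^ 3 := by gcongr; exact one_le_pow₀ hw
    nlinarith
  nlinarith

section
variable {w p t : ℝ}

lemma ar_w3 (hw : 0 ≤ w) (hp : 0 < p) (ht : 0 < t) (h : t ^ 4 = w ^ 12 * p ^ 4 + (1 + w ^ 4) * (p / (1 + w ^ 3))) :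
    w ^ 3 * p ≤ t := by
  have h1 : (w ^ 3 * p) ^ 4 ≤ t ^ 4 := by
    have : 0 ≤ (1 + w ^ 4) * (p / (1 + w ^ 3)) := by positivity
    calc _ = w ^ 12 * p ^ 4 := by ring
      _ ≤ _ := by linarith
  exact le_of_pow_le_pow_left₀ (by norm_num) ht.le h1

/-- drift is below the threshold -/
lemma ar_drift (hw : 0 ≤ w) (hp : 0 < p) (hp1 : p ≤ 1) (ht : 0 < t) (h : t ^ 4 = w ^ 12 * p ^ 4 + (1 + w ^ 4) * (p / (1 + w ^ 3)))
    (hs : t ^ 2 * 4000 ≤ 1 + w ^ 4) : w ^ 4 * (1 + w ^ 4) * p ^ 4 ≤ 4 * t ^ 2 := by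
  have h0 := ar_w3 hw hp ht h
  have h1 := ar_low hw hp
  have h2 : 0 ≤ w ^ 12 * p ^ 4 := by positivity
  rcases le_total w 1 with hw1 | hw1
  · have a1 : w ^ 4 ≤ 1 := pow_le_one₀ hw hw1
    have a2 : p ^ 4 ≤ p ^ 2 := pow_le_pow_of_le_one hp.le hp1 (by norm_num)
    have a4 : t ^ 4 ≤ t ^ 2 := by
      have : t ^ 2 ≤ 1 := by linarith
      nlinarith [sq_nonneg t]
    have a3 : p ^ 2 ≤ p := by nlinarith
    calc _ ≤ 1 * (1 + 1) * p ^ 4 := by gcongr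
      _ ≤ 4 * t ^ 2 := by linarith
  · have hwp : w * p ≤ 1 := by
      have b1 : (w ^ 3 * p) ^ 2 ≤ t ^ 2 := by gcongr
      have b2 : 1 ≤ w ^ 4 := one_le_pow₀ hw1
      have b3 : w ^ 4 * (w * p) ^ 2 ≤ w ^ 4 * 1 := by
        calc _ = (w ^ 3 * p) ^ 2 := by ring
          _ ≤ _ := by linarith
      have b4 : (w * p) ^ 2 ≤ 1 := le_of_mul_le_mul_left b3 (by positivity)
      exact (sq_le_one_iff₀ (by positivity)).1 b4
    have b2 : 1 ≤ w ^ 4 := one_le_pow₀ hw1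
    calc w ^ 4 * (1 + w ^ 4) * p ^ 4 ≤ w ^ 4 * (w ^ 4 + w ^ 4) * p ^ 4 := by gcongr
      _ = 2 * ((w ^ 3 * p) ^ 2 * (w * p) ^ 2) := by ring
      _ ≤ 2 * (t ^ 2 * 1 ^ 2) := by gcongr
      _ ≤ _ := by nlinarith [sq_nonneg t]

lemma ar_main (hw : 0 ≤ w) (hp : 0 < p) (hp1 : p ≤ 1) (ht : 0 < t) (h : t ^ 4 = w ^ 12 * p ^ 4 + (1 + w ^ 4) * (p / (1 + w ^ 3)))
    (hs : t ^ 2 * 4000 ≤ 1 + w ^ 4) {s : ℝ} (hs0 : 0 ≤ s) (hss : s ^ 2 = 1 + w ^ 4) : s ^ 5 * p ^ 4 ≤ 512 * t ^ 7 := by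
  have h0 := ar_w3 hw hp ht h
  have h1 := ar_low hw hp
  have h2 : 0 ≤ w ^ 12 * p ^ 4 := by positivity
  have h3 : 0 ≤ (1 + w ^ 4) * (p / (1 + w ^ 3)) := by positivity
  rcases le_total w 1 with hw1 | hw1
  · have a1 : w ^ 4 ≤ 1 := pow_le_one₀ hw hw1
    have s2 : s ≤ 2 := by nlinarith
    have t1 : t ≤ 1 := by nlinarith
    have p1 : p ≤ 2 * t ^ 4 := by linarith
    calc s ^ 5 * p ^ 4 ≤ 2 ^ 5 * (2 * t ^ 4) ^ 4 := by gcongr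
      _ = 512 * t ^ 16 := by ring
      _ ≤ _ := by gcongr ?_ * ?_; exact pow_le_pow_of_le_one ht.le t1 (by norm_num)
  · have b2 : 1 ≤ w ^ 4 := one_le_pow₀ hw1
    have s2 : s ≤ 2 * w ^ 2 := by
      apply le_of_pow_le_pow_left₀ (n := 2) (by norm_num) (by positivity)
      rw [hss]; nlinarith
    have p1 : w * p ≤ 2 * t ^ 4 := by have := ar_low2 hw1 hp; linarith
    calc s ^ 5 * p ^ 4 ≤ (2 * w ^ 2) ^ 5 * p ^ 4 := by gcongr
      _ = 32 * ((w ^ 3 * p) ^ 3 * (w * p)) := by ring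
      _ ≤ 32 * (t ^ 3 * (2 * t ^ 4)) := by gcongr
      _ ≤ _ := by have : 0 < t ^ 7 := by positivity
                  nlinarith
end

lemma ar_gamma {γ : ℝ} (h0 : 0 < γ) (h1 : γ ≤ 1 / 4) :
    (60000 * γ) * (1 + |Real.log (60000 * γ)|) ≤ 840000 * (γ * |Real.log γ|) := by
  have l1 : 1 ≤ |Real.log γ| := by
    have : Real.log γ ≤ -1 := by
      rw [Real.log_le_iff_le_exp h0]
      refine h1.trans ?_
      have := Real.exp_one_lt_d9
      rw [Real.exp_neg, one_div]
      apply inv_anti₀ (Real.exp_pos _)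
      linarith
    rw [abs_of_neg (by linarith)]; linarith
  have l2 : Real.log 60000 ≤ 12 := by
    rw [Real.log_le_iff_le_exp (by norm_num)]
    have e : Real.exp 12 = Real.exp 1 ^ 12 := by rw [← Real.exp_nat_mul]; norm_num
    rw [e]
    have := Real.exp_one_gt_d9
    calc (60000:ℝ) ≤ 2.7182818283 ^ 12 := by norm_num
      _ ≤ _ := by gcongr
  have l3 : 0 ≤ Real.log 60000 := Real.log_nonneg (by norm_num)
  rw [Real.log_mul (by norm_num) h0.ne']
  have := abs_add_le (Real.log 60000) (Real.log γ)
  rw [abs_of_nonneg l3] at this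
  have : 1 + |Real.log 60000 + Real.log γ| ≤ 14 * |Real.log γ| := by linarith
  calc _ ≤ 60000 * γ * (14 * |Real.log γ|) := by gcongr
    _ = _ := by ring

end SN

namespace SN

variable {Ω : Type*} {m0 : MeasurableSpace Ω} {P : Measure Ω} [IsProbabilityMeasure P]
  {F : ℕ → MeasurableSpace Ω} {n : ℕ} {ξ : ℕ → Ω → ℝ} {γ ε δ x τ θ : ℝ}

noncomputable def RR (x γ ε δ : ℝ) : ℝ :=
  x ^ 3 * ε + x ^ 2 * δ ^ 2 + (1 + x) * (x * γ + γ * |Real.log γ| + δ + ε ^ ((1 : ℝ) / 4) / (1 + x ^ ((3 : ℝ) / 4)))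

noncomputable def CF : ℝ := 200000000 + 30000000 * CBE

lemma CF_pos : 0 < CF := by have := CBE_pos; unfold CF; positivity

lemma triv_case (hx : 0 ≤ x) : 1 ≤ Real.exp (3 * (1 + x) ^ 2) * Nt x := by
  have h := mills hx
  have h1 : 15 * (1 + x) ≤ Real.exp (3 + x) := by
    rw [Real.exp_add]
    have e : Real.exp 3 = Real.exp 1 ^ 3 := by rw [← Real.exp_nat_mul]; norm_num
    have h3 : 15 ≤ Real.exp 3 := by
      rw [e]
      have := Real.exp_one_gt_d9
      calc (15:ℝ) ≤ 2.7182818283 ^ 3 := by norm_num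
        _ ≤ _ := by gcongr
    have := Real.add_one_le_exp x
    calc _ ≤ Real.exp 3 * (1 + x) := by gcongr
      _ ≤ _ := by gcongr; linarith
  have N0 := Nt_nonneg x
  have e1 : 1 = Real.exp (x ^ 2 / 2) * G x := by rw [G, ← Real.exp_add]; ring_nf; simp
  calc (1:ℝ) = Real.exp (x ^ 2 / 2) * G x := e1
    _ ≤ Real.exp (x ^ 2 / 2) * (15 * (1 + x) * Nt x) := by gcongr
    _ ≤ Real.exp (x ^ 2 / 2) * (Real.exp (3 + x) * Nt x) := by gcongr
    _ = Real.exp (x ^ 2 / 2 + (3 + x)) * Nt x := by rw [Real.exp_add (x ^ 2 / 2) (3 + x)]; ring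
    _ ≤ _ := by
      gcongr
      nlinarith

set_option maxHeartbeats 1000000 in
lemma Setup.final (h : Setup P F n ξ γ ε δ) (hx : 0 ≤ x) (hlg : x * γ ≤ 1 / 1000) :
    P.real {ω | x * Real.sqrt (QQ ξ n ω) ≤ SS ξ n ω} ≤ Real.exp (CF * RR x γ ε δ) * Nt x := by
  have hε := h.e0
  have hγ := h.g0
  have hδ := h.d0
  have hB := CBE_pos
  have N0 := Nt_nonneg x
  have hL := abs_nonneg (Real.log γ)
  set p := ε ^ ((1 : ℝ) / 4) with hp
  set w := x ^ ((1 : ℝ) / 4) with hw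
  have p0 : 0 < p := Real.rpow_pos_of_pos hε _
  have w0 : 0 ≤ w := Real.rpow_nonneg hx _
  have p4 : p ^ 4 = ε := by rw [hp, ← Real.rpow_natCast, ← Real.rpow_mul hε.le]; norm_num
  have w4 : w ^ 4 = x := by rw [hw, ← Real.rpow_natCast, ← Real.rpow_mul hx]; norm_num
  have w3 : x ^ ((3 : ℝ) / 4) = w ^ 3 := by rw [hw, ← Real.rpow_natCast, ← Real.rpow_mul hx]; norm_num
  have p1 : p ≤ 1 := Real.rpow_le_one hε.le (by linarith [h.e1]) (by norm_num)
  have R0p : 0 < w ^ 12 * p ^ 4 + (1 + w ^ 4) * (p / (1 + w ^ 3)) := by positivity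
  obtain ⟨t, t0, ht⟩ : ∃ t : ℝ, 0 < t ∧ t ^ 4 = w ^ 12 * p ^ 4 + (1 + w ^ 4) * (p / (1 + w ^ 3)) := by
    refine ⟨(w ^ 12 * p ^ 4 + (1 + w ^ 4) * (p / (1 + w ^ 3))) ^ ((1:ℝ)/4), Real.rpow_pos_of_pos R0p _, ?_⟩
    rw [← Real.rpow_natCast, ← Real.rpow_mul R0p.le]; norm_num
  have w12 : w ^ 12 = x ^ 3 := by rw [← w4]; ring
  have ht' : t ^ 4 = x ^ 3 * ε + (1 + x) * (p / (1 + w ^ 3)) := by rw [ht, w12, w4, p4]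
  have eR : RR x γ ε δ = t ^ 4 + x ^ 2 * δ ^ 2 + (1 + x) * (x * γ + γ * |Real.log γ| + δ) := by
    rw [RR, w3, ht']; ring
  have z1 : 0 ≤ x ^ 2 * δ ^ 2 := by positivity
  have z2 : 0 ≤ (1 + x) * (x * γ) := by positivity
  have z3 : 0 ≤ (1 + x) * (γ * |Real.log γ|) := by positivity
  have z4 : 0 ≤ (1 + x) * δ := by positivity
  have z5 : 0 < t ^ 4 := by positivity
  have eR2 : RR x γ ε δ = t ^ 4 + x ^ 2 * δ ^ 2 + (1 + x) * (x * γ) + (1 + x) * (γ * |Real.log γ|) + (1 + x) * δ := by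
    rw [eR]; ring
  set R := RR x γ ε δ
  by_cases hs : t ^ 2 * 4000 ≤ 1 + x
  swap
  · push Not at hs
    have h1 : (1 + x) ^ 2 ≤ t ^ 4 * 16000000 := by
      calc (1 + x) ^ 2 ≤ (t ^ 2 * 4000) ^ 2 := by gcongr
        _ = _ := by ring
    refine (measureReal_le_one).trans ((triv_case hx).trans ?_)
    apply mul_le_mul_of_nonneg_right _ N0
    apply Real.exp_le_exp.2
    have : 200000000 * R ≤ CF * R := by
      have : 0 ≤ R := by linarith
      gcongr
      unfold CF; linarith
    linarith
  have hs' : t ^ 2 * 4000 ≤ 1 + w ^ 4 := by rw [w4]; exact hs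
  have drift := ar_drift w0 p0 p1 t0 ht hs'
  rw [w4, p4] at drift
  have xp : 0 < 1 + x := by linarith
  set s := Real.sqrt (1 + x) with hsd
  have s0 : 0 < s := Real.sqrt_pos.2 xp
  have s2 : s ^ 2 = 1 + x := Real.sq_sqrt xp.le
  have main := ar_main w0 p0 p1 t0 ht hs' s0.le (by rw [s2, w4])
  rw [p4] at main
  set τ := 2 * δ ^ 2 + 2720 * (t ^ 2 / (1 + x)) with hτ
  have τ0 : 0 < τ := by positivity
  set θ := Real.sqrt τ / 2 with hθ
  have θ0 : 0 < θ := by have := Real.sqrt_pos.2 τ0; positivity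
  have θ2 : τ = 4 * θ ^ 2 := by rw [hθ, div_pow, Real.sq_sqrt τ0.le]; ring
  have u1 : t ^ 2 / (1 + x) ≤ 1 / 4000 := by rw [div_le_iff₀ xp]; linarith
  have u0 : 0 ≤ t ^ 2 / (1 + x) := by positivity
  have dd : δ ^ 2 ≤ 1 / 16 := by nlinarith [h.d1]
  have T := h.total hx hlg θ0 θ2 (by rw [hτ]; linarith) (by rw [hτ]; linarith) (by
    have : x * ε ≤ 4 * (t ^ 2 / (1 + x)) := by
      rw [← mul_div_assoc, le_div_iff₀ xp]; linarith
    have : 0 ≤ δ ^ 2 := sq_nonneg _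
    linarith) rfl
  refine T.trans ?_
  apply mul_le_mul_of_nonneg_right _ N0
  apply Real.exp_le_exp.2
  set d := x * τ ^ 2 / 2 + x * δ ^ 2 / 2 + 600 * x ^ 2 * ε with hd
  -- bound of d
  have xd2 : (1 + x) * (x * δ ^ 2) ≤ R := by
    have : x * δ ^ 2 ≤ x * δ := by
      gcongr; nlinarith [h.d1]
    nlinarith
  have xt2 : (1 + x) * (x * τ ^ 2 / 2) ≤ 4 * R + 7398400 * R := by
    have a1 : τ ^ 2 ≤ 8 * (δ ^ 2 * δ ^ 2) + 14796800 * (t ^ 2 / (1 + x)) ^ 2 := by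
      rw [hτ]; nlinarith [sq_nonneg (2 * δ ^ 2 - 2720 * (t ^ 2 / (1 + x)))]
    have a2 : δ ^ 2 * δ ^ 2 ≤ δ ^ 2 * 1 := by gcongr; linarith
    have a3 : (1 + x) * (x * (t ^ 2 / (1 + x)) ^ 2) ≤ t ^ 4 := by
      calc _ ≤ (1 + x) * ((1 + x) * (t ^ 2 / (1 + x)) ^ 2) := by gcongr; linarith
        _ = t ^ 4 := by field_simp
    calc (1 + x) * (x * τ ^ 2 / 2) ≤ (1 + x) * (x * (8 * (δ ^ 2 * 1) + 14796800 * (t ^ 2 / (1 + x)) ^ 2) / 2) := by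
          gcongr; linarith
      _ = 4 * ((1 + x) * (x * δ ^ 2)) + 7398400 * ((1 + x) * (x * (t ^ 2 / (1 + x)) ^ 2)) := by ring
      _ ≤ _ := by linarith
  have x2e : (1 + x) * (x ^ 2 * ε) ≤ 4 * R := by
    have a1 := ar_low w0 p0
    have a2 : ε ≤ p := by rw [← p4]; exact pow_le_of_le_one p0.le p1 (by norm_num)
    have a3 : 0 ≤ x ^ 3 * ε := by positivity
    have a4 : x ^ 2 * ε ≤ (1 + x ^ 3) * ε := by
      gcongr
      rcases le_total x 1 with h1 | h1
      · have : x ^ 2 ≤ 1 := pow_le_one₀ hx h1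
        have : 0 ≤ x ^ 3 := by positivity
        linarith
      · have : x ^ 2 ≤ x ^ 3 := pow_le_pow_right₀ h1 (by norm_num)
        linarith
    rw [w4] at a1
    have e : (1 + x) * (x ^ 2 * ε) = x ^ 2 * ε + x ^ 3 * ε := by ring
    rw [e]
    linarith
  have bd : (1 + x) * d ≤ 7500000 * R := by
    have e : (1 + x) * d = (1 + x) * (x * τ ^ 2 / 2) + (1 + x) * (x * δ ^ 2) / 2 + 600 * ((1 + x) * (x ^ 2 * ε)) := by
      rw [hd]; ring
    rw [e]; linarith
  have d0 : 0 ≤ d := by positivity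
  have bxd : x * d ≤ (1 + x) * d := by linarith
  -- bound of DD
  have bDD : (1 + x) * DD γ δ x ≤ 840000 * CBE * R := by
    have := ar_gamma hγ h.g1
    unfold DD
    have hxg : 0 ≤ x * γ := by positivity
    have hgl : 0 ≤ γ * |Real.log γ| := by positivity
    calc _ ≤ (1 + x) * (CBE * (840000 * δ + 840000 * (γ * |Real.log γ|) + 840000 * (x * γ))) := by
          gcongr <;> linarith
      _ = 840000 * CBE * ((1 + x) * (x * γ) + (1 + x) * (γ * |Real.log γ|) + (1 + x) * δ) := by ring
      _ ≤ _ := by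
        gcongr
        linarith
  -- bound of H
  have bH : (1 + x) * (ε / θ ^ 3) ≤ 512 * R := by
    have a1 : t / s ≤ θ := by
      apply le_of_pow_le_pow_left₀ (n := 2) (by norm_num) θ0.le
      rw [div_pow, s2]
      have := sq_nonneg δ
      linarith
    calc (1 + x) * (ε / θ ^ 3) ≤ (1 + x) * (ε / (t / s) ^ 3) := by gcongr
      _ = s ^ 5 * ε / t ^ 3 := by rw [← s2]; field_simp
      _ ≤ 512 * t ^ 7 / t ^ 3 := by gcongr
      _ = 512 * t ^ 4 := by field_simp
      _ ≤ _ := by linarith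
  have x3 : x ^ 3 * ε ≤ R := by
    have : 0 ≤ (1 + x) * (p / (1 + w ^ 3)) := by positivity
    linarith
  have e : x * d + x ^ 2 * δ ^ 2 / 2 + 680 * x ^ 3 * ε + 15 * (1 + x) * (d + 2 * DD γ δ x + 120 * (ε / θ ^ 3)) =
    x * d + x ^ 2 * δ ^ 2 / 2 + 680 * (x ^ 3 * ε) + 15 * ((1 + x) * d) + 30 * ((1 + x) * DD γ δ x) + 1800 * ((1 + x) * (ε / θ ^ 3)) := by ring
  rw [e]
  have R0 : 0 ≤ R := by linarith
  have e2 : CF * R = 200000000 * R + 30000000 * (CBE * R) := by unfold CF; ring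
  have : 0 ≤ CBE * R := by positivity
  rw [e2]
  linarith

end SN

namespace SN

noncomputable def XI {Ω : Type} [MeasurableSpace Ω] {P : Measure Ω} (A : MDS Ω P) (k : ℕ) : Ω → ℝ :=
  if k < A.n then fun ω => (Real.sqrt A.Bsq)⁻¹ * A.X (k + 1) ω else 0

section
variable {Ω : Type} [MeasurableSpace Ω] {P : Measure Ω} [IsProbabilityMeasure P]

lemma shift (n : ℕ) (f : ℕ → ℝ) : ∑ i ∈ Finset.Icc 1 n, f i = ∑ i ∈ Finset.range n, f (i + 1) := by
  rw [Finset.range_eq_Ico, Finset.sum_Ico_add' f 0 n 1]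
  rfl

lemma Bsq_pos (A : MDS Ω P) : 0 < A.Bsq := by
  unfold MDS.Bsq
  apply Finset.sum_pos
  · intro i hi
    rw [Finset.mem_Icc] at hi
    exact A.var_pos i hi.1 hi.2
  · exact ⟨1, Finset.mem_Icc.2 ⟨le_rfl, A.npos⟩⟩

lemma XI_lt (A : MDS Ω P) {k : ℕ} (hk : k < A.n) :
    XI A k = fun ω => (Real.sqrt A.Bsq)⁻¹ * A.X (k + 1) ω := by simp [XI, hk]
lemma XI_ge (A : MDS Ω P) {k : ℕ} (hk : ¬ k < A.n) : XI A k = 0 := by simp [XI, hk]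

lemma XI_sg (A : MDS Ω P) {k : ℕ} (hk : k < A.n) :
    ∀ᵐ ω ∂P, sg P A.F (XI A) k ω = (A.Bsq)⁻¹ * (P[fun ω' => (A.X (k+1) ω') ^ 2|A.F k]) ω := by
  have hB := Bsq_pos A
  have e : (fun ω => XI A k ω ^ 2) = (A.Bsq)⁻¹ • (fun ω' => (A.X (k+1) ω') ^ 2) := by
    funext ω
    rw [XI_lt A hk]
    simp only [Pi.smul_apply, smul_eq_mul]
    rw [mul_pow, inv_pow, Real.sq_sqrt hB.le]
  have := condExp_smul (μ := P) (A.Bsq)⁻¹ (fun ω' => (A.X (k+1) ω') ^ 2) (A.F k)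
  unfold sg
  rw [e]
  filter_upwards [this] with ω hω
  rw [hω]; simp

lemma rp3 (a : ℝ) : |a| ^ ((2:ℝ) + 1) = |a| ^ 3 := by
  rw [← Real.rpow_natCast]; norm_num

lemma XI_ta (A : MDS Ω P) {k : ℕ} (hk : k < A.n) :
    ∀ᵐ ω ∂P, ta P A.F (XI A) k ω
      = (Real.sqrt A.Bsq)⁻¹ ^ 3 * (P[fun ω' => |A.X (k+1) ω'| ^ ((2:ℝ) + 1)|A.F k]) ω := by
  have hB := Bsq_pos A
  have e : (fun ω => |XI A k ω| ^ 3) = ((Real.sqrt A.Bsq)⁻¹ ^ 3) • (fun ω' => |A.X (k+1) ω'| ^ ((2:ℝ) + 1)) := by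
    funext ω
    rw [XI_lt A hk]
    simp only [Pi.smul_apply, smul_eq_mul]
    rw [abs_mul, mul_pow, rp3, abs_of_nonneg (by positivity : (0:ℝ) ≤ (Real.sqrt A.Bsq)⁻¹)]
  have := condExp_smul (μ := P) ((Real.sqrt A.Bsq)⁻¹ ^ 3) (fun ω' => |A.X (k+1) ω'| ^ ((2:ℝ) + 1)) (A.F k)
  unfold ta
  rw [e]
  filter_upwards [this] with ω hω
  rw [hω]; simp

lemma mkSetup (A : MDS Ω P) {γ ε δ : ℝ} (h1 : A.CondA1 δ) (h2 : A.CondA2 1 ε) (h4 : A.CondA4 1 γ) :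
    Setup P A.F A.n (XI A) γ ε δ := by
  have hB := Bsq_pos A
  have hb : 0 < Real.sqrt A.Bsq := Real.sqrt_pos.2 hB
  have hb2 : Real.sqrt A.Bsq ^ 2 = A.Bsq := Real.sq_sqrt hB.le
  obtain ⟨d0, d1, hd⟩ := h1
  obtain ⟨e0, e1, ei, he⟩ := h2
  obtain ⟨g0, g1, gi, hg⟩ := h4
  have SG : ∀ᵐ ω ∂P, ∀ k, k < A.n → sg P A.F (XI A) k ω = (A.Bsq)⁻¹ * (P[fun ω' => (A.X (k+1) ω') ^ 2|A.F k]) ω := by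
    rw [ae_all_iff]; intro k
    by_cases hk : k < A.n
    · filter_upwards [XI_sg A hk] with ω hω _ using hω
    · exact Filter.Eventually.of_forall fun ω h => absurd h hk
  have TA : ∀ᵐ ω ∂P, ∀ k, k < A.n → ta P A.F (XI A) k ω
      = (Real.sqrt A.Bsq)⁻¹ ^ 3 * (P[fun ω' => |A.X (k+1) ω'| ^ ((2:ℝ) + 1)|A.F k]) ω := by
    rw [ae_all_iff]; intro k
    by_cases hk : k < A.n
    · filter_upwards [XI_ta A hk] with ω hω _ using hω
    · exact Filter.Eventually.of_forall fun ω h => absurd h hk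
  refine ⟨A.F_mono, A.F_le, ?_, ?_, ?_, ?_, ?_, ?_, g0, g1, e0, e1, d0, d1⟩
  · intro k
    by_cases hk : k < A.n
    · rw [XI_lt A hk]
      exact (A.meas (k+1) (by omega) (by omega)).const_mul _
    · rw [XI_ge A hk]; exact stronglyMeasurable_zero
  · intro k
    by_cases hk : k < A.n
    · rw [XI_lt A hk]
      have := (ei (k+1) (by omega) (by omega)).const_mul (|(Real.sqrt A.Bsq)⁻¹| ^ 3)
      refine this.congr (Filter.Eventually.of_forall fun ω => ?_)
      simp only
      rw [rp3, abs_mul, mul_pow]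
    · rw [XI_ge A hk]; simp
  · intro k
    by_cases hk : k < A.n
    · rw [XI_lt A hk]
      have a1 := A.mean_zero (k+1) (by omega) (by omega)
      have a2 := condExp_smul (μ := P) (Real.sqrt A.Bsq)⁻¹ (A.X (k+1)) (A.F k)
      filter_upwards [a1, a2] with ω h1 h2
      have h2' : (P[fun ω => (Real.sqrt A.Bsq)⁻¹ * A.X (k + 1) ω|A.F k]) ω
        = (Real.sqrt A.Bsq)⁻¹ * (P[A.X (k+1)|A.F k]) ω := h2
      have h1' : (P[A.X (k+1)|A.F k]) ω = 0 := h1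
      rw [h2', h1', mul_zero]
    · rw [XI_ge A hk, condExp_zero]; simp
  · intro k
    by_cases hk : k < A.n
    · filter_upwards [SG, TA, hg (k+1) (by omega) (by omega)] with ω h1 h2 h3
      rw [h1 k hk, h2 k hk]
      rw [Real.rpow_one, Nat.add_sub_cancel] at h3
      calc _ ≤ (Real.sqrt A.Bsq)⁻¹ ^ 3 * _ := mul_le_mul_of_nonneg_left h3 (by positivity)
        _ = _ := by
          nth_rewrite 3 [← hb2]
          field_simp
    · have e1 : ta P A.F (XI A) k = 0 := by
        unfold ta; rw [XI_ge A hk]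
        simp
        rfl
      have e2 : sg P A.F (XI A) k = 0 := by
        unfold sg; rw [XI_ge A hk]
        simp
        rfl
      rw [e1, e2]; simp
  · filter_upwards [TA, he] with ω h1 h2
    rw [shift] at h2
    simp only [Nat.add_sub_cancel] at h2
    rw [Finset.sum_congr rfl fun k hk => h1 k (Finset.mem_range.1 hk), ← Finset.mul_sum]
    have e : A.Bsq ^ (((2:ℝ) + 1) / 2) = Real.sqrt A.Bsq ^ 3 := by
      rw [Real.sqrt_eq_rpow, ← Real.rpow_natCast, ← Real.rpow_mul hB.le]; norm_num
    rw [e, Real.rpow_one] at h2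
    calc _ ≤ (Real.sqrt A.Bsq)⁻¹ ^ 3 * _ := mul_le_mul_of_nonneg_left h2 (by positivity)
      _ = _ := by field_simp
  · filter_upwards [SG, hd] with ω h1 h2
    unfold MDS.CV at h2
    rw [shift] at h2
    simp only [Nat.add_sub_cancel] at h2
    rw [Finset.sum_congr rfl fun k hk => h1 k (Finset.mem_range.1 hk), ← Finset.mul_sum]
    generalize ∑ i ∈ Finset.range A.n, (P[fun ω' => (A.X (i+1) ω') ^ 2|A.F i]) ω = Y at h2 ⊢
    have e : A.Bsq⁻¹ * Y - 1 = A.Bsq⁻¹ * (Y - A.Bsq) := by field_simp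
    rw [e, abs_mul, abs_of_pos (inv_pos.2 hB)]
    calc _ ≤ A.Bsq⁻¹ * _ := mul_le_mul_of_nonneg_left h2 (by positivity)
      _ = _ := by field_simp

lemma SS_XI (A : MDS Ω P) (ω : Ω) : SS (XI A) A.n ω = (Real.sqrt A.Bsq)⁻¹ * A.S ω := by
  unfold SS MDS.S
  rw [shift, Finset.mul_sum]
  refine Finset.sum_congr rfl fun k hk => ?_
  rw [XI_lt A (Finset.mem_range.1 hk)]

lemma QQ_XI (A : MDS Ω P) (ω : Ω) : Real.sqrt (QQ (XI A) A.n ω) = (Real.sqrt A.Bsq)⁻¹ * Real.sqrt (A.QV ω) := by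
  have hB := Bsq_pos A
  have : QQ (XI A) A.n ω = (A.Bsq)⁻¹ * A.QV ω := by
    unfold QQ MDS.QV
    rw [shift, Finset.mul_sum]
    refine Finset.sum_congr rfl fun k hk => ?_
    rw [XI_lt A (Finset.mem_range.1 hk)]
    simp only
    rw [mul_pow, inv_pow, Real.sq_sqrt hB.le]
  rw [this, Real.sqrt_mul (by positivity), Real.sqrt_inv]

lemma S_zero (A : MDS Ω P) (ω : Ω) (h : Real.sqrt (A.QV ω) = 0) : A.S ω = 0 := by
  have h0 : A.QV ω = 0 := by
    have : 0 ≤ A.QV ω := Finset.sum_nonneg fun i _ => sq_nonneg _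
    rwa [Real.sqrt_eq_zero this] at h
  unfold MDS.QV at h0
  rw [Finset.sum_eq_zero_iff_of_nonneg fun i _ => sq_nonneg _] at h0
  exact Finset.sum_eq_zero fun i hi => by simpa using h0 i hi

lemma upper1 (A : MDS Ω P) {γ ε δ x : ℝ} (h1 : A.CondA1 δ) (h2 : A.CondA2 1 ε) (h4 : A.CondA4 1 γ)
    (hx : 0 ≤ x) (hlg : x * γ ≤ 1 / 1000) :
    P.real {ω | x ≤ A.W ω} ≤ Real.exp (CF * RR x γ ε δ) * Nt x := by
  have hb : 0 < Real.sqrt A.Bsq := Real.sqrt_pos.2 (Bsq_pos A)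
  refine le_trans (measureReal_mono ?_ (measure_ne_top _ _)) ((mkSetup A h1 h2 h4).final hx hlg)
  intro ω hω
  have hω : x ≤ A.W ω := hω
  change x * Real.sqrt (QQ (XI A) A.n ω) ≤ SS (XI A) A.n ω
  rw [SS_XI, QQ_XI, mul_left_comm]
  apply mul_le_mul_of_nonneg_left _ (by positivity)
  rcases (Real.sqrt_nonneg (A.QV ω)).eq_or_lt with h0 | h0
  · rw [S_zero A ω h0.symm, ← h0]; simp
  · unfold MDS.W at hω
    rwa [le_div_iff₀ h0] at hω

lemma upper2 (A : MDS Ω P) {γ ε δ x : ℝ} (h1 : A.CondA1 δ) (h2 : A.CondA2 1 ε) (h4 : A.CondA4 1 γ)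
    (hx : 0 ≤ x) (hlg : x * γ ≤ 1 / 1000) :
    P.real {ω | A.W ω ≤ -x} ≤ Real.exp (CF * RR x γ ε δ) * Nt x := by
  have hb : 0 < Real.sqrt A.Bsq := Real.sqrt_pos.2 (Bsq_pos A)
  refine le_trans (measureReal_mono ?_ (measure_ne_top _ _)) ((mkSetup A h1 h2 h4).neg.final hx hlg)
  intro ω hω
  have hω : A.W ω ≤ -x := hω
  have e1 : SS (fun k ω => - XI A k ω) A.n ω = - SS (XI A) A.n ω := by simp [SS]
  have e2 : QQ (fun k ω => - XI A k ω) A.n ω = QQ (XI A) A.n ω := by simp [QQ]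
  change x * Real.sqrt (QQ (fun k ω => - XI A k ω) A.n ω) ≤ SS (fun k ω => - XI A k ω) A.n ω
  rw [e1, e2, SS_XI, QQ_XI, mul_left_comm, ← mul_neg]
  apply mul_le_mul_of_nonneg_left _ (by positivity)
  rcases (Real.sqrt_nonneg (A.QV ω)).eq_or_lt with h0 | h0
  · rw [S_zero A ω h0.symm, ← h0]; simp
  · unfold MDS.W at hω
    rw [div_le_iff₀ h0] at hω
    linarith

end
end SN

/-- Theorem 2.3 [ii]: upper bound under (A1), (A2), (A4), for `ρ = 1`. -/
theorem upper_bound_A1A2A4_rho_eq_one :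
    ∃ c : ℝ, 0 < c ∧
      ∀ (Ω : Type) [MeasurableSpace Ω] (P : Measure Ω), IsProbabilityMeasure P →
        ∀ (A : ℕ → MDS Ω P) (δ ε γ x : ℕ → ℝ),
          (∀ n, (A n).CondA1 (δ n)) →
          (∀ n, (A n).CondA2 1 (ε n)) →
          (∀ n, (A n).CondA4 1 (γ n)) →
          (∀ n, 0 ≤ x n) →
          Tendsto (fun n => x n * γ n) atTop (nhds 0) →
          ∀ᶠ n in atTop,
            (P {ω | x n ≤ (A n).W ω}).toReal / (1 - stdNormalCDF (x n)) ≤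
                Real.exp (c * (x n ^ 3 * ε n + x n ^ 2 * δ n ^ 2 + (1 + x n) * (x n * γ n + γ n * |Real.log (γ n)| + δ n + ε n ^ ((1 : ℝ) / 4) / (1 + x n ^ ((3 : ℝ) / 4))))) ∧
              (P {ω | (A n).W ω ≤ -x n}).toReal / stdNormalCDF (-x n) ≤
                Real.exp (c * (x n ^ 3 * ε n + x n ^ 2 * δ n ^ 2 + (1 + x n) * (x n * γ n + γ n * |Real.log (γ n)| + δ n + ε n ^ ((1 : ℝ) / 4) / (1 + x n ^ ((3 : ℝ) / 4))))) := by
  refine ⟨SN.CF, SN.CF_pos, ?_⟩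
  intro Ω _ P hP A δ ε γ x h1 h2 h4 hx hlim
  have ev : ∀ᶠ n in atTop, x n * γ n ≤ 1 / 1000 :=
    hlim.eventually (eventually_le_nhds (by norm_num))
  filter_upwards [ev] with n hn
  have N0 := SN.Nt_pos (x n)
  constructor
  · change _ / SN.Nt (x n) ≤ _
    rw [div_le_iff₀ N0]
    exact SN.upper1 (A n) (h1 n) (h2 n) (h4 n) (hx n) hn
  · rw [SN.cdf_neg, div_le_iff₀ N0]
    exact SN.upper2 (A n) (h1 n) (h2 n) (h4 n) (hx n) hn
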